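/- For each n ≥ 1 and m = n + 3, there exists a uniquely optimal graph in G_{n,m}, and this graph also uniquely maximizes the number of spanning trees over G_{n,m}. It is a balanced weak subdivision of K_{3,3}, specified up to isomorphism by the following additional conditions, where m ≡ r (mod 9) with r ∈ {−4, …, 4}: if r ∈ {0, 1, −1}, no further condition is needed; if r ∈ {2, 3} (respectively r ∈ {−2, −3}), the |r| chains that are one edge longer (respectively shorter) than the others correspond to a matching (pairwise non-adjacent edges) in K_{3,3}; if r = 4, the four longer chains correspond to the disjoint union of a path with three edges and a single edge in K_{3,3}; if r = −4, the four shorter chains correspond to two disjoint paths with two edges each in K_{3,3}. -/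

import Mathlib

open Classical Finset

noncomputable section

structure Multigraph where
  V : Type
  E : Type
  [fintV : Fintype V]
  [fintE : Fintype E]
  src : E → V
  tgt : E → V

attribute [instance] Multigraph.fintV Multigraph.fintE

namespace Multigraph

variable (G : Multigraph)

def nV : ℕ := Fintype.card G.V

def nE : ℕ := Fintype.card G.E

def stepOn (S : Finset G.E) (u v : G.V) : Prop :=
  ∃ e ∈ S, (G.src e = u ∧ G.tgt e = v) ∨ (G.src e = v ∧ G.tgt e = u)

def ConnOn (S : Finset G.E) : Prop :=
  ∀ u v : G.V, Relation.ReflTransGen (G.stepOn S) u v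

def Connected : Prop := G.ConnOn Finset.univ

def Disconnects (F : Finset G.E) : Prop := ¬ G.ConnOn (Finset.univ \ F)

def d (i : ℕ) : ℕ :=
  ((Finset.univ : Finset (Finset G.E)).filter fun F => F.card = i ∧ G.Disconnects F).card

def rel (p : ℝ) : ℝ :=
  ∑ S : Finset G.E, if G.ConnOn S then p ^ S.card * (1 - p) ^ (G.nE - S.card) else 0

def IsBridge (e : G.E) : Prop := G.Disconnects {e}

def Bridgeless : Prop := ∀ e : G.E, ¬ G.IsBridge e

def treeCount : ℕ :=
  ((Finset.univ : Finset (Finset G.E)).filter fun S => S.card + 1 = G.nV ∧ G.ConnOn S).card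

def edgeConnectivity : ℕ :=
  sInf {i : ℕ | ∃ F : Finset G.E, F.card = i ∧ G.Disconnects F}

def deg (v : G.V) : ℕ :=
  (Finset.univ.filter fun e => G.src e = v).card +
    (Finset.univ.filter fun e => G.tgt e = v).card

def cutEdges (A : Finset G.V) : Finset G.E :=
  Finset.univ.filter fun e =>
    (G.src e ∈ A ∧ G.tgt e ∉ A) ∨ (G.src e ∉ A ∧ G.tgt e ∈ A)

def IsCut (F : Finset G.E) : Prop :=
  ∃ A : Finset G.V, A.Nonempty ∧ A ≠ Finset.univ ∧ F = G.cutEdges A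

def IsBond (F : Finset G.E) : Prop :=
  G.IsCut F ∧ ∀ F' ⊆ F, G.IsCut F' → F' = F

def bondCount (s : ℕ) : ℕ :=
  ((Finset.univ : Finset (Finset G.E)).filter fun F => F.card = s ∧ G.IsBond F).card

def Adj (u v : G.V) : Prop :=
  ∃ e : G.E, (G.src e = u ∧ G.tgt e = v) ∨ (G.src e = v ∧ G.tgt e = u)

def IsSimple : Prop :=
  (∀ e : G.E, G.src e ≠ G.tgt e) ∧
    ∀ e f : G.E,
      ((G.src e = G.src f ∧ G.tgt e = G.tgt f) ∨ (G.src e = G.tgt f ∧ G.tgt e = G.src f)) →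
        e = f

end Multigraph

def memG (G : Multigraph) (n m : ℕ) : Prop :=
  G.nV = n ∧ G.nE = m ∧ G.Connected

structure MGIso (G H : Multigraph) where
  vMap : G.V ≃ H.V
  eMap : G.E ≃ H.E
  ends_eq : ∀ e : G.E,
    (H.src (eMap e) = vMap (G.src e) ∧ H.tgt (eMap e) = vMap (G.tgt e)) ∨
    (H.src (eMap e) = vMap (G.tgt e) ∧ H.tgt (eMap e) = vMap (G.src e))

def IsIso (G H : Multigraph) : Prop := Nonempty (MGIso G H)

def pOptimal (G : Multigraph) (n m : ℕ) (p : ℝ) : Prop :=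
  memG G n m ∧ ∀ H : Multigraph, memG H n m → H.rel p ≤ G.rel p

def UniquelyOptimal (G : Multigraph) (n m : ℕ) : Prop :=
  memG G n m ∧ ∀ H : Multigraph, memG H n m → ¬ IsIso G H →
    ∀ p : ℝ, 0 < p → p < 1 → H.rel p < G.rel p

noncomputable instance quotFintype {α : Type} [Fintype α] {r : α → α → Prop} :
    Fintype (Quot r) :=
  letI := Classical.decEq (Quot r)
  Fintype.ofSurjective (Quot.mk r) fun q => Quot.exists_rep q

def zeroRel (D : Multigraph) (w : D.E → ℕ) : D.V → D.V → Prop :=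
  fun u v => ∃ e : D.E, w e = 0 ∧ D.src e = u ∧ D.tgt e = v

def chainNode (D : Multigraph) (w : D.E → ℕ) (e : D.E) (j : ℕ) :
    Quot (zeroRel D w) ⊕ (Σ f : D.E, Fin (w f - 1)) :=
  if h : 0 < j ∧ j < w e then Sum.inr ⟨e, ⟨j - 1, by omega⟩⟩
  else if j = 0 then Sum.inl (Quot.mk _ (D.src e))
  else Sum.inl (Quot.mk _ (D.tgt e))

def subdivide (D : Multigraph) (w : D.E → ℕ) : Multigraph where
  V := Quot (zeroRel D w) ⊕ (Σ f : D.E, Fin (w f - 1))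
  E := Σ f : D.E, Fin (w f)
  src f := chainNode D w f.1 f.2.val
  tgt f := chainNode D w f.1 (f.2.val + 1)

def ZeroAcyclic (D : Multigraph) (w : D.E → ℕ) : Prop :=
  Fintype.card (Quot (zeroRel D w)) +
      (Finset.univ.filter fun e : D.E => w e = 0).card = Fintype.card D.V

def IsWeakSubdivision (G D : Multigraph) (w : D.E → ℕ) : Prop :=
  ZeroAcyclic D w ∧ IsIso G (subdivide D w)

def IsWeakDistillation (D G : Multigraph) : Prop :=
  ∃ w : D.E → ℕ, IsWeakSubdivision G D w

def BalancedWeights {E : Type} (w : E → ℕ) : Prop := ∀ e f : E, w e ≤ w f + 1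

def memDk (k : ℕ) (D : Multigraph) : Prop :=
  D.Connected ∧ (∀ v : D.V, D.deg v = 3) ∧
    (∀ F : Finset D.E, D.Disconnects F → 3 ≤ F.card) ∧ D.nE = D.nV + k

def contractRel (G : Multigraph) (e : G.E) : G.V → G.V → Prop :=
  fun u v => u = G.src e ∧ v = G.tgt e

def Multigraph.contract (G : Multigraph) (e : G.E) : Multigraph :=
  letI := Classical.decEq G.E
  { V := Quot (contractRel G e)
    E := {f : G.E // f ≠ e}
    src := fun f => Quot.mk _ (G.src f.1)
    tgt := fun f => Quot.mk _ (G.tgt f.1) }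

def IsShiftOf (G G' : Multigraph) : Prop :=
  ∃ (H : Multigraph) (e e' : H.E), e ≠ e' ∧
    H.src e ≠ H.tgt e ∧ H.src e' ≠ H.tgt e' ∧
    H.IsBond {e, e'} ∧
    IsIso (H.contract e') G ∧ IsIso (H.contract e) G'

def EquivalentGraphs (G G' : Multigraph) : Prop :=
  Relation.ReflTransGen IsShiftOf G G'

def MovedEdge (G G' : Multigraph) (φ : G.E ≃ G'.E) (e : G.E) : Prop :=
  G.src e ≠ G.tgt e ∧ G'.src (φ e) ≠ G'.tgt (φ e) ∧
  ∃ ψ : Quot (contractRel G e) ≃ Quot (contractRel G' (φ e)),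
    ∀ f : G.E, f ≠ e →
      ((ψ (Quot.mk _ (G.src f)) = Quot.mk _ (G'.src (φ f)) ∧
        ψ (Quot.mk _ (G.tgt f)) = Quot.mk _ (G'.tgt (φ f))) ∨
       (ψ (Quot.mk _ (G.src f)) = Quot.mk _ (G'.tgt (φ f)) ∧
        ψ (Quot.mk _ (G.tgt f)) = Quot.mk _ (G'.src (φ f))))

def moveWeight {E : Type} (w : E → ℕ) (a b : E) : E → ℕ :=
  fun g => if g = b then w b + 1 else if g = a then w a - 1 else w g

def maxChains (D : Multigraph) (w : D.E → ℕ) : Finset D.E :=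
  Finset.univ.filter fun e => ∀ f : D.E, w f ≤ w e

def minChains (D : Multigraph) (w : D.E → ℕ) : Finset D.E :=
  Finset.univ.filter fun e => ∀ f : D.E, w e ≤ w f

def degIn (D : Multigraph) (S : Finset D.E) (v : D.V) : ℕ :=
  (S.filter fun e => D.src e = v).card + (S.filter fun e => D.tgt e = v).card

def IsMatchingIn (D : Multigraph) (S : Finset D.E) : Prop := ∀ v : D.V, degIn D S v ≤ 1

def IsPath3In (D : Multigraph) (S : Finset D.E) : Prop :=
  S.card = 3 ∧ (∀ v : D.V, degIn D S v ≤ 2) ∧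
    (Finset.univ.filter fun v : D.V => degIn D S v = 1).card = 2

def IsPath3PlusEdgeIn (D : Multigraph) (S : Finset D.E) : Prop :=
  S.card = 4 ∧ (∀ v : D.V, degIn D S v ≤ 2) ∧
    (Finset.univ.filter fun v : D.V => degIn D S v = 1).card = 4 ∧
    ∃ e ∈ S, degIn D S (D.src e) = 2 ∧ degIn D S (D.tgt e) = 2

def IsTwoPlusTwoIn (D : Multigraph) (S : Finset D.E) : Prop :=
  S.card = 4 ∧ (∀ v : D.V, degIn D S v ≤ 2) ∧
    (Finset.univ.filter fun v : D.V => degIn D S v = 1).card = 4 ∧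
    ∀ e ∈ S, degIn D S (D.src e) = 1 ∨ degIn D S (D.tgt e) = 1

def AdjEdges (D : Multigraph) (a b : D.E) : Prop :=
  ∃ v : D.V, (D.src a = v ∨ D.tgt a = v) ∧ (D.src b = v ∨ D.tgt b = v)

def incCount (D : Multigraph) (w : D.E → ℕ) (u : D.V) (c : ℕ) : ℕ :=
  (Finset.univ.filter fun e : D.E => D.src e = u ∧ w e = c).card +
    (Finset.univ.filter fun e : D.E => D.tgt e = u ∧ w e = c).card

def piV (D : Multigraph) (w : D.E → ℕ) (q : ℕ) (u : D.V) : ℤ :=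
  (incCount D w u (q + 1) : ℤ) -
    (if q = 0 then 0 else (incCount D w u (q - 1) : ℤ))

def BalancedPiV (D : Multigraph) (w : D.E → ℕ) (q : ℕ) : Prop :=
  ∀ u v : D.V, piV D w q u ≤ piV D w q v + 1

def stdWeight (m k : ℕ) : ℕ := (2 * m + 3 * k - 1) / (6 * k)

def IsBalancedWeighting (D : Multigraph) (w : D.E → ℕ) (m : ℕ) : Prop :=
  (∑ e : D.E, w e) = m ∧ BalancedWeights w ∧ ZeroAcyclic D w

def OnlyTrivialThreeBonds (D : Multigraph) : Prop :=
  ∀ F : Finset D.E, D.IsBond F → F.card = 3 →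
    ∃ u : D.V, F = Finset.univ.filter fun e => D.src e = u ∨ D.tgt e = u

def dipole3 : Multigraph where
  V := Fin 2
  E := Fin 3
  src _ := 0
  tgt _ := 1

def K4 : Multigraph where
  V := Fin 4
  E := {p : Fin 4 × Fin 4 // p.1 < p.2}
  src p := p.1.1
  tgt p := p.1.2

def K33 : Multigraph where
  V := Fin 3 ⊕ Fin 3
  E := Fin 3 × Fin 3
  src p := Sum.inl p.1
  tgt p := Sum.inr p.2

def prism : Multigraph where
  V := Fin 3 × Bool
  E := (Fin 3 × Bool) ⊕ Fin 3
  src := fun e => match e with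
    | Sum.inl (i, b) => (i, b)
    | Sum.inr i => (i, false)
  tgt := fun e => match e with
    | Sum.inl (i, b) => (i + 1, b)
    | Sum.inr i => (i, true)

def wagner : Multigraph where
  V := Fin 8
  E := Fin 8 ⊕ Fin 4
  src := fun e => match e with
    | Sum.inl i => i
    | Sum.inr j => ⟨j.val, by omega⟩
  tgt := fun e => match e with
    | Sum.inl i => i + 1
    | Sum.inr j => ⟨j.val + 4, by omega⟩

def petersen : Multigraph where
  V := Fin 5 × Bool
  E := Fin 5 ⊕ Fin 5 ⊕ Fin 5
  src := fun e => match e with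
    | Sum.inl i => (i, false)
    | Sum.inr (Sum.inl i) => (i, false)
    | Sum.inr (Sum.inr i) => (i, true)
  tgt := fun e => match e with
    | Sum.inl i => (i + 1, false)
    | Sum.inr (Sum.inl i) => (i, true)
    | Sum.inr (Sum.inr i) => (i + 2, true)

def k33Cond (m : ℕ) (w : K33.E → ℕ) : Prop :=
  ((m % 9 = 2 ∨ m % 9 = 3) → IsMatchingIn K33 (maxChains K33 w)) ∧
  ((m % 9 = 6 ∨ m % 9 = 7) → IsMatchingIn K33 (minChains K33 w)) ∧
  (m % 9 = 4 → IsPath3PlusEdgeIn K33 (maxChains K33 w)) ∧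
  (m % 9 = 5 → IsTwoPlusTwoIn K33 (minChains K33 w))

set_option linter.unusedSimpArgs false

abbrev Q4 := Fin 4 → ZMod 2

structure Good (H : Multigraph) (φ : H.E → Q4) : Prop where
  ne : Nonempty H.V
  cob : ∀ f : H.V → ZMod 2, ∑ e, (f (H.src e) + f (H.tgt e)) • φ e = 0
  conn : ∀ f : H.V → ZMod 2, (∀ e, f (H.src e) = f (H.tgt e)) → ∀ x y, f x = f y
  card : Fintype.card H.E = Fintype.card H.V + 3
  span : Submodule.span (ZMod 2) (Set.range φ) = ⊤

lemma z2_add_eq_zero (a b : ZMod 2) : a + b = 0 ↔ a = b := by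
  revert a b; decide

lemma connOn_iff (H : Multigraph) (S : Finset H.E) :
    H.ConnOn S ↔ ∀ f : H.V → ZMod 2, (∀ e ∈ S, f (H.src e) = f (H.tgt e)) → ∀ x y, f x = f y := by
  constructor
  · intro h f hf x y
    have := h x y
    induction this with
    | refl => rfl
    | tail _ hs ih =>
      obtain ⟨e, he, h1 | h1⟩ := hs
      · rw [ih, ← h1.1, ← h1.2, hf e he]
      · rw [ih, ← h1.1, ← h1.2, hf e he]
  · intro h u v
    have := h (fun x => if Relation.ReflTransGen (H.stepOn S) u x then 1 else 0) ?_ u v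
    · have hu : Relation.ReflTransGen (H.stepOn S) u u := Relation.ReflTransGen.refl
      by_contra hv
      simp [hu, hv] at this
    · intro e he
      have h1 : H.stepOn S (H.src e) (H.tgt e) := ⟨e, he, Or.inl ⟨rfl, rfl⟩⟩
      have h2 : H.stepOn S (H.tgt e) (H.src e) := ⟨e, he, Or.inr ⟨rfl, rfl⟩⟩
      have : Relation.ReflTransGen (H.stepOn S) u (H.src e) ↔
          Relation.ReflTransGen (H.stepOn S) u (H.tgt e) :=
        ⟨fun h => h.tail h1, fun h => h.tail h2⟩
      simp [this]

def dlt (H : Multigraph) : (H.V → ZMod 2) →ₗ[ZMod 2] (H.E → ZMod 2) where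
  toFun f e := f (H.src e) + f (H.tgt e)
  map_add' f g := by ext e; simp; ring
  map_smul' a f := by ext e; simp; ring

lemma finrank_dlt (H : Multigraph) (ne : Nonempty H.V)
    (conn : ∀ f : H.V → ZMod 2, (∀ e, f (H.src e) = f (H.tgt e)) → ∀ x y, f x = f y) :
    Module.finrank (ZMod 2) (LinearMap.range (dlt H)) + 1 = Fintype.card H.V := by
  have h := LinearMap.finrank_range_add_finrank_ker (dlt H)
  rw [Module.finrank_fintype_fun_eq_card] at h
  rw [← h]
  congr 1
  symm
  obtain ⟨x0⟩ := ne
  have hk : LinearMap.ker (dlt H) = Submodule.span (ZMod 2) {fun _ => (1 : ZMod 2)} := by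
    ext f
    rw [LinearMap.mem_ker, Submodule.mem_span_singleton]
    constructor
    · intro hf
      refine ⟨f x0, ?_⟩
      ext y
      simp
      apply conn f
      intro e
      have := congrFun hf e
      exact (z2_add_eq_zero _ _).1 this
    · rintro ⟨a, rfl⟩
      ext e
      simp [dlt]
      right; rfl
  rw [hk]
  apply finrank_span_singleton
  intro h
  have := congrFun h x0
  simp at this

lemma exists_good (H : Multigraph) (ne : Nonempty H.V)
    (conn : H.Connected) (card : Fintype.card H.E = Fintype.card H.V + 3) :
    ∃ φ, Good H φ := by
  have conn' : ∀ f : H.V → ZMod 2, (∀ e, f (H.src e) = f (H.tgt e)) → ∀ x y, f x = f y := by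
    intro f hf
    exact (connOn_iff H _).1 conn f (fun e _ => hf e)
  have h1 := finrank_dlt H ne conn'
  have h2 := Submodule.finrank_quotient_add_finrank (LinearMap.range (dlt H))
  rw [Module.finrank_fintype_fun_eq_card] at h2
  have h3 : Module.finrank (ZMod 2) ((H.E → ZMod 2) ⧸ LinearMap.range (dlt H)) =
      Module.finrank (ZMod 2) Q4 := by
    simp [Q4]
    omega
  let eq := LinearEquiv.ofFinrankEq _ _ h3
  let Φ : (H.E → ZMod 2) →ₗ[ZMod 2] Q4 := eq.toLinearMap ∘ₗ (LinearMap.range (dlt H)).mkQ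
  have hΦ : ∀ g : H.E → ZMod 2, Φ g = ∑ e, g e • Φ (Pi.single e 1) := by
    intro g
    conv_lhs => rw [← Finset.univ_sum_single g]
    rw [map_sum]
    refine Finset.sum_congr rfl fun e _ => ?_
    rw [← map_smul]
    congr 1
    ext x
    simp [Pi.single_apply]
  have hsurj : Function.Surjective Φ := eq.surjective.comp (Submodule.mkQ_surjective _)
  refine ⟨fun e => Φ (Pi.single e 1), ne, ?_, conn', card, ?_⟩
  · intro f
    have := hΦ (dlt H f)
    have h0 : Φ (dlt H f) = 0 := by
      simp [Φ]
    rw [h0] at this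
    exact this.symm
  · rw [eq_top_iff]
    rintro q -
    obtain ⟨g, rfl⟩ := hsurj q
    rw [hΦ]
    refine Submodule.sum_mem _ fun e _ => Submodule.smul_mem _ _ (Submodule.subset_span ⟨e, rfl⟩)

lemma Good.star {H : Multigraph} {φ : H.E → Q4} (h : Good H φ) (g : H.E → ZMod 2) :
    ∑ e, g e • φ e = 0 ↔ ∃ f : H.V → ZMod 2, ∀ e, g e = f (H.src e) + f (H.tgt e) := by
  let Φ : (H.E → ZMod 2) →ₗ[ZMod 2] Q4 := Fintype.linearCombination (ZMod 2) φ
  have hΦ : ∀ g, Φ g = ∑ e, g e • φ e := fun g => by simp [Φ, Fintype.linearCombination_apply]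
  have hr : LinearMap.range Φ = ⊤ := by
    rw [← h.span]; exact Fintype.range_linearCombination (ZMod 2) φ
  have h1 := finrank_dlt H h.ne h.conn
  have h2 := LinearMap.finrank_range_add_finrank_ker Φ
  rw [hr, finrank_top, Module.finrank_fintype_fun_eq_card, Module.finrank_fintype_fun_eq_card] at h2
  have hle : LinearMap.range (dlt H) ≤ LinearMap.ker Φ := by
    rintro _ ⟨f, rfl⟩
    rw [LinearMap.mem_ker, hΦ]
    exact h.cob f
  have heq := Submodule.eq_of_le_of_finrank_eq hle (by
    have := h.card
    simp at h2
    omega)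
  rw [← hΦ, ← LinearMap.mem_ker, ← heq]
  constructor
  · rintro ⟨f, rfl⟩
    exact ⟨f, fun e => rfl⟩
  · rintro ⟨f, hf⟩
    exact ⟨f, by ext e; rw [hf]; rfl⟩

def Ind {E : Type} [Fintype E] (φ : E → Q4) (F : Finset E) : Prop :=
  ∀ g : E → ZMod 2, (∀ e, e ∉ F → g e = 0) → ∑ e, g e • φ e = 0 → g = 0

lemma Good.connOn_iff_ind {H : Multigraph} {φ : H.E → Q4} (h : Good H φ) (F : Finset H.E) :
    H.ConnOn (univ \ F) ↔ Ind φ F := by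
  rw [connOn_iff]
  constructor
  · intro hc g hg h0
    obtain ⟨f, hf⟩ := (h.star g).1 h0
    have := hc f (by
      intro e he
      rw [← z2_add_eq_zero, ← hf, hg]
      simpa using he)
    ext e
    rw [hf, this (H.src e) (H.tgt e)]
    exact (z2_add_eq_zero _ _).2 rfl
  · intro hi f hf
    have := hi (fun e => f (H.src e) + f (H.tgt e)) (by
      intro e he
      exact (z2_add_eq_zero _ _).2 (hf e (by simpa using he))) (h.cob f)
    apply h.conn f
    intro e
    exact (z2_add_eq_zero _ _).1 (congrFun this e)

lemma Good.ind_iff {H : Multigraph} {φ : H.E → Q4} (h : Good H φ) (F : Finset H.E) :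
    Ind φ F ↔ ∀ f : H.V → ZMod 2, (∀ e, e ∉ F → f (H.src e) = f (H.tgt e)) →
      ∀ e, f (H.src e) = f (H.tgt e) := by
  rw [← h.connOn_iff_ind, connOn_iff]
  constructor
  · intro hc f hf e
    exact hc f (fun e he => hf e (by simpa using he)) _ _
  · intro hc f hf
    exact h.conn f (hc f fun e he => hf e (by simpa using he))

lemma Ind.card_le {E : Type} [Fintype E] {φ : E → Q4} {F : Finset E} (h : Ind φ F) :
    F.card ≤ 4 := by
  have : LinearIndependent (ZMod 2) (fun e : F => φ e) := by
    rw [Fintype.linearIndependent_iff]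
    intro g hg i
    have := h (fun e => if he : e ∈ F then g ⟨e, he⟩ else 0) (by intro e he; simp [he]) (by
      rw [← hg, ← Finset.sum_subset (Finset.subset_univ F)]
      · rw [← Finset.sum_coe_sort F]
        simp
      · intro e _ he
        simp [he])
    have := congrFun this i
    simpa using this
  have := this.fintype_card_le_finrank
  simpa using this

def Nk (H : Multigraph) (k : ℕ) : ℕ :=
  (univ.filter fun F : Finset H.E => F.card = k ∧ H.ConnOn (univ \ F)).card

lemma Good.rel_eq {H : Multigraph} {φ : H.E → Q4} (h : Good H φ) (p : ℝ) :
    H.rel p = ∑ k ∈ range 5, (Nk H k : ℝ) * (p ^ (H.nE - k) * (1 - p) ^ k) := by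
  have h1 : H.rel p = ∑ F : Finset H.E, if H.ConnOn (univ \ F) then
      p ^ (H.nE - F.card) * (1 - p) ^ F.card else 0 := by
    unfold Multigraph.rel
    refine Fintype.sum_equiv (Equiv.mk compl compl compl_compl compl_compl) _ _ fun S => ?_
    have h3 : (univ \ Sᶜ : Finset H.E) = S := by rw [← compl_eq_univ_sdiff, compl_compl]
    simp only [Equiv.coe_fn_mk, h3, card_compl]
    have : S.card ≤ H.nE := Finset.card_le_univ S
    unfold Multigraph.nE at *
    rw [Nat.sub_sub_self this]
  rw [h1]
  have h2 : ∀ k, (Nk H k : ℝ) * (p ^ (H.nE - k) * (1 - p) ^ k) = ∑ F : Finset H.E,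
      if F.card = k then (if H.ConnOn (univ \ F) then
      p ^ (H.nE - F.card) * (1 - p) ^ F.card else 0) else 0 := by
    intro k
    unfold Nk
    rw [← nsmul_eq_mul, ← Finset.sum_const, Finset.sum_filter]
    refine Finset.sum_congr rfl fun F _ => ?_
    by_cases h4 : F.card = k
    · subst h4; simp
    · simp [h4]
  simp_rw [h2]
  rw [Finset.sum_comm]
  refine Finset.sum_congr rfl fun F _ => ?_
  rw [Finset.sum_ite_eq]
  split_ifs with h3 h4 h4
  · rfl
  · exfalso
    apply h4
    have := ((h.connOn_iff_ind F).1 h3).card_le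
    simp; omega
  · rfl
  · rfl

lemma Good.treeCount_eq {H : Multigraph} {φ : H.E → Q4} (h : Good H φ) :
    H.treeCount = Nk H 4 := by
  unfold Multigraph.treeCount Nk
  refine Finset.card_nbij' (fun S => Sᶜ) (fun S => Sᶜ) ?_ ?_ ?_ ?_
  · intro S hS
    simp only [coe_filter, mem_univ, true_and, Set.mem_ofPred_eq] at hS ⊢
    rw [← compl_eq_univ_sdiff, compl_compl, card_compl]
    refine ⟨?_, hS.2⟩
    have := h.card
    have := hS.1
    unfold Multigraph.nV at this
    omega
  · intro S hS
    simp only [coe_filter, mem_univ, true_and, Set.mem_ofPred_eq] at hS ⊢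
    rw [← compl_eq_univ_sdiff] at hS
    refine ⟨?_, hS.2⟩
    have := h.card
    have h5 := hS.1
    have := Finset.card_compl S
    have : 0 < Fintype.card H.V := Fintype.card_pos_iff.2 h.ne
    unfold Multigraph.nV
    omega
  · intro S _; simp
  · intro S _; simp

section lab
variable {E D : Type} [Fintype E] [Fintype D] (φ : E → Q4) (ψ : D → Q4) (ℓ : E → Option D)

def cls (d : D) : Finset E := univ.filter fun e => ℓ e = some d

lemma ind_image (hl : ∀ e, φ e = (ℓ e).elim 0 ψ) (I : Finset D) (s : D → E)
    (hs : ∀ d ∈ I, ℓ (s d) = some d) : Ind φ (I.image s) ↔ Ind ψ I := by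
  have inj : Set.InjOn s I := by
    intro a ha b hb hab
    have h1 := hs a ha
    have h2 := hs b hb
    rw [hab, h2] at h1
    exact (Option.some_injective _ h1).symm
  have hφ : ∀ d ∈ I, φ (s d) = ψ d := by
    intro d hd; rw [hl, hs d hd]; rfl
  constructor
  · intro h g hg h0
    have := h (fun e => ∑ d ∈ I, if s d = e then g d else 0) (by
      intro e he
      refine Finset.sum_eq_zero fun d hd => ?_
      rw [if_neg]
      rintro rfl
      exact he (Finset.mem_image_of_mem _ hd)) (by
      rw [← h0]
      simp_rw [Finset.sum_smul]
      rw [Finset.sum_comm, ← Finset.sum_subset (Finset.subset_univ I)]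
      · refine Finset.sum_congr rfl fun d hd => ?_
        simp [ite_smul, hφ d hd]
      · intro d _ hd; simp [hg d hd])
    ext d
    by_cases hd : d ∈ I
    · have h5 := congrFun this (s d)
      simp only [Pi.zero_apply] at h5 ⊢
      rw [← h5]
      symm
      rw [Finset.sum_eq_single_of_mem d hd]
      · simp
      · intro b hb hbd
        rw [if_neg]
        intro hh
        exact hbd (inj hb hd hh)
    · exact hg d hd
  · intro h g hg h0
    have := h (fun d => if d ∈ I then g (s d) else 0) (by intro d hd; simp [hd]) (by
      rw [← h0, ← Finset.sum_subset (Finset.subset_univ (I.image s)),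
        ← Finset.sum_subset (Finset.subset_univ I), Finset.sum_image inj]
      · refine Finset.sum_congr rfl fun d hd => ?_
        simp [hd, hφ d hd]
      · intro d _ hd; simp [hd]
      · intro e _ he; simp [hg e he])
    ext e
    by_cases he : e ∈ I.image s
    · obtain ⟨d, hd, rfl⟩ := Finset.mem_image.1 he
      have := congrFun this d
      simpa [hd] using this
    · exact hg e he

lemma ind_lab (hl : ∀ e, φ e = (ℓ e).elim 0 ψ) (F : Finset E) (h : Ind φ F) :
    (∀ e ∈ F, ∃ d, ℓ e = some d) ∧ Set.InjOn ℓ F := by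
  constructor
  · intro e he
    by_contra hc
    have hn : ℓ e = none := by
      cases h1 : ℓ e with
      | none => rfl
      | some d => exact absurd ⟨d, h1⟩ hc
    have := h (Pi.single e 1) (by
      intro x hx
      rw [Pi.single_apply, if_neg]; rintro rfl; exact hx he) (by
      simp [Pi.single_apply, ite_smul, hl, hn])
    have := congrFun this e
    simp at this
  · intro a ha b hb hab
    by_contra hne
    have := h (Pi.single a 1 + Pi.single b 1) (by
      intro x hx
      have h1 : x ≠ a := by rintro rfl; exact hx ha
      have h2 : x ≠ b := by rintro rfl; exact hx hb
      simp [Pi.single_apply, h1, h2]) (by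
      simp only [Pi.add_apply, add_smul, Finset.sum_add_distrib]
      simp only [Pi.single_apply, ite_smul, one_smul, zero_smul, Finset.sum_ite_eq', mem_univ, if_true]
      rw [hl, hl, hab]
      ext i
      exact (z2_add_eq_zero _ _).2 rfl)
    have := congrFun this a
    simp [Pi.single_apply, hne] at this

lemma card_ind (hl : ∀ e, φ e = (ℓ e).elim 0 ψ) (k : ℕ) :
    (univ.filter fun F : Finset E => F.card = k ∧ Ind φ F).card =
      ∑ I : Finset D, if I.card = k ∧ Ind ψ I then ∏ d ∈ I, (cls ℓ d).card else 0 := by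
  rw [← Finset.sum_filter]
  rw [Finset.card_eq_sum_card_fiberwise
    (f := fun F : Finset E => univ.filter fun d => ∃ e ∈ F, ℓ e = some d)
    (t := univ.filter fun I : Finset D => I.card = k ∧ Ind ψ I)]
  · refine Finset.sum_congr rfl fun I hI => ?_
    rw [← Finset.card_pi]
    symm
    simp only [mem_filter, mem_univ, true_and] at hI
    have key : ∀ (g : (a : D) → a ∈ I → E), g ∈ I.pi (cls ℓ) → ∀ a (ha : a ∈ I), ℓ (g a ha) = some a := by
      intro g hg a ha
      have := Finset.mem_pi.1 hg a ha
      simpa [cls] using this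
    refine Finset.card_nbij (fun g => I.attach.image fun a => g a.1 a.2) ?_ ?_ ?_
    · intro g hg
      have hk := key g hg
      by_cases hE : Nonempty E
      swap
      · have hI0 : I = ∅ := by
          rw [Finset.eq_empty_iff_forall_notMem]
          intro a ha; exact hE ⟨g a ha⟩
        subst hI0
        simp only [coe_filter, mem_filter, mem_univ, true_and, Set.mem_ofPred_eq]
        refine ⟨⟨by simpa using hI.1, ?_⟩, by simp⟩
        intro g _ _
        ext e
        exact absurd ⟨e⟩ hE
      obtain ⟨e0⟩ := hE
      let s : D → E := fun d => if hd : d ∈ I then g d hd else e0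
      have him : (I.attach.image fun a => g a.1 a.2) = I.image s := by
        ext e
        simp only [mem_image, mem_attach, true_and, Subtype.exists]
        constructor
        · rintro ⟨a, ha, rfl⟩
          exact ⟨a, ha, by simp [s, ha]⟩
        · rintro ⟨a, ha, rfl⟩
          exact ⟨a, ha, by simp [s, ha]⟩
      have hs : ∀ d ∈ I, ℓ (s d) = some d := by
        intro d hd; simp only [s, hd, dif_pos]; exact hk d hd
      have inj : Set.InjOn s I := by
        intro a ha b hb hab
        have h1 := hs a ha
        have h2 := hs b hb
        rw [hab, h2] at h1
        exact (Option.some_injective _ h1).symm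
      simp only [coe_filter, mem_filter, mem_univ, true_and, Set.mem_ofPred_eq]
      rw [him, Finset.card_image_of_injOn inj, ind_image φ ψ ℓ hl I s hs]
      refine ⟨hI, ?_⟩
      ext d
      simp only [mem_filter, mem_univ, true_and, mem_image]
      constructor
      · rintro ⟨e, ⟨a, ha, rfl⟩, h2⟩
        rw [hs a ha] at h2
        rw [← Option.some_injective _ h2]; exact ha
      · intro hd
        exact ⟨_, ⟨d, hd, rfl⟩, hs d hd⟩
    · intro g hg g' hg' hgg
      have hk := key g hg
      have hk' := key g' hg'
      ext a ha
      have : g a ha ∈ I.attach.image fun a => g' a.1 a.2 := by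
        simp only at hgg
        rw [← hgg]
        exact Finset.mem_image.2 ⟨⟨a, ha⟩, Finset.mem_attach _ _, rfl⟩
      obtain ⟨⟨b, hb⟩, -, h2⟩ := Finset.mem_image.1 this
      have h3 := hk a ha
      rw [← h2, hk' b hb] at h3
      have := Option.some_injective _ h3
      subst this
      exact h2.symm
    · intro F hF
      simp only [coe_filter, mem_filter, mem_univ, true_and, Set.mem_ofPred_eq] at hF
      obtain ⟨⟨hF1, hF2⟩, hF3⟩ := hF
      obtain ⟨l1, l2⟩ := ind_lab φ ψ ℓ hl F hF2
      have hex : ∀ d ∈ I, ∃ e, e ∈ F ∧ ℓ e = some d := by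
        intro d hd
        rw [← hF3] at hd
        simpa using hd
      choose s hs1 hs2 using hex
      refine ⟨s, ?_, ?_⟩
      · rw [Finset.mem_coe, Finset.mem_pi]
        intro a ha
        simpa [cls] using hs2 a ha
      · ext e
        simp only [mem_image, mem_attach, true_and, Subtype.exists]
        constructor
        · rintro ⟨a, ha, rfl⟩
          exact hs1 a ha
        · intro he
          obtain ⟨d, hd⟩ := l1 e he
          have hdI : d ∈ I := by
            rw [← hF3]; simp; exact ⟨e, he, hd⟩
          exact ⟨d, hdI, l2 (hs1 d hdI) he (by rw [hs2 d hdI, hd])⟩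
  · intro F hF
    simp only [coe_filter, mem_univ, true_and, Set.mem_ofPred_eq] at hF ⊢
    obtain ⟨hF1, hF2⟩ := hF
    obtain ⟨l1, l2⟩ := ind_lab φ ψ ℓ hl F hF2
    set I := univ.filter fun d => ∃ e ∈ F, ℓ e = some d with hIdef
    have hex : ∀ d ∈ I, ∃ e, e ∈ F ∧ ℓ e = some d := by
      intro d hd
      simpa [hIdef] using hd
    by_cases hE : Nonempty E
    swap
    · have hI0 : I = ∅ := by
        rw [Finset.eq_empty_iff_forall_notMem]
        intro a ha; exact hE ⟨(hex a ha).choose⟩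
      have hF0 : F = ∅ := by
        rw [Finset.eq_empty_iff_forall_notMem]
        intro a ha; exact hE ⟨a⟩
      rw [hI0]
      rw [hF0] at hF1
      refine ⟨hF1, ?_⟩
      intro g hg _
      ext e; exact hg e (by simp)
    choose! s hs1 hs2 using hex
    have him : I.image s = F := by
      ext e
      simp only [mem_image]
      constructor
      · rintro ⟨a, ha, rfl⟩
        exact hs1 a ha
      · intro he
        obtain ⟨d, hd⟩ := l1 e he
        have hdI : d ∈ I := by
          simp [hIdef]; exact ⟨e, he, hd⟩
        exact ⟨d, hdI, l2 (hs1 d hdI) he (by rw [hs2 d hdI, hd])⟩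
    have inj : Set.InjOn s I := by
      intro a ha b hb hab
      have h1 := hs2 a ha
      have h2 := hs2 b hb
      rw [hab, h2] at h1
      exact (Option.some_injective _ h1).symm
    rw [← ind_image φ ψ ℓ hl I s hs2, him]
    refine ⟨?_, hF2⟩
    rw [← hF1, ← him, Finset.card_image_of_injOn inj]
end lab

def red (H : Multigraph) (e : H.E) (hne : H.src e ≠ H.tgt e) (x : H.V) : {x // x ≠ H.tgt e} :=
  if h : x = H.tgt e then ⟨H.src e, hne⟩ else ⟨x, h⟩

def ctr (H : Multigraph) (e : H.E) (hne : H.src e ≠ H.tgt e) : Multigraph where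
  V := {x : H.V // x ≠ H.tgt e}
  E := {f : H.E // f ≠ e}
  src f := red H e hne (H.src f.1)
  tgt f := red H e hne (H.tgt f.1)

lemma red_val (H : Multigraph) (e : H.E) (hne : H.src e ≠ H.tgt e) (x : {x // x ≠ H.tgt e}) :
    red H e hne x.1 = x := by
  unfold red
  rw [dif_neg x.2]

lemma red_ends (H : Multigraph) (e : H.E) (hne : H.src e ≠ H.tgt e) :
    red H e hne (H.src e) = red H e hne (H.tgt e) := by
  unfold red
  rw [dif_neg hne, dif_pos rfl]

lemma sum_ne {E M : Type} [Fintype E] [AddCommMonoid M] (e : E) (g : E → M) :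
    ∑ x, g x = g e + ∑ x : {x // x ≠ e}, g x.1 := by
  have := Finset.sum_erase_add (univ : Finset E) g (mem_univ e)
  rw [← this, add_comm]
  congr 1
  exact (Finset.sum_subtype _ (by intro x; simp) g)

lemma Good.ctr {H : Multigraph} {φ : H.E → Q4} (h : Good H φ) (e : H.E)
    (hne : H.src e ≠ H.tgt e)
    (hs : Submodule.span (ZMod 2) (Set.range fun f : {f // f ≠ e} => φ f.1) = ⊤) :
    Good (ctr H e hne) (fun f => φ f.1) where
  ne := ⟨⟨H.src e, hne⟩⟩
  cob f := by
    have := h.cob (f ∘ red H e hne)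
    rw [sum_ne e] at this
    simp only [Function.comp, red_ends H e hne] at this
    rw [(z2_add_eq_zero _ _).2 rfl, zero_smul, zero_add] at this
    exact this
  conn f hf x y := by
    have := h.conn (f ∘ red H e hne) (by
      intro g
      by_cases hg : g = e
      · subst hg; exact congrArg f (red_ends H g hne)
      · exact hf ⟨g, hg⟩) x.1 y.1
    have h1 := congrArg f (red_val H e hne x)
    have h2 := congrArg f (red_val H e hne y)
    exact h1.symm.trans (this.trans h2)
  card := by
    have h1 : Fintype.card {f // f ≠ e} = Fintype.card H.E - 1 := by
      simp [Fintype.card_subtype_compl]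
    have h2 : Fintype.card {x // x ≠ H.tgt e} = Fintype.card H.V - 1 := by
      simp [Fintype.card_subtype_compl]
    have : 0 < Fintype.card H.V := Fintype.card_pos_iff.2 h.ne
    have := h.card
    show Fintype.card {f // f ≠ e} = Fintype.card {x // x ≠ H.tgt e} + 3
    omega
  span := hs

lemma Good.nonloop0 {H : Multigraph} {φ : H.E → Q4} (h : Good H φ) (e : H.E) (h0 : φ e = 0) :
    H.src e ≠ H.tgt e := by
  obtain ⟨f, hf⟩ := (h.star (Pi.single e 1)).1 (by
    simp [Pi.single_apply, ite_smul, h0])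
  intro hc
  have := hf e
  rw [hc, (z2_add_eq_zero _ _).2 rfl] at this
  simp at this

lemma Good.nonloop2 {H : Multigraph} {φ : H.E → Q4} (h : Good H φ) (a b : H.E) (hab : a ≠ b)
    (h0 : φ a = φ b) : H.src a ≠ H.tgt a := by
  obtain ⟨f, hf⟩ := (h.star (Pi.single a 1 + Pi.single b 1)).1 (by
    simp only [Pi.add_apply, add_smul, Finset.sum_add_distrib]
    simp only [Pi.single_apply, ite_smul, one_smul, zero_smul, Finset.sum_ite_eq', mem_univ, if_true]
    rw [h0]
    ext i
    exact (z2_add_eq_zero _ _).2 rfl)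
  intro hc
  have := hf a
  rw [hc, (z2_add_eq_zero _ _).2 rfl] at this
  simp [Pi.single_apply, hab] at this

lemma span_drop {E : Type} {φ : E → Q4} (hs : Submodule.span (ZMod 2) (Set.range φ) = ⊤) (e : E)
    (h0 : φ e = 0 ∨ ∃ f, f ≠ e ∧ φ e = φ f) :
    Submodule.span (ZMod 2) (Set.range fun f : {f // f ≠ e} => φ f.1) = ⊤ := by
  rw [eq_top_iff, ← hs, Submodule.span_le]
  rintro _ ⟨x, rfl⟩
  by_cases hx : x = e
  · subst hx
    rcases h0 with h0 | ⟨f, hf, h0⟩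
    · rw [h0]; exact Submodule.zero_mem _
    · rw [h0]; exact Submodule.subset_span ⟨⟨f, hf⟩, rfl⟩
  · exact Submodule.subset_span ⟨⟨x, hx⟩, rfl⟩

lemma good_reduce (k : ℕ) : ∀ (H : Multigraph) (φ : H.E → Q4), Fintype.card H.E = k → Good H φ →
    ∃ (H0 : Multigraph) (φ0 : H0.E → Q4), Good H0 φ0 ∧ Function.Injective φ0 ∧ (∀ e, φ0 e ≠ 0) ∧
      ∀ e, φ e = 0 ∨ ∃ e0, φ e = φ0 e0 := by
  induction k using Nat.strong_induction_on with
  | _ k ih =>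
    intro H φ hk h
    have step : ∀ e : H.E, H.src e ≠ H.tgt e → (φ e = 0 ∨ ∃ f, f ≠ e ∧ φ e = φ f) → 
      ∃ (H0 : Multigraph) (φ0 : H0.E → Q4), Good H0 φ0 ∧ Function.Injective φ0 ∧ (∀ e, φ0 e ≠ 0) ∧
      ∀ e, φ e = 0 ∨ ∃ e0, φ e = φ0 e0 := by
      intro e hne he
      have hg := h.ctr e hne (span_drop h.span e he)
      have hlt : Fintype.card {f // f ≠ e} < k := by
        rw [← hk]
        exact Fintype.card_subtype_lt (x := e) (by simp)
      obtain ⟨H0, φ0, h1, h2, h3, h4⟩ := ih _ hlt (ctr H e hne) (fun f => φ f.1) rfl hg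
      refine ⟨H0, φ0, h1, h2, h3, fun x => ?_⟩
      by_cases hx : x = e
      · subst hx
        rcases he with he | ⟨f, hf, he⟩
        · exact Or.inl he
        · rw [he]; exact h4 ⟨f, hf⟩
      · exact h4 ⟨x, hx⟩
    by_cases h0 : ∃ e, φ e = 0
    · obtain ⟨e, he⟩ := h0
      exact step e (h.nonloop0 e he) (Or.inl he)
    by_cases hi : Function.Injective φ
    · push Not at h0
      exact ⟨H, φ, h, hi, h0, fun e => Or.inr ⟨e, rfl⟩⟩
    · simp only [Function.Injective] at hi
      push Not at hi
      obtain ⟨a, b, hab, hne⟩ := hi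
      exact step a (h.nonloop2 a b hne hab) (Or.inr ⟨b, hne.symm, hab⟩)

def NL (H : Multigraph) (v : H.V) : Finset H.E := univ.filter fun e => ¬ (H.src e = v ↔ H.tgt e = v)

def LP (H : Multigraph) (v : H.V) : Finset H.E := univ.filter fun e => H.src e = v ∧ H.tgt e = v

lemma deg_eq (H : Multigraph) (v : H.V) : H.deg v = (NL H v).card + 2 * (LP H v).card := by
  unfold Multigraph.deg NL LP
  simp only [Finset.card_filter]
  rw [Finset.mul_sum, ← Finset.sum_add_distrib, ← Finset.sum_add_distrib]
  refine Finset.sum_congr rfl fun e _ => ?_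
  by_cases h1 : H.src e = v <;> by_cases h2 : H.tgt e = v <;> simp [h1, h2]

lemma sum_deg (H : Multigraph) : ∑ v, H.deg v = 2 * Fintype.card H.E := by
  unfold Multigraph.deg
  simp only [Finset.card_filter]
  rw [Finset.sum_add_distrib, Finset.sum_comm, Finset.sum_comm (s := univ) (t := univ) (f := fun v e => if H.tgt e = v then 1 else 0)]
  simp
  ring

lemma Good.sumNL {H : Multigraph} {φ : H.E → Q4} (h : Good H φ) (v : H.V) :
    ∑ e ∈ NL H v, φ e = 0 := by
  rw [← h.cob (fun x => if x = v then 1 else 0), NL, Finset.sum_filter]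
  refine Finset.sum_congr rfl fun e _ => ?_
  by_cases h1 : H.src e = v <;> by_cases h2 : H.tgt e = v <;> simp [h1, h2]
  ext i
  rw [z2_add_eq_zero 1 1 |>.2 rfl]
  simp

lemma q4_add_eq_zero (a b : Q4) : a + b = 0 ↔ a = b := by
  constructor
  · intro h; ext i; exact (z2_add_eq_zero _ _).1 (congrFun h i)
  · rintro rfl; ext i; exact (z2_add_eq_zero _ _).2 rfl

lemma Good.two_le_NL {H : Multigraph} {φ : H.E → Q4} (h : Good H φ) (h0 : ∀ e, φ e ≠ 0)
    (v w : H.V) (hw : w ≠ v) : 2 ≤ (NL H v).card := by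
  by_contra hc
  have : (NL H v).card = 0 ∨ (NL H v).card = 1 := by omega
  rcases this with h1 | h1
  · have := h.conn (fun x => if x = v then 1 else 0) (by
      intro e
      rw [Finset.card_eq_zero] at h1
      have : e ∉ NL H v := by rw [h1]; simp
      simp only [NL, mem_filter, mem_univ, true_and, not_not] at this
      simp [this]) v w
    simp [hw] at this
  · obtain ⟨e, he⟩ := Finset.card_eq_one.1 h1
    have := h.sumNL v
    rw [he, Finset.sum_singleton] at this
    exact h0 e this

lemma Good.NL_two {H : Multigraph} {φ : H.E → Q4} (h : Good H φ)
    (v : H.V) (h2 : (NL H v).card = 2) : ∃ a b, a ≠ b ∧ NL H v = {a, b} ∧ φ a = φ b := by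
  obtain ⟨a, b, hab, he⟩ := Finset.card_eq_two.1 h2
  have := h.sumNL v
  rw [he, Finset.sum_pair hab] at this
  exact ⟨a, b, hab, he, (q4_add_eq_zero _ _).1 this⟩

lemma Good.three_le_NL {H : Multigraph} {φ : H.E → Q4} (h : Good H φ) (h0 : ∀ e, φ e ≠ 0)
    (hi : Function.Injective φ) (v w : H.V) (hw : w ≠ v) : 3 ≤ (NL H v).card := by
  by_contra hc
  have := h.two_le_NL h0 v w hw
  obtain ⟨a, b, hab, -, he⟩ := h.NL_two v (by omega)
  exact hab (hi he)

def joins (H : Multigraph) (e : H.E) (x y : H.V) : Prop :=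
  (H.src e = x ∧ H.tgt e = y) ∨ (H.src e = y ∧ H.tgt e = x)

lemma joins.symm {H : Multigraph} {e : H.E} {x y : H.V} (h : joins H e x y) : joins H e y x :=
  Or.symm h

def chn (H : Multigraph) : H.V → List H.E → H.V → Prop
  | x, [], y => x = y
  | x, e :: l, y => ∃ z, joins H e x z ∧ chn H z l y

lemma chn_append {H : Multigraph} {l l' : List H.E} {x y z : H.V} (h : chn H x l y)
    (h' : chn H y l' z) : chn H x (l ++ l') z := by
  induction l generalizing x with
  | nil => have : x = y := h
           subst this; exact h'
  | cons e l ih =>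
    obtain ⟨u, hu, h2⟩ := h
    exact ⟨u, hu, ih h2⟩

lemma chn_reverse {H : Multigraph} {l : List H.E} {x y : H.V} (h : chn H x l y) :
    chn H y l.reverse x := by
  induction l generalizing x with
  | nil => exact Eq.symm h
  | cons e l ih =>
    obtain ⟨u, hu, h2⟩ := h
    rw [List.reverse_cons]
    exact chn_append (ih h2) ⟨x, hu.symm, rfl⟩

structure Pres (D H : Multigraph) (κ : D.V → H.V) (L : D.E → List H.E) : Prop where
  chain : ∀ d, chn H (κ (D.src d)) (L d) (κ (D.tgt d))
  cover : ∀ e, ∃ d, e ∈ L d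
  card : ∑ d, (L d).length ≤ Fintype.card H.E

def LP2 (D H : Multigraph) (φ : H.E → Q4) : Prop :=
  ∃ (ψ : D.E → Q4) (κ : D.V → H.V) (L : D.E → List H.E), Good D ψ ∧ Pres D H κ L ∧
    ∀ d, ∀ e ∈ L d, φ e = ψ d

def splt (H : Multigraph) (v : H.V) (a b : H.E) (sa sb : Bool) : Multigraph where
  V := Option H.V
  E := Option H.E
  src e := match e with
    | none => none
    | some e => if (e = a ∧ sa = false) ∨ (e = b ∧ sb = false) then none else some (H.src e)
  tgt e := match e with
    | none => some v
    | some e => if (e = a ∧ sa = true) ∨ (e = b ∧ sb = true) then none else some (H.tgt e)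

def eend (H : Multigraph) (e : H.E) (s : Bool) : H.V := if s then H.tgt e else H.src e

def φsplt {E : Type} (φ : E → Q4) (a b : E) : Option E → Q4
  | none => φ a + φ b
  | some e => φ e

lemma splt_sum {H : Multigraph} (v : H.V) (a b : H.E) (hab : a ≠ b) (sa sb : Bool)
    (ha : eend H a sa = v) (hb : eend H b sb = v) (f : Option H.V → ZMod 2) (e : H.E) :
    f ((splt H v a b sa sb).src (some e)) + f ((splt H v a b sa sb).tgt (some e)) =
      (f (some (H.src e)) + f (some (H.tgt e))) + ((if e = a then f none + f (some v) else 0) +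
        (if e = b then f none + f (some v) else 0)) := by
  have key : ∀ x y : ZMod 2, x + y = y + y + (x + y) ∧ y + x = y + y + (x + y) := by decide
  have key2 : ∀ x y z : ZMod 2, x + y = z + y + (x + z) ∧ y + x = y + z + (x + z) := by decide
  by_cases h1 : e = a
  · subst h1
    cases sa <;> simp only [eend] at ha <;> simp at ha <;> simp [splt, hab, ha]
    · exact (key2 _ _ _).1
    · exact (key2 _ _ _).2
  · by_cases h2 : e = b
    · subst h2
      cases sb <;> simp only [eend] at hb <;> simp at hb <;> simp [splt, h1, hb]
      · exact (key2 _ _ _).1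
      · exact (key2 _ _ _).2
    · simp [splt, h1, h2]

lemma Good.splt {H : Multigraph} {φ : H.E → Q4} (h : Good H φ) (v : H.V) (a b : H.E) (hab : a ≠ b)
    (sa sb : Bool) (ha : eend H a sa = v) (hb : eend H b sb = v) :
    Good (splt H v a b sa sb) (φsplt φ a b) where
  ne := ⟨(none : Option H.V)⟩
  cob f := by
    refine (Fintype.sum_option _).trans ?_
    have : ∀ e : H.E, (f ((_root_.splt H v a b sa sb).src (some e)) +
      f ((_root_.splt H v a b sa sb).tgt (some e))) • φsplt φ a b (some e) = 
       (f (some (H.src e)) + f (some (H.tgt e))) • φ e + ((if e = a then f none + f (some v) else 0) • φ e +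
        (if e = b then f none + f (some v) else 0) • φ e) := by
      intro e
      rw [splt_sum v a b hab sa sb ha hb f e]
      simp only [add_smul]
      rfl
    refine (congrArg _ (Finset.sum_congr rfl fun e _ => this e)).trans ?_
    rw [Finset.sum_add_distrib, Finset.sum_add_distrib]
    have h2 := h.cob (fun x => f (some x))
    refine (congrArg _ (congrArg (· + _) h2)).trans ?_
    simp only [ite_smul, zero_smul, Finset.sum_ite_eq', mem_univ, if_true, zero_add]
    rw [← smul_add]
    exact (q4_add_eq_zero _ _).2 rfl
  conn f hf := by
    have h0 : f none = f (some v) := hf none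
    have h1 := h.conn (fun x => f (some x)) (by
      intro e
      have h2 := hf (some e)
      have h3 := splt_sum v a b hab sa sb ha hb f e
      rw [(z2_add_eq_zero _ _).2 h2, (z2_add_eq_zero _ _).2 h0] at h3
      simp at h3
      exact (z2_add_eq_zero _ _).1 h3.symm)
    have h2 : ∀ x, f x = f none := by
      intro x
      cases x with
      | none => rfl
      | some x => rw [h0]; exact h1 _ _
    intro x y
    rw [h2 x, h2 y]
  card := by
    have := h.card
    show Fintype.card (Option H.E) = Fintype.card (Option H.V) + 3
    simp
    omega
  span := by
    rw [eq_top_iff, ← h.span, Submodule.span_le]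
    rintro _ ⟨x, rfl⟩
    exact Submodule.subset_span ⟨some x, rfl⟩

lemma splt_chn {H : Multigraph} (v : H.V) (a b : H.E)
    (sa sb : Bool) (ha : eend H a sa = v) (hb : eend H b sb = v) (x y : Option H.V)
    (l : List (Option H.E)) (hl : chn (splt H v a b sa sb) x l y) :
    chn H (x.getD v) (l.filterMap id) (y.getD v) := by
  have hsrc : ∀ e : H.E, Option.getD ((splt H v a b sa sb).src (some e)) v = H.src e := by
    intro e
    simp only [splt]
    split_ifs with h1
    · rcases h1 with ⟨rfl, rfl⟩ | ⟨rfl, rfl⟩ <;> simp_all [eend]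
    · rfl
  have htgt : ∀ e : H.E, Option.getD ((splt H v a b sa sb).tgt (some e)) v = H.tgt e := by
    intro e
    simp only [splt]
    split_ifs with h1
    · rcases h1 with ⟨rfl, rfl⟩ | ⟨rfl, rfl⟩ <;> simp_all [eend]
    · rfl
  induction l generalizing x with
  | nil => 
    have : x = y := hl
    subst this
    rfl
  | cons e l ih =>
    obtain ⟨z, hz, h2⟩ := hl
    have ih := ih z h2
    cases e with
    | none =>
      have : x.getD v = z.getD v := by
        rcases hz with ⟨h3, h4⟩ | ⟨h3, h4⟩
        · have h3 : none = x := h3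
          have h4 : some v = z := h4
          subst h3 h4; rfl
        · have h3 : none = z := h3
          have h4 : some v = x := h4
          subst h3 h4; rfl
      rw [this]
      exact ih
    | some e =>
      refine ⟨z.getD v, ?_, ih⟩
      rcases hz with ⟨h3, h4⟩ | ⟨h3, h4⟩
      · left
        rw [← h3, ← h4]
        exact ⟨(hsrc e).symm, (htgt e).symm⟩
      · right
        rw [← h3, ← h4]
        exact ⟨(hsrc e).symm, (htgt e).symm⟩

lemma filterMap_id_lt {E : Type} (l : List (Option E)) (h : none ∈ l) :
    (l.filterMap id).length < l.length := by
  rcases (List.length_filterMap_le (id : Option E → Option E) l).lt_or_eq with h1 | h1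
  · exact h1
  · rw [List.length_filterMap_eq_countP, List.countP_eq_length] at h1
    have := h1 _ h
    simp at this

lemma LP2.splt {D H : Multigraph} {φ : H.E → Q4} (v : H.V) (a b : H.E)
    (sa sb : Bool) (ha : eend H a sa = v) (hb : eend H b sb = v)
    (h : LP2 D (splt H v a b sa sb) (φsplt φ a b)) : LP2 D H φ := by
  obtain ⟨ψ, κ, L, hg, hp, hl⟩ := h
  refine ⟨ψ, fun d => Option.getD (κ d) v, fun d => (L d).filterMap (id : Option H.E → Option H.E), hg,
    ⟨?_, ?_, ?_⟩, ?_⟩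
  · intro d
    exact splt_chn v a b sa sb ha hb _ _ _ (hp.chain d)
  · intro e
    obtain ⟨d, hd⟩ := hp.cover (some e)
    exact ⟨d, List.mem_filterMap.2 ⟨some e, hd, rfl⟩⟩
  · have h1 : ∑ d, (L d).length ≤ Fintype.card (Option H.E) := hp.card
    rw [Fintype.card_option] at h1
    have h2 : ∑ d, ((L d).filterMap (id : Option H.E → Option H.E)).length < ∑ d, (L d).length := by
      obtain ⟨d, hd⟩ := hp.cover (none : Option H.E)
      refine Finset.sum_lt_sum (fun d _ => List.length_filterMap_le _ _) ⟨d, mem_univ _, ?_⟩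
      exact filterMap_id_lt _ hd
    omega
  · intro d e he
    obtain ⟨x, hx, rfl⟩ := List.mem_filterMap.1 he
    exact hl d _ hx

lemma wt_dec : ∀ c r : Fin 4 → ZMod 2, (∀ i, r ≠ Pi.single i 1) →
    (∀ i j, r ≠ Pi.single i 1 + Pi.single j 1) →
    ∃ t : ZMod 2, c + t • r = 0 ∨ (∃ i, c + t • r = Pi.single i 1) ∨
      ∃ i j, i ≠ j ∧ c + t • r = Pi.single i 1 + Pi.single j 1 := by
  decide +kernel

lemma wt_card : 10 ≤ (univ.filter fun c : Fin 4 → ZMod 2 => (∃ i, c = Pi.single i 1) ∨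
      ∃ i j, i ≠ j ∧ c = Pi.single i 1 + Pi.single j 1).card := by
  decide +kernel

lemma plane_lemma (S : Finset Q4) (x : Fin 4 → Q4) (hx : Function.Injective x)
    (hx0 : ∀ i, x i ≠ 0) (hS : ∀ i, x i ∈ S) (hS2 : ∀ i j, i ≠ j → x i + x j ∈ S)
    (hc : S.card ≤ 8) :
    ∃ W : Submodule (ZMod 2) Q4, W < ⊤ ∧ 7 ≤ (S.filter fun q => q ∈ W).card := by
  let lc : (Fin 4 → ZMod 2) →ₗ[ZMod 2] Q4 := Fintype.linearCombination (ZMod 2) x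
  have l1 : ∀ i, lc (Pi.single i 1) = x i := by
    intro i; simp [lc, Fintype.linearCombination_apply, Pi.single_apply, ite_smul]
  by_cases hinj : Function.Injective lc
  · exfalso
    have := wt_card
    have h2 : ((univ.filter fun c : Fin 4 → ZMod 2 => (∃ i, c = Pi.single i 1) ∨
      ∃ i j, i ≠ j ∧ c = Pi.single i 1 + Pi.single j 1).image lc).card ≤ S.card := by
      apply Finset.card_le_card
      intro q hq
      obtain ⟨c, hc, rfl⟩ := Finset.mem_image.1 hq
      simp only [mem_filter, mem_univ, true_and] at hc
      rcases hc with ⟨i, rfl⟩ | ⟨i, j, hij, rfl⟩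
      · rw [l1]; exact hS i
      · rw [map_add, l1, l1]; exact hS2 i j hij
    rw [Finset.card_image_of_injective _ hinj] at h2
    have h3 := this.trans (le_of_eq (by congr)) |>.trans h2
    omega
  · rw [← LinearMap.ker_eq_bot, Submodule.eq_bot_iff] at hinj
    push Not at hinj
    obtain ⟨r, hr, hr0⟩ := hinj
    rw [LinearMap.mem_ker] at hr
    have hW : ∀ q ∈ LinearMap.range lc, q ≠ 0 → q ∈ S := by
      rintro _ ⟨c, rfl⟩ hq
      obtain ⟨t, ht⟩ := wt_dec c r (by
        rintro i rfl
        rw [l1] at hr; exact hx0 i hr) (by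
        rintro i j rfl
        rw [map_add, l1, l1, q4_add_eq_zero] at hr
        have := hx hr
        subst this
        apply hr0
        rw [q4_add_eq_zero])
      have h1 : lc c = lc (c + t • r) := by rw [map_add, map_smul, hr]; simp
      rw [h1] at hq ⊢
      rcases ht with ht | ⟨i, ht⟩ | ⟨i, j, hij, ht⟩
      · rw [ht] at hq; simp at hq
      · rw [ht, l1]; exact hS i
      · rw [ht, map_add, l1, l1]; exact hS2 i j hij
    have hcW : 8 ≤ (univ.filter fun q => q ∈ LinearMap.range lc).card := by
      have h1 : (univ.filter fun q => q ∈ LinearMap.range lc).card =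
          2 ^ Module.finrank (ZMod 2) (LinearMap.range lc) := by
        have := Module.card_eq_pow_finrank (K := ZMod 2) (V := LinearMap.range lc)
        rw [ZMod.card] at this
        rw [← this, Fintype.card_subtype]
      have h2 : 5 ≤ (univ.filter fun q => q ∈ LinearMap.range lc).card := by
        have : (insert 0 (univ.image x)).card = 5 := by
          rw [Finset.card_insert_of_notMem, Finset.card_image_of_injective _ hx]
          · simp
          · simp only [mem_image, mem_univ, true_and, not_exists]
            exact hx0
        rw [← this]
        apply Finset.card_le_card
        intro q hq
        simp only [mem_filter, mem_univ, true_and]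
        rcases Finset.mem_insert.1 hq with rfl | hq
        · exact Submodule.zero_mem _
        · obtain ⟨i, -, rfl⟩ := Finset.mem_image.1 hq
          exact ⟨_, l1 i⟩
      rw [h1] at h2 ⊢
      have : 3 ≤ Module.finrank (ZMod 2) (LinearMap.range lc) := by
        by_contra hcon
        have : Module.finrank (ZMod 2) (LinearMap.range lc) ≤ 2 := by omega
        have := Nat.pow_le_pow_right (n := 2) (by norm_num) this
        omega
      exact Nat.pow_le_pow_right (n := 2) (by norm_num) this
    have hsub : ((univ.filter fun q => q ∈ LinearMap.range lc).erase 0) ⊆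
        S.filter fun q => q ∈ LinearMap.range lc := by
      intro q hq
      simp only [mem_erase, mem_filter, mem_univ, true_and] at hq ⊢
      exact ⟨hW q hq.2 hq.1, hq.2⟩
    have hcard := Finset.card_le_card hsub
    rw [Finset.card_erase_of_mem (by simpa using ⟨0, map_zero lc⟩)] at hcard
    refine ⟨LinearMap.range lc, ?_, by omega⟩
    rw [lt_top_iff_ne_top]
    intro htop
    rw [htop] at hcard
    simp at hcard
    omega

lemma exists_split {H : Multigraph} {φ : H.E → Q4} (h : Good H φ) (h0 : ∀ e, φ e ≠ 0)
    (hi : Function.Injective φ) : Fintype.card H.E ≤ 9 ∧ (Fintype.card H.E ≠ 9 →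
    ∃ v a b sa sb, a ≠ b ∧ eend H a sa = v ∧ eend H b sb = v ∧ ∀ e, φ e ≠ φ a + φ b) := by
  have hc := h.card
  have hpos : 0 < Fintype.card H.V := Fintype.card_pos_iff.2 h.ne
  have hNL : 2 ≤ Fintype.card H.V → ∀ v, 3 ≤ (NL H v).card := by
    intro h2 v
    obtain ⟨w, hw⟩ := Fintype.exists_ne_of_one_lt_card (by omega) v
    exact h.three_le_NL h0 hi v w hw
  have hsum := sum_deg H
  have h9 : Fintype.card H.E ≤ 9 := by
    by_cases h2 : 2 ≤ Fintype.card H.V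
    · have : ∑ v : H.V, 3 ≤ ∑ v, H.deg v := Finset.sum_le_sum fun v _ => by
        rw [deg_eq]; have := hNL h2 v; omega
      simp at this
      omega
    · omega
  refine ⟨h9, fun hn9 => ?_⟩
  by_contra hno
  push Not at hno
  have hno' : ∀ v a b, a ≠ b → (H.src a = v ∨ H.tgt a = v) → (H.src b = v ∨ H.tgt b = v) →
      ∃ e, φ e = φ a + φ b := by
    intro v a b hab ha hb
    have : ∀ e, (H.src e = v ∨ H.tgt e = v) → ∃ s, eend H e s = v := by
      rintro e (he | he)
      · exact ⟨false, by simpa [eend] using he⟩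
      · exact ⟨true, by simpa [eend] using he⟩
    obtain ⟨sa, hsa⟩ := this a ha
    obtain ⟨sb, hsb⟩ := this b hb
    exact hno v a b sa sb hab hsa hsb
  have hinc : ∃ v, 4 ≤ (NL H v ∪ LP H v).card := by
    have hdisj : ∀ v, (NL H v ∪ LP H v).card = (NL H v).card + (LP H v).card := by
      intro v
      apply Finset.card_union_of_disjoint
      rw [Finset.disjoint_left]
      intro e he he'
      simp only [NL, LP, mem_filter, mem_univ, true_and] at he he'
      exact he ⟨fun _ => he'.2, fun _ => he'.1⟩
    by_contra hcon
    push Not at hcon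
    by_cases h2 : 2 ≤ Fintype.card H.V
    · have : ∑ v, H.deg v ≤ ∑ v : H.V, 3 := Finset.sum_le_sum fun v _ => by
        rw [deg_eq]; have := hNL h2 v; have := hcon v; have := hdisj v; omega
      simp at this
      omega
    · obtain ⟨v⟩ := h.ne
      have hd := deg_eq H v
      have h1 : ∑ v, H.deg v = H.deg v := by
        have := Fintype.card_le_one_iff_subsingleton.1 (show Fintype.card H.V ≤ 1 by omega)
        exact Fintype.sum_subsingleton _ v
      have hz : (NL H v).card = 0 := by
        rw [Finset.card_eq_zero, NL, Finset.filter_eq_empty_iff]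
        have := Fintype.card_le_one_iff_subsingleton.1 (show Fintype.card H.V ≤ 1 by omega)
        intro e _
        simp [Subsingleton.elim (H.src e) v, Subsingleton.elim (H.tgt e) v]
      have := hcon v; have := hdisj v
      omega
  obtain ⟨v, hv⟩ := hinc
  have hmem : ∀ e ∈ NL H v ∪ LP H v, H.src e = v ∨ H.tgt e = v := by
    intro e he
    simp only [NL, LP, mem_union, mem_filter, mem_univ, true_and] at he
    tauto
  obtain ⟨T, hT, hT4⟩ := Finset.exists_subset_card_eq hv
  let y : Fin 4 → H.E := fun i => (T.equivFinOfCardEq hT4).symm i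
  have hyT : ∀ i, y i ∈ T := fun i => ((T.equivFinOfCardEq hT4).symm i).2
  have hyi : Function.Injective y := Subtype.val_injective.comp (Equiv.injective _)
  have hcardS : (univ.image φ).card = Fintype.card H.E := by
    rw [Finset.card_image_of_injective _ hi]; rfl
  obtain ⟨W, hW, hW7⟩ := plane_lemma (univ.image φ) (fun i => φ (y i)) (hi.comp hyi)
    (fun i => h0 _) (fun i => Finset.mem_image_of_mem _ (mem_univ _)) (by
      intro i j hij
      obtain ⟨e, he⟩ := hno' v (y i) (y j) (fun h => hij (hyi h)) (hmem _ (hT (hyT i)))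
        (hmem _ (hT (hyT j)))
      rw [← he]
      exact Finset.mem_image_of_mem _ (mem_univ _)) (by omega)
  obtain ⟨g, hg0, hgW⟩ := Submodule.exists_le_ker_of_lt_top W hW
  have hK : 7 ≤ (univ.filter fun e => g (φ e) = 0).card := by
    refine hW7.trans ?_
    rw [← Finset.card_image_of_injective _ hi]
    apply Finset.card_le_card
    intro q hq
    obtain ⟨hq1, hq2⟩ := Finset.mem_filter.1 hq
    obtain ⟨e, -, rfl⟩ := Finset.mem_image.1 hq1
    exact Finset.mem_image_of_mem _ (by simpa using hgW hq2)
  have hne : ∃ f, g (φ f) ≠ 0 := by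
    by_contra hcon
    push Not at hcon
    apply hg0
    rw [← LinearMap.ker_eq_top, eq_top_iff, ← h.span, Submodule.span_le]
    rintro _ ⟨e, rfl⟩
    exact hcon e
  obtain ⟨f, hf⟩ := hne
  have htot := Finset.card_filter_add_card_filter_not (s := (univ : Finset H.E)) (fun e => g (φ e) = 0)
  rw [Finset.card_univ] at htot
  have hfmem : f ∈ univ.filter fun e => ¬ g (φ e) = 0 := by simpa using hf
  have h1 : (univ.filter fun e => ¬ g (φ e) = 0).card = 1 := by
    have := Finset.card_pos.2 ⟨f, hfmem⟩
    omega
  have huniq : ∀ e, g (φ e) ≠ 0 → e = f := by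
    intro e he
    exact Finset.card_le_one.1 h1.le e (by simpa using he) f hfmem
  have hloop : H.tgt f = H.src f := by
    have hcob := congrArg g (h.cob (fun x => if x = H.src f then 1 else 0))
    rw [map_sum, map_zero] at hcob
    rw [Finset.sum_eq_single f] at hcob
    · rw [map_smul] at hcob
      by_contra hcon
      simp [hcon] at hcob
      exact hf hcob
    · intro b _ hb
      rw [map_smul]
      have : g (φ b) = 0 := by
        by_contra hh
        exact hb (huniq b hh)
      rw [this, smul_zero]
    · simp
  have h17 : ∑ v : H.V, (3 + if v = H.src f then 2 else 0) ≤ ∑ v, H.deg v :=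
    Finset.sum_le_sum fun v _ => by
      have := hNL (by omega) v
      rw [deg_eq]
      split_ifs with hvf
      · have : 0 < (LP H v).card := Finset.card_pos.2 ⟨f, by simp [LP, hloop, hvf]⟩
        omega
      · omega
  rw [Finset.sum_add_distrib] at h17
  simp at h17
  omega

lemma prism_of {V : Type} (A : V → V → Prop) (hs : ∀ x y, A x y → A y x) (a b c d e f : V)
    (hn : [a, b, c, d, e, f].Nodup) (h1 : A a b) (h2 : A b c) (h3 : A a c) (h4 : A d e) (h5 : A e f)
    (h6 : A d f) (h7 : A a d) (h8 : A b e) (h9 : A c f) :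
    ∃ κ : prism.V → V, Function.Injective κ ∧ ∀ d, A (κ (prism.src d)) (κ (prism.tgt d)) := by
  refine ⟨fun p => (match p with
    | (0, false) => a | (1, false) => b | (2, false) => c
    | (0, true) => d | (1, true) => e | (2, true) => f), ?_, ?_⟩
  · have hh : ∀ p q : Fin 3 × Bool, p ≠ q → (match p with
    | (0, false) => a | (1, false) => b | (2, false) => c
    | (0, true) => d | (1, true) => e | (2, true) => f) ≠ (match q with
    | (0, false) => a | (1, false) => b | (2, false) => c
    | (0, true) => d | (1, true) => e | (2, true) => f) := by
      simp only [List.nodup_cons, List.mem_cons, List.not_mem_nil, or_false, not_or] at hn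
      rintro ⟨i, s⟩ ⟨j, t⟩ h
      fin_cases i <;> fin_cases j <;> cases s <;> cases t <;> simp at h ⊢ <;> grind
    intro p q h
    by_contra hc
    exact hh p q hc h
  · rintro (⟨i, s⟩ | i)
    · fin_cases i <;> cases s
      · exact h1
      · exact h4
      · exact h2
      · exact h5
      · exact hs _ _ h3
      · exact hs _ _ h6
    · fin_cases i
      · exact h7
      · exact h8
      · exact h9

lemma K33_of {V : Type} (A : V → V → Prop) (a b c d e f : V)
    (hn : [a, b, c, d, e, f].Nodup) (h1 : A a d) (h2 : A a e) (h3 : A a f) (h4 : A b d) (h5 : A b e)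
    (h6 : A b f) (h7 : A c d) (h8 : A c e) (h9 : A c f) :
    ∃ κ : K33.V → V, Function.Injective κ ∧ ∀ d, A (κ (K33.src d)) (κ (K33.tgt d)) := by
  refine ⟨(Sum.elim ![a, b, c] ![d, e, f] : Fin 3 ⊕ Fin 3 → V), ?_, ?_⟩
  · have hh : ∀ p q : Fin 3 ⊕ Fin 3, p ≠ q → (Sum.elim ![a, b, c] ![d, e, f] : Fin 3 ⊕ Fin 3 → V) p ≠
      (Sum.elim ![a, b, c] ![d, e, f] : Fin 3 ⊕ Fin 3 → V) q := by
      simp only [List.nodup_cons, List.mem_cons, List.not_mem_nil, or_false, not_or] at hn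
      rintro (i | i) (j | j) h <;> fin_cases i <;> fin_cases j <;> simp at h ⊢ <;> grind
    intro p q h
    by_contra hc
    exact hh p q hc h
  · rintro ⟨i, j⟩
    fin_cases i <;> fin_cases j <;> assumption

lemma ar0 {ab ac bc ad ae bd be cd ce : ℕ} (r1 : ab + ac + ad + ae = 2) (r2 : ab + bc + bd + be = 2)
    (r3 : ac + bc + cd + ce = 2) (r4 : ad + bd + cd = 2) (r5 : ae + be + ce = 2)
    (_ : ad ≤ 1) (_ : ae ≤ 1) (_ : bd ≤ 1) (_ : be ≤ 1) (_ : cd ≤ 1) (_ : ce ≤ 1) (h : ab = 1) :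
    cd = 1 ∧ ce = 1 ∧ ((ae = 1 ∧ bd = 1) ∨ (ad = 1 ∧ be = 1)) := by
  have h1 : ab + ac + bc = 1 := by omega
  have h2 : cd = 1 := by omega
  have h3 : ce = 1 := by omega
  have h4 : ad + ae = 1 := by omega
  have h5 : bd + be = 1 := by omega
  have h6 : ad + bd = 1 := by omega
  clear r1 r2 r3 r4 r5
  refine ⟨h2, h3, ?_⟩
  omega

lemma cubic6 {V : Type} [Fintype V] (A : V → V → Prop) (hV : Fintype.card V = 6)
    (hs : ∀ x y, A x y → A y x) (hi : ∀ x, ¬ A x x) (h3 : ∀ x, (univ.filter (A x)).card = 3) :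
    (∃ κ : K33.V → V, Function.Injective κ ∧ ∀ d, A (κ (K33.src d)) (κ (K33.tgt d))) ∨
    (∃ κ : prism.V → V, Function.Injective κ ∧ ∀ d, A (κ (prism.src d)) (κ (prism.tgt d))) := by
  obtain ⟨v⟩ : Nonempty V := Fintype.card_pos_iff.1 (by omega)
  obtain ⟨a, b, c, hab, hac, hbc, hN⟩ := Finset.card_eq_three.1 (h3 v)
  have hva : A v a := by have : a ∈ univ.filter (A v) := by rw [hN]; simp
                         simpa using this
  have hvb : A v b := by have : b ∈ univ.filter (A v) := by rw [hN]; simp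
                         simpa using this
  have hvc : A v c := by have : c ∈ univ.filter (A v) := by rw [hN]; simp
                         simpa using this
  have va : v ≠ a := fun h => hi v (by rw [h] at hva ⊢; exact hva)
  have vb : v ≠ b := fun h => hi v (by rw [h] at hvb ⊢; exact hvb)
  have vc : v ≠ c := fun h => hi v (by rw [h] at hvc ⊢; exact hvc)
  have h4 : ({v, a, b, c} : Finset V).card = 4 := by
    rw [card_insert_of_notMem (by simp [va, vb, vc]), card_insert_of_notMem (by simp [hab, hac]),
      card_insert_of_notMem (by simp [hbc]), card_singleton]
  have h5 : ({v, a, b, c} : Finset V)ᶜ.card = 2 := by rw [card_compl]; omega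
  obtain ⟨d, e, hde, hC⟩ := Finset.card_eq_two.1 h5
  have hd : d ∈ ({v, a, b, c} : Finset V)ᶜ := by rw [hC]; simp
  have he : e ∈ ({v, a, b, c} : Finset V)ᶜ := by rw [hC]; simp
  simp only [mem_compl, mem_insert, mem_singleton, not_or] at hd he
  obtain ⟨dv, da, db, dc⟩ := hd
  obtain ⟨ev, ea, eb, ec⟩ := he
  have hu : (univ : Finset V) = {v, a, b, c, d, e} := by
    have := Finset.union_compl ({v, a, b, c} : Finset V)
    rw [← this, hC]; ext; simp; tauto
  set χ : V → V → ℕ := fun x y => if A x y then 1 else 0 with hχ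
  have hrow : ∀ x, χ x v + (χ x a + (χ x b + (χ x c + (χ x d + χ x e)))) = 3 := by
    intro x
    have h := h3 x
    rw [Finset.card_filter, hu, sum_insert (by simp [va, vb, vc, Ne.symm dv, Ne.symm ev]),
      sum_insert (by simp [hab, hac, Ne.symm da, Ne.symm ea]), sum_insert (by simp [hbc, Ne.symm db, Ne.symm eb]),
      sum_insert (by simp [Ne.symm dc, Ne.symm ec]), sum_pair hde] at h
    exact h
  have hsy : ∀ x y, χ x y = χ y x := fun x y => by
    have : A x y ↔ A y x := ⟨hs x y, hs y x⟩
    simp only [hχ, this]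
  have h1 : ∀ x y, χ x y = 0 ∨ χ x y = 1 := fun x y => by
    by_cases h : A x y <;> simp [hχ, h]
  have hA : ∀ x y, χ x y = 1 → A x y := fun x y h => by
    by_contra hc; simp [hχ, hc] at h
  have h0 : ∀ x, χ x x = 0 := fun x => by simp [hχ, hi]
  have r1 := hrow a; have r2 := hrow b; have r3 := hrow c; have r4 := hrow d; have r5 := hrow e
  have r0 := hrow v
  have s1 : χ v a = 1 := if_pos hva
  have s2 : χ v b = 1 := if_pos hvb
  have s3 : χ v c = 1 := if_pos hvc
  have q1 := hsy a v; have q2 := hsy b v; have q3 := hsy c v; have q4 := hsy d v; have q5 := hsy e v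
  have q6 := hsy b a; have q7 := hsy c a; have q8 := hsy d a; have q9 := hsy e a
  have q10 := hsy c b; have q11 := hsy d b; have q12 := hsy e b
  have q13 := hsy d c; have q14 := hsy e c; have q15 := hsy e d
  have z0 := h0 v; have z1 := h0 a; have z2 := h0 b; have z3 := h0 c; have z4 := h0 d; have z5 := h0 e
  have t1 := h1 a b; have t2 := h1 a c; have t3 := h1 b c; have t4 := h1 a d; have t5 := h1 b d
  have t6 := h1 c d; have t7 := h1 a e; have t8 := h1 b e; have t9 := h1 c e; have t10 := h1 d e
  clear_value χ
  rw [q1] at r1; rw [q2, q6] at r2; rw [q3, q7, q10] at r3; rw [q4, q8, q11, q13] at r4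
  rw [q5, q9, q12, q14, q15] at r5
  have l4 : χ a d ≤ 1 := by clear * - t4; omega
  have l5 : χ b d ≤ 1 := by clear * - t5; omega
  have l6 : χ c d ≤ 1 := by clear * - t6; omega
  have l7 : χ a e ≤ 1 := by clear * - t7; omega
  have l8 : χ b e ≤ 1 := by clear * - t8; omega
  have l9 : χ c e ≤ 1 := by clear * - t9; omega
  have hvd : χ v d = 0 := by clear * - r0 s1 s2 s3 z0; omega
  have hve : χ v e = 0 := by clear * - r0 s1 s2 s3 z0; omega
  rw [hvd, z4] at r4
  rw [hve, z5] at r5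
  rw [s1, z1] at r1
  rw [s2, z2] at r2
  rw [s3, z3] at r3
  rcases t10 with t10 | t10
  · left
    rw [t10] at r4 r5
    apply K33_of A v d e a b c (by simp; grind) hva hvb hvc <;> apply hs <;> apply hA
    · clear * - r4 l4 l5 l6; omega
    · clear * - r4 l4 l5 l6; omega
    · clear * - r4 l4 l5 l6; omega
    · clear * - r5 l7 l8 l9; omega
    · clear * - r5 l7 l8 l9; omega
    · clear * - r5 l7 l8 l9; omega
  · right
    have hDE := hA _ _ t10
    rw [t10] at r4 r5
    have g1 : χ a b + χ a c + χ a d + χ a e = 2 := by clear * - r1; omega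
    have g2 : χ a b + χ b c + χ b d + χ b e = 2 := by clear * - r2; omega
    have g3 : χ a c + χ b c + χ c d + χ c e = 2 := by clear * - r3; omega
    have g4 : χ a d + χ b d + χ c d = 2 := by clear * - r4; omega
    have g5 : χ a e + χ b e + χ c e = 2 := by clear * - r5; omega
    clear r0 r1 r2 r3 r4 r5 q1 q2 q3 q4 q5 q6 q7 q8 q9 q10 q11 q12 q13 q14 q15 z0 z1 z2 z3 z4 z5 hrow h1 h0
    have : χ a b = 1 ∨ χ a c = 1 ∨ χ b c = 1 := by clear * - t1 t2 t3 g1 g2 g3 g4 g5; omega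
    rcases this with u | u | u
    · have hu := hA _ _ u
      obtain ⟨y1, y2, ⟨y3, y4⟩ | ⟨y3, y4⟩⟩ := ar0 g1 g2 g3 g4 g5 l4 l7 l5 l8 l6 l9 u
      · exact prism_of A hs v a b c e d (by simp; grind) hva hu hvb (hA _ _ y2) (hs _ _ hDE)
          (hA _ _ y1) hvc (hA _ _ y3) (hA _ _ y4)
      · exact prism_of A hs v a b c d e (by simp; grind) hva hu hvb (hA _ _ y1) hDE
          (hA _ _ y2) hvc (hA _ _ y3) (hA _ _ y4)
    · have hu := hA _ _ u
      obtain ⟨y1, y2, ⟨y3, y4⟩ | ⟨y3, y4⟩⟩ := ar0 (ab := χ a c) (ac := χ a b) (bc := χ b c)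
        (ad := χ a d) (ae := χ a e) (bd := χ c d) (be := χ c e) (cd := χ b d) (ce := χ b e)
        (by rw [← g1]; ring) (by rw [← g3]) (by rw [← g2])
        (by rw [← g4]; ring) (by rw [← g5]; ring) l4 l7 l6 l9 l5 l8 u
      · exact prism_of A hs v a c b e d (by simp; grind) hva hu hvc (hA _ _ y2) (hs _ _ hDE)
          (hA _ _ y1) hvb (hA _ _ y3) (hA _ _ y4)
      · exact prism_of A hs v a c b d e (by simp; grind) hva hu hvc (hA _ _ y1) hDE
          (hA _ _ y2) hvb (hA _ _ y3) (hA _ _ y4)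
    · have hu := hA _ _ u
      obtain ⟨y1, y2, ⟨y3, y4⟩ | ⟨y3, y4⟩⟩ := ar0 (ab := χ b c) (ac := χ a b) (bc := χ a c)
        (ad := χ b d) (ae := χ b e) (bd := χ c d) (be := χ c e) (cd := χ a d) (ce := χ a e)
        (by rw [← g2]; ring) (by rw [← g3]; ring) (by rw [← g1])
        (by rw [← g4]; ring) (by rw [← g5]; ring) l5 l8 l6 l9 l4 l7 u
      · exact prism_of A hs v b c a e d (by simp; grind) hvb hu hvc (hA _ _ y2) (hs _ _ hDE)
          (hA _ _ y1) hva (hA _ _ y3) (hA _ _ y4)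
      · exact prism_of A hs v b c a d e (by simp; grind) hvb hu hvc (hA _ _ y1) hDE
          (hA _ _ y2) hva (hA _ _ y3) (hA _ _ y4)

lemma lp2_of_emb {D H : Multigraph} {φ : H.E → Q4} (h : Good H φ)
    (hV : Fintype.card D.V = Fintype.card H.V) (hE : Fintype.card D.E = Fintype.card H.E)
    (κ : D.V → H.V) (hκ : Function.Injective κ) (ε : D.E → H.E)
    (hj : ∀ d, joins H (ε d) (κ (D.src d)) (κ (D.tgt d)))
    (hsimp : ∀ d d', (D.src d = D.src d' ∧ D.tgt d = D.tgt d') ∨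
      (D.src d = D.tgt d' ∧ D.tgt d = D.src d') → d = d') : LP2 D H φ := by
  have hε : Function.Injective ε := by
    intro d d' hd
    apply hsimp
    have h1 := hj d
    have h2 := hj d'
    rw [← hd] at h2
    simp only [joins] at h1 h2
    rcases h1 with ⟨a1, a2⟩ | ⟨a1, a2⟩ <;> rcases h2 with ⟨b1, b2⟩ | ⟨b1, b2⟩
    · exact Or.inl ⟨hκ (a1.symm.trans b1), hκ (a2.symm.trans b2)⟩
    · exact Or.inr ⟨hκ (a1.symm.trans b1), hκ (a2.symm.trans b2)⟩
    · exact Or.inr ⟨hκ (a2.symm.trans b2), hκ (a1.symm.trans b1)⟩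
    · exact Or.inl ⟨hκ (a2.symm.trans b2), hκ (a1.symm.trans b1)⟩
  have bε : Function.Bijective ε := (Fintype.bijective_iff_injective_and_card ε).2 ⟨hε, hE⟩
  have bκ : Function.Bijective κ := (Fintype.bijective_iff_injective_and_card κ).2 ⟨hκ, hV⟩
  let K := Equiv.ofBijective κ bκ
  let N := Equiv.ofBijective ε bε
  have hK : ∀ d, κ (K.symm d) = d := fun d => K.apply_symm_apply d
  have hKs : ∀ d, K.symm (κ d) = d := fun d => K.symm_apply_apply d
  have hval : ∀ (f : D.V → ZMod 2) (d : D.E), f (D.src d) + f (D.tgt d) =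
      f (K.symm (H.src (ε d))) + f (K.symm (H.tgt (ε d))) := by
    intro f d
    rcases hj d with ⟨a1, a2⟩ | ⟨a1, a2⟩ <;> rw [a1, a2, hKs, hKs]
    rw [add_comm]
  refine ⟨fun d => φ (ε d), κ, fun d => [ε d], ⟨h.ne.map K.symm, ?_, ?_, ?_, ?_⟩, ⟨?_, ?_, ?_⟩, ?_⟩
  · intro f
    rw [← h.cob (fun x => f (K.symm x))]
    refine Fintype.sum_equiv N _ _ fun d => ?_
    rw [hval]; rfl
  · intro f hf x y
    have := h.conn (fun x => f (K.symm x)) (fun e => ?_) (κ x) (κ y)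
    · simpa [hKs] using this
    · obtain ⟨d, rfl⟩ := bε.2 e
      have := hval f d
      rw [hf d] at this
      rw [(z2_add_eq_zero _ _).2 rfl] at this
      exact (z2_add_eq_zero _ _).1 this.symm
  · rw [hE, hV, h.card]
  · rw [← h.span]
    congr 1
    exact bε.2.range_comp φ
  · intro d
    exact ⟨_, hj d, rfl⟩
  · intro e
    obtain ⟨d, rfl⟩ := bε.2 e
    exact ⟨d, by simp⟩
  · simp [hE]
  · intro d e he
    simp at he
    rw [he]

lemma base9 {H : Multigraph} {φ : H.E → Q4} (h : Good H φ) (h0 : ∀ e, φ e ≠ 0)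
    (hi : Function.Injective φ) (hE : Fintype.card H.E = 9) : LP2 K33 H φ ∨ LP2 prism H φ := by
  have hV : Fintype.card H.V = 6 := by have := h.card; omega
  have hoth : ∀ v : H.V, ∃ w, w ≠ v := by
    intro v
    obtain ⟨w, hw⟩ := Fintype.exists_ne_of_one_lt_card (by omega : 1 < Fintype.card H.V) v
    exact ⟨w, hw⟩
  have h3 : ∀ v, 3 ≤ (NL H v).card := fun v => by
    obtain ⟨w, hw⟩ := hoth v
    exact h.three_le_NL h0 hi v w hw
  have hdeg : ∀ v, H.deg v = 3 := by
    have hs := sum_deg H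
    have hge : ∀ v ∈ (univ : Finset H.V), 3 ≤ H.deg v := fun v _ => by
      rw [deg_eq]; have := h3 v; omega
    have hsum : ∑ v : H.V, 3 = ∑ v, H.deg v := by
      rw [hs, hE]; simp [hV]
    intro v
    exact ((Finset.sum_eq_sum_iff_of_le hge).1 hsum v (mem_univ v)).symm
  have hNL : ∀ v, (NL H v).card = 3 := fun v => by
    have := hdeg v; rw [deg_eq] at this; have := h3 v; omega
  have hLP : ∀ v, (LP H v).card = 0 := fun v => by
    have := hdeg v; rw [deg_eq] at this; have := h3 v; omega
  have hnl : ∀ e, H.src e ≠ H.tgt e := by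
    intro e he
    have := hLP (H.src e)
    rw [Finset.card_eq_zero] at this
    have h' : e ∈ LP H (H.src e) := by simp [LP, he]
    rw [this] at h'
    simp at h'
  have hmem : ∀ v e, e ∈ NL H v ↔ (H.src e = v ∨ H.tgt e = v) := by
    intro v e
    have := hnl e
    simp only [NL, mem_filter, mem_univ, true_and]
    constructor
    · intro; tauto
    · rintro (rfl | rfl) hh
      · exact this (hh.1 rfl).symm
      · exact this (hh.2 rfl)
  have hsim : ∀ e f x y, joins H e x y → joins H f x y → e = f := by
    intro e f x y he hf
    by_contra hef
    have hexy : ∀ g, joins H g x y → g ∈ NL H x ∧ g ∈ NL H y := by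
      intro g hg
      rw [hmem, hmem]
      rcases hg with ⟨a, b⟩ | ⟨a, b⟩ <;> simp [a, b]
    have third : ∀ v, e ∈ NL H v → f ∈ NL H v → ∃ g, NL H v = {e, f, g} ∧ φ g = φ e + φ f := by
      intro v h1 h2
      have hsub : ({e, f} : Finset H.E) ⊆ NL H v := by
        intro a; simp; rintro (rfl | rfl) <;> assumption
      have hc : (NL H v \ {e, f}).card = 1 := by
        rw [card_sdiff_of_subset hsub, hNL, card_pair hef]
      obtain ⟨g, hg⟩ := Finset.card_eq_one.1 hc
      have hN : NL H v = {e, f, g} := by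
        rw [← Finset.sdiff_union_of_subset hsub, hg]; ext; simp; tauto
      have hgm : g ∈ NL H v \ {e, f} := by rw [hg]; simp
      simp only [mem_sdiff, mem_insert, mem_singleton, not_or] at hgm
      refine ⟨g, hN, ?_⟩
      have := h.sumNL v
      rw [hN, sum_insert (by simp [hef, Ne.symm hgm.2.1]), sum_pair (Ne.symm hgm.2.2), ← add_assoc] at this
      exact ((q4_add_eq_zero _ _).1 this).symm
    obtain ⟨g, hg, hg'⟩ := third x (hexy e he).1 (hexy f hf).1
    obtain ⟨k, hk, hk'⟩ := third y (hexy e he).2 (hexy f hf).2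
    have : g = k := hi (hg'.trans hk'.symm)
    subst this
    have hxy : NL H x = NL H y := hg.trans hk.symm
    have hne : x ≠ y := by
      rintro rfl
      rcases he with ⟨a, b⟩ | ⟨a, b⟩ <;> exact hnl e (a.trans b.symm)
    obtain ⟨z, hz⟩ : ∃ z, z ∉ ({x, y} : Finset H.V) := by
      by_contra hc
      push Not at hc
      have : Fintype.card H.V ≤ ({x, y} : Finset H.V).card := Finset.card_le_card fun z _ => hc z
      have := Finset.card_le_two (a := x) (b := y)
      omega
    simp at hz
    have := h.conn (fun v => if v = x ∨ v = y then 1 else 0) (fun a => ?_) x z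
    · simp [hz] at this
    · have h1 := hmem x a
      have h2 := hmem y a
      rw [hxy] at h1
      have h3 := hnl a
      have : (H.src a = x ∨ H.src a = y) ↔ (H.tgt a = x ∨ H.tgt a = y) := by
        have h4 := h1.symm.trans h2
        constructor
        · rintro (h5 | h5)
          · rcases h4.1 (Or.inl h5) with h6 | h6
            · exact absurd (h5.symm.trans h6) hne
            · exact Or.inr h6
          · rcases h4.2 (Or.inl h5) with h6 | h6
            · exact absurd (h6.symm.trans h5) hne
            · exact Or.inl h6
        · rintro (h5 | h5)
          · rcases h4.1 (Or.inr h5) with h6 | h6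
            · exact Or.inr h6
            · exact absurd (h5.symm.trans h6) hne
          · rcases h4.2 (Or.inr h5) with h6 | h6
            · exact Or.inl h6
            · exact absurd (h6.symm.trans h5) hne
      simp [this]
  set A : H.V → H.V → Prop := fun x y => ∃ e, joins H e x y with hA
  have hoe : ∀ x (e : H.E), e ∈ NL H x → ∃ y, joins H e x y := by
    intro x e he
    rcases (hmem x e).1 he with h1 | h1
    · exact ⟨_, Or.inl ⟨h1, rfl⟩⟩
    · exact ⟨_, Or.inr ⟨rfl, h1⟩⟩
  have hcard : ∀ x, (univ.filter (A x)).card = 3 := by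
    intro x
    rw [← hNL x]
    symm
    have hch : ∀ e ∈ NL H x, ∃ y, joins H e x y := hoe x
    haveI : Nonempty H.V := h.ne
    choose! o ho using hch
    refine Finset.card_bij (fun e _ => o e) ?_ ?_ ?_
    · intro e he
      simp only [mem_filter, mem_univ, true_and]
      exact ⟨e, ho e he⟩
    · intro e he f hf hef
      have h2 := ho f hf
      rw [← hef] at h2
      exact hsim _ _ _ _ (ho e he) h2
    · intro y hy
      simp only [mem_filter, mem_univ, true_and] at hy
      obtain ⟨e, he⟩ := hy
      have hem : e ∈ NL H x := by rw [hmem]; rcases he with ⟨a, b⟩ | ⟨a, b⟩ <;> simp [a, b]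
      refine ⟨e, hem, ?_⟩
      have h1 := ho e hem
      have h2 := hnl e
      rcases he with ⟨a, b⟩ | ⟨a, b⟩ <;> rcases h1 with ⟨c, d⟩ | ⟨c, d⟩
      · exact d.symm.trans b
      · exact absurd (a.trans d.symm) h2
      · exact absurd (c.trans b.symm) h2
      · exact c.symm.trans a
  have := cubic6 A hV (fun x y ⟨e, he⟩ => ⟨e, he.symm⟩)
    (by rintro x ⟨e, ⟨a, b⟩ | ⟨a, b⟩⟩ <;> exact hnl e (a.trans b.symm)) (fun x => by convert hcard x)
  rcases this with ⟨κ, hκ, hk⟩ | ⟨κ, hκ, hk⟩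
  · left
    choose ε hε using hk
    refine lp2_of_emb h (by rw [hV]; rfl) (by rw [hE]; rfl) κ hκ ε hε ?_
    rintro ⟨a, b⟩ ⟨c, d⟩ h
    have h' : (Sum.inl a = (Sum.inl c : Fin 3 ⊕ Fin 3) ∧ (Sum.inr b : Fin 3 ⊕ Fin 3) = Sum.inr d) ∨
     (Sum.inl a = (Sum.inr d : Fin 3 ⊕ Fin 3) ∧ (Sum.inr b : Fin 3 ⊕ Fin 3) = Sum.inl c) := h
    simp at h'
    exact Prod.ext h'.1 h'.2
  · right
    choose ε hε using hk
    refine lp2_of_emb h (by rw [hV]; rfl) (by rw [hE]; rfl) κ hκ ε hε ?_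
    have : ∀ d d' : (Fin 3 × Bool) ⊕ Fin 3, (prism.src d = (prism.src d' : Fin 3 × Bool) ∧
      (prism.tgt d : Fin 3 × Bool) = prism.tgt d') ∨
      ((prism.src d : Fin 3 × Bool)  = prism.tgt d' ∧ (prism.tgt d : Fin 3 × Bool) = prism.src d') → d = d' := by
      simp only [prism]; decide
    exact this

theorem CI (k : ℕ) : ∀ {H : Multigraph} {φ : H.E → Q4} (_ : Good H φ) (_ : ∀ e, φ e ≠ 0)
    (_ : Function.Injective φ) (_ : 9 ≤ Fintype.card H.E + k), LP2 K33 H φ ∨ LP2 prism H φ := by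
  induction k with
  | zero =>
    intro H φ h h0 hi hk
    have := (exists_split h h0 hi).1
    exact base9 h h0 hi (by omega)
  | succ k ih =>
    intro H φ h h0 hi hk
    obtain ⟨h1, h2⟩ := exists_split h h0 hi
    by_cases h9 : Fintype.card H.E = 9
    · exact base9 h h0 hi h9
    · obtain ⟨v, a, b, sa, sb, hab, ha, hb, hne⟩ := h2 h9
      have hg := h.splt v a b hab sa sb ha hb
      have hinj : Function.Injective (φsplt φ a b) := by
        rintro (_ | x) (_ | y) hxy
        · rfl
        · exact absurd hxy.symm (hne y)
        · exact absurd hxy (hne x)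
        · exact congrArg some (hi hxy)
      have hz : ∀ e, φsplt φ a b e ≠ 0 := by
        rintro (_ | x) hx
        · exact hab (hi ((q4_add_eq_zero _ _).1 hx))
        · exact h0 x hx
      have hc : Fintype.card (splt H v a b sa sb).E = Fintype.card H.E + 1 := Fintype.card_option
      rcases ih hg hz hinj (by omega) with h | h
      · exact Or.inl (LP2.splt v a b sa sb ha hb h)
      · exact Or.inr (LP2.splt v a b sa sb ha hb h)

lemma sum_count_len {E : Type} [Fintype E] (l : List E) : ∑ e, l.count e = l.length := by
  induction l with
  | nil => simp
  | cons a l ih => simp [List.count_cons, Finset.sum_add_distrib, ih]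

lemma Pres.count {D H : Multigraph} {κ : D.V → H.V} {L : D.E → List H.E} (h : Pres D H κ L) (e : H.E) :
    ∑ d, (L d).count e = 1 := by
  have h1 : ∀ e ∈ (univ : Finset H.E), 1 ≤ ∑ d, (L d).count e := by
    intro e _
    obtain ⟨d, hd⟩ := h.cover e
    have h2 : 1 ≤ (L d).count e := List.one_le_count_iff.2 hd
    exact h2.trans (Finset.single_le_sum (f := fun d => (L d).count e) (fun _ _ => Nat.zero_le _) (mem_univ d))
  have h2 : ∑ e : H.E, ∑ d, (L d).count e = ∑ d, (L d).length := by
    rw [Finset.sum_comm]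
    exact Finset.sum_congr rfl fun d _ => sum_count_len _
  have h3 : ∑ e : H.E, 1 = ∑ e : H.E, ∑ d, (L d).count e := by
    apply le_antisymm (Finset.sum_le_sum h1)
    rw [h2]; simpa using h.card
  exact ((Finset.sum_eq_sum_iff_of_le h1).1 h3 e (mem_univ e)).symm

lemma chn_ctr {H : Multigraph} (a b : H.E) (hab : b ≠ a) (hne : H.src a ≠ H.tgt a) (v u y : H.V) (huv : u ≠ v)
    (hyv : y ≠ v)
    (ha : joins H a v u) (hb : joins H b v y) (hv : ∀ f, f ≠ a → f ≠ b → H.src f ≠ v ∧ H.tgt f ≠ v)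
    (ρ : {x // x ≠ H.tgt a} → H.V) (hρ : ∀ s, ρ (red H a hne s) = if s = v then u else s) :
    ∀ (l : List {f // f ≠ a}) (x z : {x // x ≠ H.tgt a}), chn (ctr H a hne) x l z →
      ∃ l' : List H.E, chn H (ρ x) l' (ρ z) ∧ l'.length = l.length + List.count (α := (ctr H a hne).E) ⟨b, hab⟩ l ∧
        (∀ e ∈ l', (e = a ∧ ⟨b, hab⟩ ∈ l) ∨ ∃ f ∈ l, f.1 = e) ∧ (∀ f ∈ l, f.1 ∈ l') ∧
        (⟨b, hab⟩ ∈ l → a ∈ l') := by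
  intro l
  induction l with
  | nil =>
    intro x z h
    exact ⟨[], congrArg ρ h, rfl, by simp, by simp, by simp⟩
  | cons f l ih =>
    rintro x z ⟨t, hj, hc⟩
    obtain ⟨l', h1, h2, h3, h4, h5⟩ := ih t z hc
    by_cases hf : f.1 = b
    · have hfb : f = ⟨b, hab⟩ := Subtype.ext hf
      have hred : ∀ p q, joins H b p q → (red H a hne p = x ∧ red H a hne q = t) →
          ∃ m, chn H (ρ x) m (ρ t) ∧ (m = [a, b] ∨ m = [b, a]) := by
        rintro p q hpq ⟨rfl, rfl⟩
        rw [hρ, hρ]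
        have hcase : (p = v ∧ q = y) ∨ (p = y ∧ q = v) := by
          rcases hpq with ⟨c1, c2⟩ | ⟨c1, c2⟩ <;> rcases hb with ⟨d1, d2⟩ | ⟨d1, d2⟩
          · exact Or.inl ⟨c1.symm.trans d1, c2.symm.trans d2⟩
          · exact Or.inr ⟨c1.symm.trans d1, c2.symm.trans d2⟩
          · exact Or.inr ⟨c2.symm.trans d2, c1.symm.trans d1⟩
          · exact Or.inl ⟨c2.symm.trans d2, c1.symm.trans d1⟩
        rcases hcase with ⟨rfl, rfl⟩ | ⟨rfl, rfl⟩
        · rw [if_pos rfl, if_neg hyv]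
          exact ⟨[a, b], ⟨_, ha.symm, _, hb, rfl⟩, Or.inl rfl⟩
        · rw [if_pos rfl, if_neg hyv]
          exact ⟨[b, a], ⟨_, hb.symm, _, ha, rfl⟩, Or.inr rfl⟩
      obtain ⟨m, hm, hm'⟩ : ∃ m, chn H (ρ x) m (ρ t) ∧ (m = [a, b] ∨ m = [b, a]) := by
        rw [hfb] at hj
        rcases hj with ⟨c1, c2⟩ | ⟨c1, c2⟩
        · exact hred _ _ (Or.inl ⟨rfl, rfl⟩) ⟨c1, c2⟩
        · exact hred _ _ (Or.inr ⟨rfl, rfl⟩) ⟨c2, c1⟩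
      refine ⟨m ++ l', chn_append hm h1, ?_, ?_, ?_, ?_⟩
      · have hcc := List.count_cons_self (α := (ctr H a hne).E) (a := ⟨b, hab⟩) (l := l)
        rw [hfb, List.length_append, List.length_cons, h2]
        refine Eq.trans ?_ (congrArg (l.length + 1 + ·) hcc).symm
        show _ = l.length + 1 + (_ + 1)
        rcases hm' with rfl | rfl <;> simp <;> omega
      · intro e he
        rw [List.mem_append] at he
        rcases he with he | he
        · have : e = a ∨ e = b := by rcases hm' with rfl | rfl <;> simp at he <;> tauto
          rcases this with rfl | rfl
          · exact Or.inl ⟨rfl, by rw [hfb]; simp⟩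
          · exact Or.inr ⟨f, by simp, hf⟩
        · rcases h3 e he with ⟨e1, e2⟩ | ⟨g, g1, g2⟩
          · exact Or.inl ⟨e1, List.mem_cons_of_mem _ e2⟩
          · exact Or.inr ⟨g, List.mem_cons_of_mem _ g1, g2⟩
      · intro g hg
        rw [List.mem_append]
        rcases List.mem_cons.1 hg with rfl | hg
        · left; rw [hf]; rcases hm' with rfl | rfl <;> simp
        · exact Or.inr (h4 g hg)
      · intro _
        rw [List.mem_append]
        left; rcases hm' with rfl | rfl <;> simp
    · have hh := hv f.1 f.2 hf
      have hj' : joins H f.1 (ρ x) (ρ t) := by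
        have e1 : ρ (red H a hne (H.src f.1)) = H.src f.1 := by rw [hρ, if_neg hh.1]
        have e2 : ρ (red H a hne (H.tgt f.1)) = H.tgt f.1 := by rw [hρ, if_neg hh.2]
        rcases hj with ⟨c1, c2⟩ | ⟨c1, c2⟩
        · exact Or.inl ⟨e1.symm.trans (congrArg ρ c1), e2.symm.trans (congrArg ρ c2)⟩
        · exact Or.inr ⟨e1.symm.trans (congrArg ρ c1), e2.symm.trans (congrArg ρ c2)⟩
      have hfb : f ≠ ⟨b, hab⟩ := fun h => hf (congrArg Subtype.val h)
      refine ⟨f.1 :: l', ⟨_, hj', h1⟩, ?_, ?_, ?_, ?_⟩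
      · have hcc := List.count_cons_of_ne (α := (ctr H a hne).E) (l := l) hfb
        rw [List.length_cons, List.length_cons, h2]
        refine Eq.trans ?_ (congrArg (l.length + 1 + ·) hcc).symm
        show _ = l.length + 1 + _
        omega
      · intro e he
        rcases List.mem_cons.1 he with rfl | he
        · exact Or.inr ⟨f, by simp, rfl⟩
        · rcases h3 e he with ⟨e1, e2⟩ | ⟨g, g1, g2⟩
          · exact Or.inl ⟨e1, List.mem_cons_of_mem _ e2⟩
          · exact Or.inr ⟨g, List.mem_cons_of_mem _ g1, g2⟩
      · intro g hg
        rcases List.mem_cons.1 hg with rfl | hg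
        · simp
        · exact List.mem_cons_of_mem _ (h4 g hg)
      · intro hg
        rcases List.mem_cons.1 hg with hg | hg
        · exact absurd hg.symm hfb
        · exact List.mem_cons_of_mem _ (h5 hg)

lemma LP2.ctr {D H : Multigraph} {φ : H.E → Q4} (a b : H.E) (hab : b ≠ a) (hne : H.src a ≠ H.tgt a)
    (v u y : H.V) (huv : u ≠ v) (hyv : y ≠ v) (hφ : φ a = φ b)
    (ha : joins H a v u) (hb : joins H b v y) (hv : ∀ f, f ≠ a → f ≠ b → H.src f ≠ v ∧ H.tgt f ≠ v)
    (h : LP2 D (ctr H a hne) (fun f => φ f.1)) : LP2 D H φ := by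
  obtain ⟨ψ, κ, L, hg, hp, hl⟩ := h
  let ρ : {x // x ≠ H.tgt a} → H.V := fun x => if x.1 = v then u else x.1
  have hρ : ∀ s, ρ (red H a hne s) = if s = v then u else s := by
    intro s
    simp only [ρ, red]
    rcases ha with ⟨c1, c2⟩ | ⟨c1, c2⟩
    · by_cases hs : s = H.tgt a
      · rw [dif_pos hs]; simp [c1, hs, c2, huv]
      · rw [dif_neg hs]
    · by_cases hs : s = H.tgt a
      · rw [dif_pos hs]; simp [c1, c2, hs, huv]
      · rw [dif_neg hs]
  have := fun d => chn_ctr a b hab hne v u y huv hyv ha hb hv ρ hρ (L d) _ _ (hp.chain d)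
  choose L' h1 h2 h3 h4 h5 using this
  refine ⟨ψ, fun d => ρ (κ d), L', hg, ⟨h1, ?_, ?_⟩, ?_⟩
  · intro e
    by_cases he : e = a
    · obtain ⟨d, hd⟩ := hp.cover ⟨b, hab⟩
      exact ⟨d, he ▸ h5 d hd⟩
    · obtain ⟨d, hd⟩ := hp.cover ⟨e, he⟩
      exact ⟨d, h4 d _ hd⟩
  · have e1 : ∑ d, (L' d).length = ∑ d, (L d).length + ∑ d, List.count (α := (_root_.ctr H a hne).E) ⟨b, hab⟩ (L d) := by
      rw [← Finset.sum_add_distrib]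
      exact Finset.sum_congr rfl fun d _ => h2 d
    have e2 : ∑ d, List.count (α := (_root_.ctr H a hne).E) ⟨b, hab⟩ (L d) = 1 := by
      exact hp.count ⟨b, hab⟩
    have e3 : ∑ d, (L d).length ≤ Fintype.card {f // f ≠ a} := hp.card
    have e4 : Fintype.card {f // f ≠ a} = Fintype.card H.E - 1 := by
      simp [Fintype.card_subtype_compl]
    have : 0 < Fintype.card H.E := Fintype.card_pos_iff.2 ⟨a⟩
    omega
  · intro d e he
    rcases h3 d e he with ⟨rfl, hm⟩ | ⟨f, hf, rfl⟩
    · rw [hφ]; exact hl d ⟨b, hab⟩ hm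
    · exact hl d f hf

theorem Uthm (k : ℕ) : ∀ {H : Multigraph} {φ : H.E → Q4} (_ : Good H φ) (_ : ∀ e, φ e ≠ 0)
    (_ : Function.Injective φ ∨ 9 ≤ (univ.image φ).card) (_ : Fintype.card H.E ≤ k),
    LP2 K33 H φ ∨ LP2 prism H φ := by
  induction k with
  | zero =>
    intro H φ h _ _ hk
    have := h.card
    omega
  | succ k ih =>
    intro H φ h h0 hi hk
    by_cases hinj : Function.Injective φ
    · exact CI 9 h h0 hinj (by omega)
    have h9 : 9 ≤ (univ.image φ).card := hi.resolve_left hinj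
    have h10 : 9 < Fintype.card H.E := by
      rcases Nat.lt_or_ge 9 (Fintype.card H.E) with h | h
      · exact h
      · exfalso
        apply hinj
        have : (univ.image φ).card = (univ : Finset H.E).card := by
          apply le_antisymm Finset.card_image_le
          rw [Finset.card_univ]; omega
        have := Finset.card_image_iff.1 this
        simpa [Set.injOn_univ] using this
    have hc := h.card
    obtain ⟨v, hv⟩ : ∃ v, H.deg v ≤ 2 := by
      by_contra hcon
      push Not at hcon
      have := sum_deg H
      have h3 : ∑ v : H.V, 3 ≤ ∑ v, H.deg v := Finset.sum_le_sum fun v _ => hcon v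
      simp at h3
      omega
    obtain ⟨w, hw⟩ := Fintype.exists_ne_of_one_lt_card (by omega : 1 < Fintype.card H.V) v
    have h2 := h.two_le_NL h0 v w hw
    rw [deg_eq] at hv
    have hN : (NL H v).card = 2 := by omega
    have hL : (LP H v).card = 0 := by omega
    obtain ⟨a, b, hab, hNab, hφ⟩ := h.NL_two v hN
    have hj : ∀ e ∈ NL H v, ∃ u, u ≠ v ∧ joins H e v u := by
      intro e he
      simp only [NL, mem_filter, mem_univ, true_and] at he
      by_cases h1 : H.src e = v
      · exact ⟨H.tgt e, fun h2 => he (by simp [h1, h2]), Or.inl ⟨h1, rfl⟩⟩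
      · have h2 : H.tgt e = v := by by_contra h2; exact he (by simp [h1, h2])
        exact ⟨H.src e, h1, Or.inr ⟨rfl, h2⟩⟩
    obtain ⟨u, hu, ha⟩ := hj a (by rw [hNab]; simp)
    obtain ⟨y, hy, hb⟩ := hj b (by rw [hNab]; simp)
    have hne : H.src a ≠ H.tgt a := by
      rcases ha with ⟨c1, c2⟩ | ⟨c1, c2⟩
      · rw [c1, c2]; exact hu.symm
      · rw [c1, c2]; exact hu
    have hother : ∀ f, f ≠ a → f ≠ b → H.src f ≠ v ∧ H.tgt f ≠ v := by
      intro f hfa hfb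
      have h1 : f ∉ NL H v := by rw [hNab]; simp [hfa, hfb]
      have h2 : f ∉ LP H v := by rw [Finset.card_eq_zero.1 hL]; simp
      simp only [NL, LP, mem_filter, mem_univ, true_and, not_not] at h1 h2
      constructor <;> intro h3 <;> exact h2 (by tauto)
    have hg := h.ctr a hne (span_drop h.span a (Or.inr ⟨b, hab.symm, hφ⟩))
    have hcard : Fintype.card (ctr H a hne).E = Fintype.card H.E - 1 := by
      show Fintype.card {f // f ≠ a} = _
      simp [Fintype.card_subtype_compl]
    have him : 9 ≤ (univ.image (fun f : (ctr H a hne).E => φ f.1)).card := by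
      refine h9.trans (Finset.card_le_card ?_)
      intro q hq
      obtain ⟨e, -, rfl⟩ := Finset.mem_image.1 hq
      by_cases he : e = a
      · subst he
        exact Finset.mem_image.2 ⟨(⟨b, hab.symm⟩ : {f // f ≠ e}), mem_univ _, hφ.symm⟩
      · exact Finset.mem_image.2 ⟨(⟨e, he⟩ : {f // f ≠ a}), mem_univ _, rfl⟩
    rcases ih hg (fun f => h0 f.1) (Or.inr him) (by omega) with h | h
    · exact Or.inl (LP2.ctr a b hab.symm hne v u y hu hy hφ ha hb hother h)
    · exact Or.inr (LP2.ctr a b hab.symm hne v u y hu hy hφ ha hb hother h)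

def chkL (bs : List (List (Fin 9))) (l : List (Fin 9)) : Bool := bs.all fun c => !(c.all fun i => l.contains i)

def sumL (bs : List (List (Fin 9))) (k : ℕ) (X : Fin 9 → ℕ) : ℕ :=
  ((((List.finRange 9).sublistsLen k).filter (chkL bs)).map fun l => (l.map X).prod).sum

lemma sum_filter_map (c : List (Fin 9) → Bool) (F : List (Fin 9) → ℕ) (L : List (List (Fin 9))) :
    (L.map fun l => if c l = true then F l else 0).sum = ((L.filter c).map F).sum := by
  induction L with
  | nil => rfl
  | cons a L ih =>
    by_cases h : c a = true
    · simp [h, ih]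
    · simp [h, ih]

lemma cnt_list {E : Type} [Fintype E] (en : Fin 9 ≃ E) (P : Finset E → Prop) (bs : List (List (Fin 9)))
    (hP : ∀ l : List (Fin 9), P (l.toFinset.image en) ↔ chkL bs l = true) (x : E → ℕ) (k : ℕ) :
    (∑ I : Finset E, if I.card = k ∧ P I then ∏ d ∈ I, x d else 0) = sumL bs k (fun i => x (en i)) := by
  rw [← Equiv.sum_comp (Equiv.finsetCongr en)]
  have h1 : ∀ J : Finset (Fin 9), (if ((Equiv.finsetCongr en) J).card = k ∧ P ((Equiv.finsetCongr en) J) then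
      ∏ d ∈ (Equiv.finsetCongr en) J, x d else 0) =
      if J.card = k then (if P (J.image en) then ∏ i ∈ J, x (en i) else 0) else 0 := by
    intro J
    have : (Equiv.finsetCongr en) J = J.image en := by
      rw [Equiv.finsetCongr_apply, Finset.map_eq_image]; rfl
    rw [this, Finset.card_image_of_injective _ en.injective,
      Finset.prod_image (fun a _ b _ h => en.injective h), ite_and]
  rw [Finset.sum_congr rfl fun J _ => h1 J, ← Finset.sum_filter]
  have h2 : (univ.filter fun J : Finset (Fin 9) => J.card = k) = powersetCard k univ := by
    ext J; simp [Finset.mem_powersetCard]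
  rw [h2]
  have h3 : ∀ J ∈ powersetCard k (univ : Finset (Fin 9)), (if P (J.image en) then ∏ i ∈ J, x (en i) else 0) =
      (fun M : Multiset (Fin 9) => if P (M.toFinset.image en) then (M.map fun i => x (en i)).prod else 0) J.val := by
    intro J _
    simp only [Finset.val_toFinset]
    rfl
  rw [Finset.sum_congr rfl h3]
  show (Multiset.map ((fun M : Multiset (Fin 9) => if P (M.toFinset.image en) then
    (M.map fun i => x (en i)).prod else 0) ∘ Finset.val) (powersetCard k (univ : Finset (Fin 9))).val).sum = _
  rw [← Multiset.map_map, Finset.map_val_val_powersetCard]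
  have h4 : (univ : Finset (Fin 9)).val = ((List.finRange 9 : List (Fin 9)) : Multiset (Fin 9)) := rfl
  rw [h4, Multiset.powersetCard_coe, Multiset.map_coe, Multiset.sum_coe, List.map_map, sumL, ← sum_filter_map]
  congr 1
  apply List.map_congr_left
  intro l _
  simp only [Function.comp, List.toFinset_coe, hP, Multiset.map_coe, Multiset.prod_coe]

lemma ind_chk {D : Multigraph} {ψ : D.E → Q4} (h : Good D ψ) (en : Fin 9 ≃ D.E) (ν : Fin 6 ≃ D.V)
    (s t : Fin 9 → Fin 6) (hs : ∀ i, D.src (en i) = ν (s i)) (ht : ∀ i, D.tgt (en i) = ν (t i))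
    (bs : List (List (Fin 9)))
    (h1 : ∀ f : Fin 6 → Bool, (∀ i, f (s i) = f (t i)) ∨ ∃ c ∈ bs, ∀ i ∈ c, f (s i) ≠ f (t i))
    (h2 : ∀ c ∈ bs, ∃ f : Fin 6 → Bool, (∃ i, f (s i) ≠ f (t i)) ∧ ∀ i, f (s i) ≠ f (t i) → i ∈ c)
    (l : List (Fin 9)) : Ind ψ (l.toFinset.image en) ↔ chkL bs l = true := by
  rw [h.ind_iff]
  have hchk : chkL bs l = true ↔ ∀ c ∈ bs, ¬ ∀ i ∈ c, i ∈ l := by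
    simp [chkL]
  rw [hchk]
  constructor
  · intro h3 c hc hcl
    obtain ⟨f, ⟨i, hi⟩, hf⟩ := h2 c hc
    have := h3 (fun v => if f (ν.symm v) then 1 else 0) (fun e he => ?_) (en i)
    · rw [hs, ht] at this
      simp only [Equiv.symm_apply_apply] at this
      cases h4 : f (s i) <;> cases h5 : f (t i) <;> simp_all
    · obtain ⟨j, rfl⟩ := en.surjective e
      have hj : j ∉ c := fun hj => he (by simpa using hcl j hj)
      have : f (s j) = f (t j) := by by_contra hne; exact hj (hf j hne)
      rw [hs, ht]
      simp only [Equiv.symm_apply_apply, this]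
  · intro h3 f hf e
    have hb : ∀ a b : ZMod 2, (decide (a = 0) = decide (b = 0)) ↔ a = b := by decide
    rcases h1 (fun v => decide (f (ν v) = 0)) with h4 | ⟨c, hc, h4⟩
    · obtain ⟨i, rfl⟩ := en.surjective e
      rw [hs, ht]
      exact (hb _ _).1 (h4 i)
    · exfalso
      apply h3 c hc
      intro i hi
      by_contra hil
      have := hf (en i) (by simpa using hil)
      rw [hs, ht] at this
      exact h4 i hi ((hb _ _).2 this)

def kBonds : List (List (Fin 9)) := [[0, 1, 2], [0, 3, 6], [1, 4, 7], [2, 5, 8], [3, 4, 5], [6, 7, 8], [0, 1, 5, 8], [0, 2, 4, 7], 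
    [0, 3, 7, 8], [0, 4, 5, 6], [1, 2, 3, 6], [1, 3, 5, 7], [1, 4, 6, 8], [2, 3, 4, 8], [2, 5, 6, 
    7], [0, 1, 3, 4, 8], [0, 1, 5, 6, 7], [0, 2, 3, 5, 7], [0, 2, 4, 6, 8], [0, 4, 5, 7, 8], [1, 2, 
    3, 7, 8], [1, 2, 4, 5, 6], [1, 3, 5, 6, 8], [2, 3, 4, 6, 7]]

def pBonds : List (List (Fin 9)) := [[0, 1, 8], [0, 2, 7], [1, 2, 6], [3, 4, 8], [3, 5, 7], [4, 5, 6], [6, 7, 8], [0, 1, 3, 4], [0, 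
    1, 6, 7], [0, 2, 3, 5], [0, 2, 6, 8], [1, 2, 4, 5], [1, 2, 7, 8], [3, 4, 6, 7], [3, 5, 6, 8], 
    [4, 5, 7, 8], [0, 1, 3, 5, 6], [0, 1, 4, 5, 7], [0, 2, 3, 4, 6], [0, 2, 4, 5, 8], [1, 2, 3, 4, 
    7], [1, 2, 3, 5, 8]]

def kEn : Fin 9 → Fin 3 × Fin 3 := ![(0, 0), (0, 1), (0, 2), (1, 0), (1, 1), (1, 2), (2, 0), (2, 1), (2, 2)]

def pEn : Fin 9 → (Fin 3 × Bool) ⊕ Fin 3 := ![.inl (1, false), .inl (2, false), .inl (0, false),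
  .inl (1, true), .inl (2, true), .inl (0, true), .inr 0, .inr 1, .inr 2]

def kNu : Fin 6 → Fin 3 ⊕ Fin 3 := ![.inl 0, .inl 1, .inl 2, .inr 0, .inr 1, .inr 2]

def pNu : Fin 6 → Fin 3 × Bool := ![(0, false), (1, false), (2, false), (0, true), (1, true), (2, true)]

lemma kEn_bij : Function.Bijective kEn := by decide
lemma pEn_bij : Function.Bijective pEn := by decide
lemma kNu_bij : Function.Bijective kNu := by decide
lemma pNu_bij : Function.Bijective pNu := by decide

def kE : Fin 9 ≃ K33.E := Equiv.ofBijective kEn kEn_bij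
def pE : Fin 9 ≃ prism.E := Equiv.ofBijective pEn pEn_bij

lemma k_ind {ψ : K33.E → Q4} (h : Good K33 ψ) (l : List (Fin 9)) :
    Ind ψ (l.toFinset.image kE) ↔ chkL kBonds l = true := by
  refine ind_chk h kE (Equiv.ofBijective kNu kNu_bij) ![0, 0, 0, 1, 1, 1, 2, 2, 2] ![3, 4, 5, 3, 4, 5, 3, 4, 5] ?_ ?_ kBonds ?_ ?_ l
  · intro i; fin_cases i <;> rfl
  · intro i; fin_cases i <;> rfl
  · decide +kernel
  · decide +kernel

lemma p_ind {ψ : prism.E → Q4} (h : Good prism ψ) (l : List (Fin 9)) :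
    Ind ψ (l.toFinset.image pE) ↔ chkL pBonds l = true := by
  refine ind_chk h pE (Equiv.ofBijective pNu pNu_bij) ![1, 2, 0, 4, 5, 3, 0, 1, 2] ![2, 0, 1, 5, 3, 4, 3, 4, 5] ?_ ?_ pBonds ?_ ?_ l
  · intro i; fin_cases i <;> rfl
  · intro i; fin_cases i <;> rfl
  · decide +kernel
  · decide +kernel

def B2 {R : Type} [CommSemiring R] (a b c : R) : R := a * b + a * c + b * c

def KB {R : Type} [CommSemiring R] (a b c d e f : R) : R := a * (e + f) + b * (d + f) + c * (d + e)

def KT4 {R : Type} [CommSemiring R] (a b c d e f g h i : R) : R :=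
  B2 a b c * B2 d e f + B2 a b c * B2 g h i + B2 d e f * B2 g h i + B2 a b c * KB d e f g h i +
    B2 d e f * KB a b c g h i + B2 g h i * KB a b c d e f

def KT3 {R : Type} [CommSemiring R] (a b c d e f g h i : R) : R :=
  B2 a b c * (d + e + f + (g + h + i)) + B2 d e f * (a + b + c + (g + h + i)) +
  B2 g h i * (a + b + c + (d + e + f)) +
  (a * (d * (h + i) + (e + f) * (g + h + i)) + b * (e * (g + i) + (d + f) * (g + h + i)) +
    c * (f * (g + h) + (d + e) * (g + h + i)))

def T2 {R : Type} [CommSemiring R] (a b c d e f g h i : R) : R :=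
  B2 a b c + B2 d e f + B2 g h i + (a + b + c) * (d + e + f) + (a + b + c) * (g + h + i) +
   (d + e + f) * (g + h + i)

def PT4 {R : Type} [CommSemiring R] (a b c d e f x y z : R) : R :=
  (a + b + c) * (d + e + f) * B2 x y z +
  (x * ((d + e + f) * (a * (b + c)) + (a + b + c) * (d * (e + f))) +
   y * ((d + e + f) * (b * (a + c)) + (a + b + c) * (e * (d + f))) +
   z * ((d + e + f) * (c * (a + b)) + (a + b + c) * (f * (d + e)))) +
  (d + e + f) * (a * b * c) + (a + b + c) * (d * e * f) +
  (a * b * (d * f + e * f) + a * c * (d * e + e * f) + b * c * (d * e + d * f))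

def PT3 {R : Type} [CommSemiring R] (a b c d e f x y z : R) : R :=
  B2 a b c * (d + e + f) + B2 d e f * (a + b + c) + a * b * c + d * e * f +
  B2 x y z * (a + b + c + (d + e + f)) +
  x * ((a + b + c) * (d + e + f) + a * (b + c) + d * (e + f)) +
  y * ((a + b + c) * (d + e + f) + b * (a + c) + e * (d + f)) +
  z * ((a + b + c) * (d + e + f) + c * (a + b) + f * (d + e))

def fdg (n : ℕ) : Fin 9 := Fin.ofNat 9 n

lemma fdgs : fdg 0 = 0 ∧ fdg 1 = 1 ∧ fdg 2 = 2 ∧ fdg 3 = 3 ∧ fdg 4 = 4 ∧ fdg 5 = 5 ∧ fdg 6 = 6 ∧ fdg 7 = 7 ∧ fdg 8 = 8 := by decide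

def fqd (k n : ℕ) : List (Fin 9) := (List.range k).map fun i => fdg (n / 10 ^ i % 10)

lemma fqd2 (X : Fin 9 → ℕ) (n : ℕ) : ((fqd 2 n).map X).prod = X (fdg (n % 10)) * X (fdg (n / 10 % 10)) := by
  simp [fqd, List.range_succ]

lemma fqd3 (X : Fin 9 → ℕ) (n : ℕ) : ((fqd 3 n).map X).prod =
    X (fdg (n % 10)) * X (fdg (n / 10 % 10)) * X (fdg (n / 100 % 10)) := by
  simp [fqd, List.range_succ, mul_assoc]

lemma fqd4 (X : Fin 9 → ℕ) (n : ℕ) : ((fqd 4 n).map X).prod =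
    X (fdg (n % 10)) * X (fdg (n / 10 % 10)) * X (fdg (n / 100 % 10)) * X (fdg (n / 1000 % 10)) := by
  simp [fqd, List.range_succ, mul_assoc]

lemma sum_qd {bs : List (List (Fin 9))} {k : ℕ} (L : List ℕ) (X : Fin 9 → ℕ)
    (h : ((List.finRange 9).sublistsLen k).filter (chkL bs) = L.map (fqd k)) :
    sumL bs k X = (L.map fun n => ((fqd k n).map X).prod).sum := by
  rw [sumL, h, List.map_map]; rfl

lemma kSum4 (X : Fin 9 → ℕ) : sumL kBonds 4 X =
    KT4 (X 0) (X 1) (X 2) (X 3) (X 4) (X 5) (X 6) (X 7) (X 8) := by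
  rw [sum_qd
    [8754, 8654, 7654, 8753, 8653, 7653, 8743, 8643, 7643, 8742, 8642, 7642, 7542, 6542, 8732, 8632, 7632,
    7532, 6532, 7432, 6432, 8751, 8651, 7651, 8541, 6541, 8731, 8631, 7631, 8531, 6531, 8431, 6431, 8721,
    8621, 7621, 7521, 6521, 8421, 6421, 5421, 8321, 7321, 5321, 4321, 8750, 8650, 7650, 8740, 8640, 7640,
    8540, 7540, 8530, 7530, 8430, 7430, 8720, 8620, 7620, 7520, 6520, 8420, 6420, 5420, 8320, 7320, 5320,
    4320, 8710, 8610, 7610, 7510, 6510, 8410, 6410, 5410, 8310, 7310, 5310, 4310] X (by decide +kernel)]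
  simp only [List.map_cons, List.map_nil, List.sum_cons, List.sum_nil, fqd4, Nat.reduceMod, Nat.reduceDiv, fdgs, KT4, KT3, T2, PT4, PT3, B2, KB]
  ring

lemma kSum3 (X : Fin 9 → ℕ) : sumL kBonds 3 X =
    KT3 (X 0) (X 1) (X 2) (X 3) (X 4) (X 5) (X 6) (X 7) (X 8) := by
  rw [sum_qd
    [875, 865, 765, 874, 864, 764, 854, 754, 654, 873, 863, 763, 853, 753, 653, 843, 743, 643, 872, 862, 762,
    752, 652, 842, 742, 642, 542, 832, 732, 632, 532, 432, 871, 861, 761, 851, 751, 651, 841, 641, 541, 831,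
    731, 631, 531, 431, 821, 721, 621, 521, 421, 321, 870, 860, 760, 850, 750, 650, 840, 740, 640, 540, 830,
    730, 530, 430, 820, 720, 620, 520, 420, 320, 810, 710, 610, 510, 410, 310] X (by decide +kernel)]
  simp only [List.map_cons, List.map_nil, List.sum_cons, List.sum_nil, fqd3, Nat.reduceMod, Nat.reduceDiv, fdgs, KT4, KT3, T2, PT4, PT3, B2, KB]
  ring

lemma kSum2 (X : Fin 9 → ℕ) : sumL kBonds 2 X =
    T2 (X 0) (X 1) (X 2) (X 3) (X 4) (X 5) (X 6) (X 7) (X 8) := by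
  rw [sum_qd
    [87, 86, 76, 85, 75, 65, 84, 74, 64, 54, 83, 73, 63, 53, 43, 82, 72, 62, 52, 42, 32, 81, 71, 61, 51, 41,
    31, 21, 80, 70, 60, 50, 40, 30, 20, 10] X (by decide +kernel)]
  simp only [List.map_cons, List.map_nil, List.sum_cons, List.sum_nil, fqd2, Nat.reduceMod, Nat.reduceDiv, fdgs, KT4, KT3, T2, PT4, PT3, B2, KB]
  ring

lemma kSum1 (X : Fin 9 → ℕ) : sumL kBonds 1 X =
    X 0 + X 1 + X 2 + X 3 + X 4 + X 5 + X 6 + X 7 + X 8 := by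
  rw [sum_qd
    [8, 7, 6, 5, 4, 3, 2, 1, 0] X (by decide +kernel)]
  simp [fqd, fdgs]; ring

lemma kSum0 (X : Fin 9 → ℕ) : sumL kBonds 0 X =
    1 := by
  rw [sum_qd
    [0] X (by decide +kernel)]
  rfl

lemma pSum4 (X : Fin 9 → ℕ) : sumL pBonds 4 X =
    PT4 (X 0) (X 1) (X 2) (X 3) (X 4) (X 5) (X 6) (X 7) (X 8) := by
  rw [sum_qd
    [8752, 8652, 7652, 8742, 8642, 7642, 8542, 7542, 8732, 8632, 7632, 8532, 6532, 7432, 6432, 5432, 8751,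
    8651, 7651, 8741, 8641, 7641, 8541, 7541, 8731, 8631, 7631, 8531, 6531, 7431, 6431, 5431, 8521, 7521,
    8421, 7421, 8321, 7321, 5321, 4321, 8750, 8650, 7650, 8740, 8640, 7640, 8540, 7540, 8730, 8630, 7630,
    8530, 6530, 7430, 6430, 5430, 8520, 6520, 8420, 6420, 5420, 8320, 6320, 4320, 7510, 6510, 7410, 6410,
    5410, 7310, 6310, 5310, 5210, 4210, 3210] X (by decide +kernel)]
  simp only [List.map_cons, List.map_nil, List.sum_cons, List.sum_nil, fqd4, Nat.reduceMod, Nat.reduceDiv, fdgs, KT4, KT3, T2, PT4, PT3, B2, KB]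
  ring

lemma pSum3 (X : Fin 9 → ℕ) : sumL pBonds 3 X =
    PT3 (X 0) (X 1) (X 2) (X 3) (X 4) (X 5) (X 6) (X 7) (X 8) := by
  rw [sum_qd
    [875, 865, 765, 874, 864, 764, 854, 754, 873, 863, 763, 853, 653, 743, 643, 543, 872, 862, 762, 852, 752,
    652, 842, 742, 642, 542, 832, 732, 632, 532, 432, 871, 861, 761, 851, 751, 651, 841, 741, 641, 541, 831,
    731, 631, 531, 431, 821, 721, 521, 421, 321, 870, 860, 760, 850, 750, 650, 840, 740, 640, 540, 830, 730,
    630, 530, 430, 820, 620, 520, 420, 320, 710, 610, 510, 410, 310, 210] X (by decide +kernel)]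
  simp only [List.map_cons, List.map_nil, List.sum_cons, List.sum_nil, fqd3, Nat.reduceMod, Nat.reduceDiv, fdgs, KT4, KT3, T2, PT4, PT3, B2, KB]
  ring

lemma pSum2 (X : Fin 9 → ℕ) : sumL pBonds 2 X =
    T2 (X 0) (X 1) (X 2) (X 3) (X 4) (X 5) (X 6) (X 7) (X 8) := by
  rw [sum_qd
    [87, 86, 76, 85, 75, 65, 84, 74, 64, 54, 83, 73, 63, 53, 43, 82, 72, 62, 52, 42, 32, 81, 71, 61, 51, 41,
    31, 21, 80, 70, 60, 50, 40, 30, 20, 10] X (by decide +kernel)]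
  simp only [List.map_cons, List.map_nil, List.sum_cons, List.sum_nil, fqd2, Nat.reduceMod, Nat.reduceDiv, fdgs, KT4, KT3, T2, PT4, PT3, B2, KB]
  ring

lemma pSum1 (X : Fin 9 → ℕ) : sumL pBonds 1 X =
    X 0 + X 1 + X 2 + X 3 + X 4 + X 5 + X 6 + X 7 + X 8 := by
  rw [sum_qd
    [8, 7, 6, 5, 4, 3, 2, 1, 0] X (by decide +kernel)]
  simp [fqd, fdgs]; ring

lemma pSum0 (X : Fin 9 → ℕ) : sumL pBonds 0 X =
    1 := by
  rw [sum_qd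
    [0] X (by decide +kernel)]
  rfl

def Lab (D H : Multigraph) (φ : H.E → Q4) (X : D.E → ℕ) : Prop :=
  ∃ (ψ : D.E → Q4) (ℓ : H.E → Option D.E), Good D ψ ∧ (∀ e, φ e = (ℓ e).elim 0 ψ) ∧
    ∀ d, (cls ℓ d).card = X d

lemma Nk_ind {H : Multigraph} {φ : H.E → Q4} (h : Good H φ) (k : ℕ) :
    Nk H k = (univ.filter fun F : Finset H.E => F.card = k ∧ Ind φ F).card := by
  unfold Nk
  congr 1
  ext F
  simp only [mem_filter, mem_univ, true_and, h.connOn_iff_ind]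

lemma Nk_K {H : Multigraph} {φ : H.E → Q4} (h : Good H φ) {X : K33.E → ℕ} (hl : Lab K33 H φ X) (k : ℕ) :
    Nk H k = sumL kBonds k (fun i => X (kE i)) := by
  obtain ⟨ψ, ℓ, hg, h1, h2⟩ := hl
  rw [Nk_ind h, card_ind φ ψ ℓ h1 k, ← cnt_list kE (Ind ψ) kBonds (fun l => by convert k_ind hg l) X k]
  refine Finset.sum_congr rfl fun I _ => ?_
  simp only [h2]

lemma Nk_P {H : Multigraph} {φ : H.E → Q4} (h : Good H φ) {X : prism.E → ℕ} (hl : Lab prism H φ X) (k : ℕ) :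
    Nk H k = sumL pBonds k (fun i => X (pE i)) := by
  obtain ⟨ψ, ℓ, hg, h1, h2⟩ := hl
  rw [Nk_ind h, card_ind φ ψ ℓ h1 k, ← cnt_list pE (Ind ψ) pBonds (fun l => by convert p_ind hg l) X k]
  refine Finset.sum_congr rfl fun I _ => ?_
  simp only [h2]

lemma cls_sum {D E : Type} [Fintype D] [Fintype E] (ℓ : E → Option D) :
    ∑ d, (cls ℓ d).card + (univ.filter fun e => ℓ e = none).card = Fintype.card E := by
  have h := Finset.card_eq_sum_card_fiberwise (s := (univ : Finset E)) (f := ℓ) (t := univ) (fun _ _ => mem_univ _)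
  rw [Fintype.sum_option, Finset.card_univ] at h
  rw [h, add_comm]
  rfl

lemma Lab.sum_le {D H : Multigraph} {φ : H.E → Q4} {X : D.E → ℕ} (hl : Lab D H φ X) :
    ∑ d, X d ≤ Fintype.card H.E := by
  obtain ⟨ψ, ℓ, hg, h1, h2⟩ := hl
  have := cls_sum ℓ
  simp only [h2] at this
  omega

lemma lab_of_values {D H : Multigraph} {φ : H.E → Q4} {ψ : D.E → Q4} (hg : Good D ψ)
    (h : ∀ e, φ e = 0 ∨ ∃ d, φ e = ψ d) : ∃ X, Lab D H φ X := by
  have : ∀ e, ∃ o : Option D.E, φ e = o.elim 0 ψ := by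
    intro e
    rcases h e with h | ⟨d, h⟩
    · exact ⟨none, h⟩
    · exact ⟨some d, h⟩
  choose ℓ hℓ using this
  exact ⟨fun d => (cls ℓ d).card, ψ, ℓ, hg, hℓ, fun _ => rfl⟩

theorem exists_lab {H : Multigraph} {φ : H.E → Q4} (h : Good H φ) :
    (∃ X, Lab K33 H φ X) ∨ ∃ X, Lab prism H φ X := by
  obtain ⟨H0, φ0, hg0, hi, h0, hv⟩ := good_reduce _ H φ rfl h
  have key : ∀ D, LP2 D H0 φ0 → ∃ X, Lab D H φ X := by
    rintro D ⟨ψ, κ, L, hg, hp, hl⟩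
    apply lab_of_values hg
    intro e
    rcases hv e with h | ⟨e0, h⟩
    · exact Or.inl h
    · obtain ⟨d, hd⟩ := hp.cover e0
      exact Or.inr ⟨d, h.trans (hl d e0 hd)⟩
  rcases CI 9 hg0 h0 hi (by omega) with h | h
  · exact Or.inl (key _ h)
  · exact Or.inr (key _ h)

lemma Pres.sum_len {D H : Multigraph} {κ : D.V → H.V} {L : D.E → List H.E} (h : Pres D H κ L) :
    ∑ d, (L d).length = Fintype.card H.E := by
  have h1 := fun d => (sum_count_len (L d)).symm
  simp only [h1]
  rw [Finset.sum_comm]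
  simp [h.count]

lemma LP2.lab {D H : Multigraph} {φ : H.E → Q4} (h : LP2 D H φ) :
    ∃ κ L, Pres D H κ L ∧ Lab D H φ (fun d => (L d).length) := by
  obtain ⟨ψ, κ, L, hg, hp, hl⟩ := h
  refine ⟨κ, L, hp, ψ, ?_⟩
  have hex : ∀ e, ∃ d, e ∈ L d := hp.cover
  choose g hg' using hex
  have huniq : ∀ e d, e ∈ L d → d = g e := by
    intro e d hd
    by_contra hne
    have h1 : (L d).count e + (L (g e)).count e ≤ ∑ d, (L d).count e := by
      rw [← Finset.sum_pair (f := fun d => (L d).count e) hne]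
      exact Finset.sum_le_sum_of_subset (subset_univ _)
    rw [hp.count] at h1
    have h2 : 1 ≤ (L d).count e := List.one_le_count_iff.2 hd
    have h3 : 1 ≤ (L (g e)).count e := List.one_le_count_iff.2 (hg' e)
    omega
  have hnd : ∀ d, (L d).Nodup := by
    intro d
    rw [List.nodup_iff_count_le_one]
    intro e
    rw [← hp.count e]
    exact Finset.single_le_sum (f := fun d => (L d).count e) (fun _ _ => Nat.zero_le _) (mem_univ d)
  refine ⟨fun e => some (g e), hg, fun e => hl _ _ (hg' e), fun d => ?_⟩
  show (cls (fun e => some (g e)) d).card = (L d).length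
  rw [← List.toFinset_card_of_nodup (hnd d)]
  congr 1
  ext e
  simp only [cls, mem_filter, mem_univ, true_and, List.mem_toFinset, Option.some.injEq]
  exact ⟨fun h => h ▸ hg' e, fun h => (huniq e d h).symm⟩

abbrev Cfg := Fin 3 → Fin 3 → ℕ

def t4 (X : Cfg) : ℕ := KT4 (X 0 0) (X 0 1) (X 0 2) (X 1 0) (X 1 1) (X 1 2) (X 2 0) (X 2 1) (X 2 2)
def t3 (X : Cfg) : ℕ := KT3 (X 0 0) (X 0 1) (X 0 2) (X 1 0) (X 1 1) (X 1 2) (X 2 0) (X 2 1) (X 2 2)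
def t2 (X : Cfg) : ℕ := T2 (X 0 0) (X 0 1) (X 0 2) (X 1 0) (X 1 1) (X 1 2) (X 2 0) (X 2 1) (X 2 2)
def sz (X : Cfg) : ℕ := X 0 0 + X 0 1 + X 0 2 + X 1 0 + X 1 1 + X 1 2 + X 2 0 + X 2 1 + X 2 2
def sqs (X : Cfg) : ℕ := X 0 0 ^ 2 + X 0 1 ^ 2 + X 0 2 ^ 2 + X 1 0 ^ 2 + X 1 1 ^ 2 + X 1 2 ^ 2 +
  X 2 0 ^ 2 + X 2 1 ^ 2 + X 2 2 ^ 2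

def patL : ℕ → List ℕ
  | 1 => [0] | 2 => [0, 4] | 3 => [0, 4, 8] | 4 => [0, 3, 4, 8] | 5 => [2, 3, 4, 6, 7]
  | 6 => [1, 2, 3, 5, 6, 7] | 7 => [1, 2, 3, 5, 6, 7, 8] | 8 => [1, 2, 3, 4, 5, 6, 7, 8] | _ => []

def pat (r : ℕ) (i j : Fin 3) : ℕ := if (patL r).contains (3 * i.val + j.val) then 1 else 0

def w0 (m : ℕ) : Cfg := fun i j => m / 9 + pat (m % 9) i j

def PM (X Y : Cfg) : Prop := ∃ σ τ : Equiv.Perm (Fin 3), ∀ i j, X (σ i) (τ j) = Y i j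

lemma perm3 (σ : Equiv.Perm (Fin 3)) :
    (σ 0 = 0 ∧ σ 1 = 1 ∧ σ 2 = 2) ∨ (σ 0 = 0 ∧ σ 1 = 2 ∧ σ 2 = 1) ∨ (σ 0 = 1 ∧ σ 1 = 0 ∧ σ 2 = 2) ∨
    (σ 0 = 1 ∧ σ 1 = 2 ∧ σ 2 = 0) ∨ (σ 0 = 2 ∧ σ 1 = 0 ∧ σ 2 = 1) ∨ (σ 0 = 2 ∧ σ 1 = 1 ∧ σ 2 = 0) := by
  revert σ; decide

lemma inv_row (X : Cfg) (σ : Equiv.Perm (Fin 3)) :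
    t4 (fun i j => X (σ i) j) = t4 X ∧ t3 (fun i j => X (σ i) j) = t3 X ∧
    sz (fun i j => X (σ i) j) = sz X ∧ sqs (fun i j => X (σ i) j) = sqs X := by
  unfold t4 t3 sz sqs KT4 KT3 B2 KB
  rcases perm3 σ with ⟨h0, h1, h2⟩ | ⟨h0, h1, h2⟩ | ⟨h0, h1, h2⟩ | ⟨h0, h1, h2⟩ | ⟨h0, h1, h2⟩ | ⟨h0, h1, h2⟩ <;>
  simp only [h0, h1, h2] <;> refine ⟨?_, ?_, ?_, ?_⟩ <;> first | trivial | ring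

lemma inv_tr (X : Cfg) :
    t4 (fun i j => X j i) = t4 X ∧ t3 (fun i j => X j i) = t3 X ∧
    sz (fun i j => X j i) = sz X ∧ sqs (fun i j => X j i) = sqs X := by
  unfold t4 t3 sz sqs KT4 KT3 B2 KB
  refine ⟨?_, ?_, ?_, ?_⟩ <;> ring

lemma inv_pm (X : Cfg) (σ τ : Equiv.Perm (Fin 3)) :
    t4 (fun i j => X (σ i) (τ j)) = t4 X ∧ t3 (fun i j => X (σ i) (τ j)) = t3 X ∧
    sz (fun i j => X (σ i) (τ j)) = sz X ∧ sqs (fun i j => X (σ i) (τ j)) = sqs X := by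
  have h1 := inv_row (fun i j => X i (τ j)) σ
  have h2 := inv_tr (fun i j => X i (τ j))
  have h3 := inv_row (fun j i => X i j) τ
  have h4 := inv_tr X
  refine ⟨?_, ?_, ?_, ?_⟩
  · rw [h1.1, ← h2.1, h3.1, h4.1]
  · rw [h1.2.1, ← h2.2.1, h3.2.1, h4.2.1]
  · rw [h1.2.2.1, ← h2.2.2.1, h3.2.2.1, h4.2.2.1]
  · rw [h1.2.2.2, ← h2.2.2.2, h3.2.2.2, h4.2.2.2]

lemma perm_two (j k : Fin 3) (h : j ≠ k) : ∃ τ : Equiv.Perm (Fin 3), τ 0 = j ∧ τ 1 = k := by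
  revert j k; decide

def AdjB (X : Cfg) (M : ℕ) : Prop := ∀ i j k, X i j ≤ X i k + M ∧ X j i ≤ X k i + M

lemma AdjB.pm {X M} (h : AdjB X M) (σ τ : Equiv.Perm (Fin 3)) : AdjB (fun i j => X (σ i) (τ j)) M :=
  fun i j k => ⟨(h (σ i) (τ j) (τ k)).1, (h (τ i) (σ j) (σ k)).2⟩

lemma AdjB.tr {X M} (h : AdjB X M) : AdjB (fun i j => X j i) M :=
  fun i j k => ⟨(h i j k).2, (h i j k).1⟩

lemma adj_wlog (P : Cfg → Prop) (hp : ∀ (X : Cfg) (σ τ : Equiv.Perm (Fin 3)), P (fun i j => X (σ i) (τ j)) → P X)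
    (ht : ∀ X : Cfg, P (fun i j => X j i) → P X)
    (hcore : ∀ (X : Cfg) M, 2 ≤ M → AdjB X M → X 0 0 = X 0 1 + M → P X) (h1 : ∀ X : Cfg, AdjB X 1 → P X) (X : Cfg) : P X := by
  have hex : ∃ M, AdjB X M := by
    refine ⟨sz X, fun i j k => ?_⟩
    have : ∀ i j, X i j ≤ sz X := by
      unfold sz; intro i j; fin_cases i <;> fin_cases j <;> simp <;> omega
    exact ⟨(this i j).trans (by omega), (this j i).trans (by omega)⟩
  classical
  set M := Nat.find hex with hM
  have hb : AdjB X M := Nat.find_spec hex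
  by_cases hM1 : M ≤ 1
  · exact h1 X fun i j k => ⟨(hb i j k).1.trans (by omega), (hb i j k).2.trans (by omega)⟩
  have hn : ¬ AdjB X (M - 1) := Nat.find_min hex (by omega)
  unfold AdjB at hn
  push Not at hn
  obtain ⟨i, j, k, hijk⟩ := hn
  by_cases hr : X i j ≤ X i k + (M - 1)
  · have hc := hijk hr
    have hjk : j ≠ k := by rintro rfl; omega
    obtain ⟨τ, t0, t1⟩ := perm_two j k hjk
    apply ht
    apply hp _ (Equiv.swap 0 i) τ
    refine hcore _ M (by omega) (hb.tr.pm _ _) ?_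
    have := (hb i j k).2
    simp only [t0, t1, Equiv.swap_apply_left]
    omega
  · have hjk : j ≠ k := by rintro rfl; omega
    obtain ⟨τ, t0, t1⟩ := perm_two j k hjk
    apply hp _ (Equiv.swap 0 i) τ
    refine hcore _ M (by omega) (hb.pm _ _) ?_
    have := (hb i j k).1
    simp only [t0, t1, Equiv.swap_apply_left]
    omega

lemma diag_wlog (P : Cfg → Prop) (hp : ∀ (X : Cfg) (σ τ : Equiv.Perm (Fin 3)), P (fun i j => X (σ i) (τ j)) → P X)
    (hcore : ∀ X : Cfg, AdjB X 1 → X 0 0 = X 1 1 + 2 → P X)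
    (h1 : ∀ X : Cfg, (∃ q, ∀ i j, X i j = q ∨ X i j = q + 1) → P X) (X : Cfg) (hX : AdjB X 1) : P X := by
  by_cases h : ∃ i j k l, X k l + 2 ≤ X i j
  · obtain ⟨i, j, k, l, h⟩ := h
    have a1 := (hX i j l).1
    have a2 := (hX l i k).2
    have hik : i ≠ k := by rintro rfl; omega
    have hjl : j ≠ l := by
      rintro rfl; have := (hX j i k).2; omega
    obtain ⟨τ, t0, t1⟩ := perm_two j l hjl
    obtain ⟨σ, s0, s1⟩ := perm_two i k hik
    apply hp _ σ τ
    refine hcore _ (hX.pm _ _) ?_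
    simp only [s0, s1, t0, t1]
    omega
  · push Not at h
    apply h1
    have hex : ∃ q, ∃ i j, X i j = q := ⟨_, 0, 0, rfl⟩
    obtain ⟨i, j, hq⟩ := Nat.find_spec hex
    refine ⟨Nat.find hex, fun k l => ?_⟩
    have h2 : Nat.find hex ≤ X k l := Nat.find_min' hex ⟨k, l, rfl⟩
    have h3 := h k l i j
    omega

def z4 (E : Cfg) (q : ℤ) : ℤ := KT4 (q + E 0 0) (q + E 0 1) (q + E 0 2) (q + E 1 0) (q + E 1 1) (q + E 1 2)
  (q + E 2 0) (q + E 2 1) (q + E 2 2)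
def z3 (E : Cfg) (q : ℤ) : ℤ := KT3 (q + E 0 0) (q + E 0 1) (q + E 0 2) (q + E 1 0) (q + E 1 1) (q + E 1 2)
  (q + E 2 0) (q + E 2 1) (q + E 2 2)

lemma z4_expand (E : Cfg) (q : ℤ) : 2 * z4 E q = 162 * q ^ 4 + 72 * sz E * q ^ 3 +
    (z4 E 2 + z4 E 0 - 2 * z4 E 1 - 1134 - 216 * sz E) * q ^ 2 +
    (4 * z4 E 1 - z4 E 2 - 3 * z4 E 0 + 972 + 144 * sz E) * q + 2 * z4 E 0 := by
  simp only [z4, sz, KT4, KB, B2]; push_cast; ring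

lemma z3_expand (E : Cfg) (q : ℤ) : 2 * z3 E q = 156 * q ^ 3 +
    (z3 E 2 + z3 E 0 - 2 * z3 E 1 - 468) * q ^ 2 + (4 * z3 E 1 - z3 E 2 - 3 * z3 E 0 + 312) * q + 2 * z3 E 0 := by
  simp only [z3, sz, KT3, KB, B2]; push_cast; ring

def permL : List (Equiv.Perm (Fin 3)) := [1, Equiv.swap 0 1, Equiv.swap 0 2, Equiv.swap 1 2,
  Equiv.swap 0 1 * Equiv.swap 1 2, Equiv.swap 1 2 * Equiv.swap 0 1]

def pmB (X Y : Cfg) : Bool := permL.any fun σ => permL.any fun τ =>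
  decide (∀ i j, X (σ i) (τ j) = Y i j)

lemma pm_of_pmB {X Y} (h : pmB X Y = true) : PM X Y := by
  unfold pmB at h
  simp only [List.any_eq_true, decide_eq_true_eq] at h
  obtain ⟨σ, _, τ, _, h⟩ := h
  exact ⟨σ, τ, h⟩

def nuB (a b c : ℕ) : ℕ := a * b + a * c + b * c

def nuK (a b c d e f : ℕ) : ℕ := a * (e + f) + b * (d + f) + c * (d + e)

def nu4' (a b c d e f g h i : ℕ) : ℕ :=
  nuB a b c * nuB d e f + nuB a b c * nuB g h i + nuB d e f * nuB g h i + nuB a b c * nuK d e f g h i +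
    nuB d e f * nuK a b c g h i + nuB g h i * nuK a b c d e f

def nu3' (a b c d e f g h i : ℕ) : ℕ :=
  nuB a b c * (d + e + f + (g + h + i)) + nuB d e f * (a + b + c + (g + h + i)) +
  nuB g h i * (a + b + c + (d + e + f)) +
  (a * (d * (h + i) + (e + f) * (g + h + i)) + b * (e * (g + i) + (d + f) * (g + h + i)) +
    c * (f * (g + h) + (d + e) * (g + h + i)))

def nu4 (E : Cfg) (q : ℕ) : ℕ := nu4' (q + E 0 0) (q + E 0 1) (q + E 0 2) (q + E 1 0) (q + E 1 1) (q + E 1 2)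
  (q + E 2 0) (q + E 2 1) (q + E 2 2)
def nu3 (E : Cfg) (q : ℕ) : ℕ := nu3' (q + E 0 0) (q + E 0 1) (q + E 0 2) (q + E 1 0) (q + E 1 1) (q + E 1 2)
  (q + E 2 0) (q + E 2 1) (q + E 2 2)

lemma nu4_eq (E : Cfg) (q : ℕ) : (nu4 E q : ℤ) = z4 E q := by
  simp only [nu4, z4, nu4', nuB, nuK, KT4, KB, B2]; push_cast; rfl

lemma nu3_eq (E : Cfg) (q : ℕ) : (nu3 E q : ℤ) = z3 E q := by
  simp only [nu3, z3, nu3', nuB, KT3, B2]; push_cast; rfl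

def chk (E : Cfg) (r : ℕ) : Bool :=
  Nat.ble (nu4 E 2 + nu4 E 0 + 2 * nu4 (pat r) 1) (nu4 (pat r) 2 + nu4 (pat r) 0 + 2 * nu4 E 1) &&
  Nat.ble (4 * nu4 E 1 + (nu4 (pat r) 2 + 3 * nu4 (pat r) 0)) (4 * nu4 (pat r) 1 + (nu4 E 2 + 3 * nu4 E 0)) &&
  Nat.ble (nu4 E 0) (nu4 (pat r) 0) &&
  Nat.ble (nu3 E 2 + nu3 E 0 + 2 * nu3 (pat r) 1) (nu3 (pat r) 2 + nu3 (pat r) 0 + 2 * nu3 E 1) &&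
  Nat.ble (4 * nu3 E 1 + (nu3 (pat r) 2 + 3 * nu3 (pat r) 0)) (4 * nu3 (pat r) 1 + (nu3 E 2 + 3 * nu3 E 0)) &&
  Nat.ble (nu3 E 0) (nu3 (pat r) 0) && Nat.beq (sz (pat r)) r &&
  ((if 5 ≤ r then Nat.blt (nu4 E 0) (nu4 (pat r) 0) else Nat.blt (nu4 E 1) (nu4 (pat r) 1)) || pmB E (pat r))

lemma chk_all : ∀ a b c d e f g h i : Fin 2,
    sz ![![a.val, b, c], ![d, e, f], ![g, h, i]] ≤ 8 →
    chk ![![a.val, b, c], ![d, e, f], ![g, h, i]] (sz ![![a.val, b, c], ![d, e, f], ![g, h, i]]) = true := by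
  decide +kernel

lemma cfg_eq (X : Cfg) : X = ![![X 0 0, X 0 1, X 0 2], ![X 1 0, X 1 1, X 1 2], ![X 2 0, X 2 1, X 2 2]] := by
  ext i j; fin_cases i <;> fin_cases j <;> rfl

lemma chk_cfg (E : Cfg) (h : ∀ i j, E i j < 2) (hs : sz E ≤ 8) : chk E (sz E) = true := by
  have := chk_all ⟨_, h 0 0⟩ ⟨_, h 0 1⟩ ⟨_, h 0 2⟩ ⟨_, h 1 0⟩ ⟨_, h 1 1⟩ ⟨_, h 1 2⟩ ⟨_, h 2 0⟩ ⟨_, h 2 1⟩ ⟨_, h 2 2⟩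
  simp only at this
  rw [← cfg_eq E] at this
  exact this hs

def f4 (m : ℕ) : ℕ := t4 (w0 m)
def f3 (m : ℕ) : ℕ := t3 (w0 m)

lemma t4_z4 (E : Cfg) (q : ℕ) : (t4 (fun i j => q + E i j) : ℤ) = z4 E q := by
  simp only [t4, z4, KT4, KB, B2]; push_cast; ring

lemma t3_z3 (E : Cfg) (q : ℕ) : (t3 (fun i j => q + E i j) : ℤ) = z3 E q := by
  simp only [t3, z3, KT3, KB, B2]; push_cast; ring

lemma w0_eq (q r : ℕ) (hr : r ≤ 8) : w0 (9 * q + r) = fun i j => q + pat r i j := by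
  unfold w0
  rw [show (9 * q + r) / 9 = q by omega, show (9 * q + r) % 9 = r by omega]

lemma bal_bound (E : Cfg) (h : ∀ i j, E i j < 2) (hs : sz E ≤ 8) (q : ℕ) :
    t4 (fun i j => q + E i j) ≤ f4 (9 * q + sz E) ∧ t3 (fun i j => q + E i j) ≤ f3 (9 * q + sz E) ∧
    (5 ≤ 9 * q + sz E → t4 (fun i j => q + E i j) = f4 (9 * q + sz E) →
      PM (fun i j => q + E i j) (w0 (9 * q + sz E))) := by
  have hc := chk_cfg E h hs
  unfold chk at hc
  unfold f4 f3
  rw [w0_eq q _ hs]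
  simp only [Bool.and_eq_true, Nat.ble_eq, Nat.beq_eq, Bool.or_eq_true] at hc
  obtain ⟨⟨⟨⟨⟨⟨⟨c1, c2⟩, c3⟩, c4⟩, c5⟩, c6⟩, c7⟩, c8⟩ := hc
  zify [nu4_eq, nu3_eq] at c1 c2 c3 c4 c5 c6
  replace c1 := sub_le_sub_iff.2 c1
  replace c2 := sub_le_sub_iff.2 c2
  replace c4 := sub_le_sub_iff.2 c4
  replace c5 := sub_le_sub_iff.2 c5
  have e1 := z4_expand E q
  have e2 := z4_expand (pat (sz E)) q
  have e3 := z3_expand E q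
  have e4 := z3_expand (pat (sz E)) q
  have g1 := t4_z4 E q
  have g2 := t4_z4 (pat (sz E)) q
  have g3 := t3_z3 E q
  have g4 := t3_z3 (pat (sz E)) q
  rw [c7] at e2
  have hq : (0 : ℤ) ≤ q := Int.natCast_nonneg q
  have hq2 : (0 : ℤ) ≤ (q : ℤ) ^ 2 := sq_nonneg _
  have d1 := mul_le_mul_of_nonneg_right c1 hq2
  have d2 := mul_le_mul_of_nonneg_right c2 hq
  have d4 := mul_le_mul_of_nonneg_right c4 hq2
  have d5 := mul_le_mul_of_nonneg_right c5 hq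
  refine ⟨?_, ?_, ?_⟩
  · zify; rw [g1, g2]; linarith
  · zify; rw [g3, g4]; linarith
  · intro hm heq
    rcases c8 with c8 | c8
    · exfalso
      have heq' : z4 E q = z4 (pat (sz E)) q := by rw [← g1, ← g2, heq]
      split_ifs at c8 with h5
      · rw [Nat.blt_eq] at c8
        zify [nu4_eq] at c8
        linarith
      · rw [Nat.blt_eq] at c8
        zify [nu4_eq] at c8
        have hq1 : (1 : ℤ) ≤ q := by omega
        have x1 := mul_le_mul_of_nonneg_right c1 (sub_nonneg.2 (one_le_pow₀ hq1 : (1 : ℤ) ≤ (q : ℤ) ^ 2))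
        have x2 := mul_le_mul_of_nonneg_right c2 (sub_nonneg.2 hq1)
        linarith
    · obtain ⟨σ, τ, h⟩ := pm_of_pmB c8
      exact ⟨σ, τ, fun i j => by simp only [h i j]⟩

lemma bal_bound' (X : Cfg) (hX : ∃ q, ∀ i j, X i j = q ∨ X i j = q + 1) :
    t4 X ≤ f4 (sz X) ∧ t3 X ≤ f3 (sz X) ∧ (5 ≤ sz X → t4 X = f4 (sz X) → PM X (w0 (sz X))) := by
  obtain ⟨q, hq⟩ := hX
  have key : ∀ q (E : Cfg), (∀ i j, E i j < 2) → sz E ≤ 8 → X = (fun i j => q + E i j) →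
     t4 X ≤ f4 (sz X) ∧ t3 X ≤ f3 (sz X) ∧ (5 ≤ sz X → t4 X = f4 (sz X) → PM X (w0 (sz X))) := by
    intro q E h1 h2 h3
    have := bal_bound E h1 h2 q
    have hs : sz X = 9 * q + sz E := by rw [h3]; simp only [sz]; ring
    rw [hs, h3]
    exact this
  by_cases h9 : ∀ i j, X i j = q + 1
  · exact key (q + 1) (fun _ _ => 0) (fun _ _ => by norm_num) (by simp [sz]) (by ext i j; simp [h9])
  · push Not at h9
    obtain ⟨i0, j0, h0⟩ := h9
    refine key q (fun i j => X i j - q) (fun i j => ?_) ?_ ?_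
    · rcases hq i j with h | h <;> omega
    · have hh : ∀ i j, X i j - q ≤ 1 := fun i j => by rcases hq i j with h | h <;> omega
      have h00 : X i0 j0 - q = 0 := by rcases hq i0 j0 with h | h <;> omega
      have a0 := hh 0 0; have a1 := hh 0 1; have a2 := hh 0 2
      have a3 := hh 1 0; have a4 := hh 1 1; have a5 := hh 1 2
      have a6 := hh 2 0; have a7 := hh 2 1; have a8 := hh 2 2
      clear hq hh h0
      simp only [sz]
      fin_cases i0 <;> fin_cases j0 <;> simp at h00 <;> omega
    · ext i j
      rcases hq i j with h | h <;> omega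

/-! ### T3 bound -/

def ex01 (X : Cfg) : Cfg := ![![X 0 0 - 1, X 0 1 + 1, X 0 2], ![X 1 0, X 1 1, X 1 2], ![X 2 0, X 2 1, X 2 2]]
def ex11 (X : Cfg) : Cfg := ![![X 0 0 - 1, X 0 1, X 0 2], ![X 1 0, X 1 1 + 1, X 1 2], ![X 2 0, X 2 1, X 2 2]]

lemma t3_ex01 (X : Cfg) (M : ℕ) (hM : 2 ≤ M) (hb : AdjB X M) (h : X 0 0 = X 0 1 + M) :
    t3 X ≤ t3 (ex01 X) ∧ sz (ex01 X) = sz X ∧ sqs (ex01 X) < sqs X := by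
  have h1 := (hb 1 1 0).1
  have h2 := (hb 2 1 0).1
  clear hb
  simp only [t3, sz, sqs, ex01, Matrix.cons_val_zero, Matrix.cons_val_one, Matrix.cons_val]
  generalize X 0 0 = a at *
  generalize X 0 1 = b at *
  generalize X 0 2 = c at *
  generalize X 1 0 = d at *
  generalize X 1 1 = e at *
  generalize X 1 2 = f at *
  generalize X 2 0 = g at *
  generalize X 2 1 = h at *
  generalize X 2 2 = i at *
  obtain ⟨k, rfl⟩ : ∃ k, M = k + 2 := ⟨M - 2, by omega⟩
  subst h
  rw [show b + (k + 2) - 1 = b + k + 1 by omega]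
  refine ⟨?_, by ring, by nlinarith⟩
  zify at *
  have k0 : (0:ℤ) ≤ k := by positivity
  have hd : (0:ℤ) ≤ d := by positivity
  have he : (0:ℤ) ≤ e := by positivity
  have hf : (0:ℤ) ≤ f := by positivity
  have hg : (0:ℤ) ≤ g := by positivity
  have hh : (0:ℤ) ≤ h := by positivity
  have hi : (0:ℤ) ≤ i := by positivity
  have p1 := mul_le_mul_of_nonneg_left h2 he
  have p2 := mul_le_mul_of_nonneg_left h1 hg
  have p3 := mul_le_mul_of_nonneg_left h1 hh
  have p4 := mul_le_mul_of_nonneg_left h2 hd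
  have kd := mul_nonneg k0 hd
  have ke := mul_nonneg k0 he
  have kf := mul_nonneg k0 hf
  have kg := mul_nonneg k0 hg
  have kh := mul_nonneg k0 hh
  have ki := mul_nonneg k0 hi
  simp only [KT3, B2]; push_cast
  linarith

lemma adj_two (X : Cfg) (hb : AdjB X 1) (h : X 0 0 = X 1 1 + 2) : ∃ q c f g h i : ℕ,
    X = ![![q + 2, q + 1, q + 1 + c], ![q + 1, q, q + f], ![q + 1 + g, q + h, q + i]] ∧
    c ≤ 1 ∧ f ≤ 1 ∧ g ≤ 1 ∧ h ≤ 1 ∧ i ≤ 2 := by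
  have h1 := (hb 0 0 1).1
  have h2 := (hb 1 0 1).2
  have h3 := (hb 0 0 1).2
  have h4 := (hb 1 0 1).1
  have h5 := (hb 0 0 2).1
  have h6 := (hb 0 2 1).1
  have h7 := (hb 0 0 2).2
  have h8 := (hb 0 2 1).2
  have h9 := (hb 1 2 1).1
  have h10 := (hb 2 0 1).2
  have h11 := (hb 1 2 1).2
  have h12 := (hb 2 0 1).1
  have h13 := (hb 2 2 1).1
  have h14 := (hb 2 0 2).1
  refine ⟨X 1 1, X 0 2 - (X 1 1 + 1), X 1 2 - X 1 1, X 2 0 - (X 1 1 + 1), X 2 1 - X 1 1, X 2 2 - X 1 1, ?_, ?_⟩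
  · conv_lhs => rw [cfg_eq X]
    clear hb
    congr! 3 <;> (try congr! 3) <;> omega
  · clear hb
    omega

set_option maxHeartbeats 1000000 in
lemma ex11_all (X : Cfg) (hb : AdjB X 1) (hd : X 0 0 = X 1 1 + 2) :
    t4 X < t4 (ex11 X) ∧ t3 X ≤ t3 (ex11 X) ∧ sz (ex11 X) = sz X ∧ sqs (ex11 X) < sqs X := by
  obtain ⟨q, c, f, g, h, i, rfl, hc, hf, hg, hh, hi⟩ := adj_two X hb hd
  clear hb hd
  simp only [t4, t3, sz, sqs, ex11, Matrix.cons_val_zero, Matrix.cons_val_one, Matrix.cons_val,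
    show q + 2 - 1 = q + 1 by omega]
  refine ⟨?_, ?_, by ring, by nlinarith⟩
  · have key : KT4 (q + 1) (q + 1) (q + 1 + c) (q + 1) (q + 1) (q + f) (q + 1 + g) (q + h) (q + i) +
        (f * h * (1 + 2 * q) + (f + h) * (3 * q * q)) =
        KT4 (q + 2) (q + 1) (q + 1 + c) (q + 1) q (q + f) (q + 1 + g) (q + h) (q + i) +
        (8 + 5 * c + c * f + 3 * c * g + 2 * c * g * q + c * i + 10 * c * q + 3 * c * q * q + f + f * i + 5 * g +
          g * h + g * i + 10 * g * q + 3 * g * q * q + h + h * i + 4 * i + 6 * i * q + 26 * q + 21 * q * q) := by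
      simp only [KT4, KB, B2]; ring
    have b1 : f * h * (1 + 2 * q) ≤ 1 * 1 * (1 + 2 * q) := by gcongr
    have b2 : (f + h) * (3 * q * q) ≤ (1 + 1) * (3 * q * q) := by gcongr
    have b3 : 0 ≤ c * f + 3 * c * g + 2 * c * g * q + c * i + 10 * c * q + 3 * c * q * q + f * i +
      g * h + g * i + 10 * g * q + 3 * g * q * q + h * i + 6 * i * q + q * q := Nat.zero_le _
    linarith [Nat.zero_le (q * q)]
  · have key : KT3 (q + 1) (q + 1) (q + 1 + c) (q + 1) (q + 1) (q + f) (q + 1 + g) (q + h) (q + i) + (f + h) * q =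
        KT3 (q + 2) (q + 1) (q + 1 + c) (q + 1) q (q + f) (q + 1 + g) (q + h) (q + i) +
        (6 + 2 * c + c * q + 2 * g + g * q + i + 9 * q) := by
      simp only [KT3, B2]; ring
    have b2 : (f + h) * q ≤ (1 + 1) * q := by gcongr
    have b3 : 0 ≤ c * q + g * q := Nat.zero_le _
    linarith

theorem t3_bound (X : Cfg) : t3 X ≤ f3 (sz X) := by
  have main : ∀ n (X : Cfg), sqs X ≤ n → t3 X ≤ f3 (sz X) := by
    intro n
    induction n with
    | zero =>
      intro X h
      have h0 : ∀ i j, X i j = 0 := by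
        simp only [sqs] at h
        intro i j
        fin_cases i <;> fin_cases j <;> simp <;> nlinarith
      exact (bal_bound' X ⟨0, fun i j => Or.inl (h0 i j)⟩).2.1
    | succ n ih =>
      intro X
      apply adj_wlog (fun X => sqs X ≤ n + 1 → t3 X ≤ f3 (sz X))
      · intro X σ τ h
        rw [(inv_pm X σ τ).2.1, (inv_pm X σ τ).2.2.1, (inv_pm X σ τ).2.2.2] at h
        exact h
      · intro X h
        rw [(inv_tr X).2.1, (inv_tr X).2.2.1, (inv_tr X).2.2.2] at h
        exact h
      · intro X M hM hb h hn
        obtain ⟨h1, h2, h3⟩ := t3_ex01 X M hM hb h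
        have := ih (ex01 X) (by omega)
        rw [h2] at this
        omega
      · apply diag_wlog (fun X => sqs X ≤ n + 1 → t3 X ≤ f3 (sz X))
        · intro X σ τ h
          rw [(inv_pm X σ τ).2.1, (inv_pm X σ τ).2.2.1, (inv_pm X σ τ).2.2.2] at h
          exact h
        · intro X hb h hn
          obtain ⟨_, h1, h2, h3⟩ := ex11_all X hb h
          have := ih (ex11 X) (by omega)
          rw [h2] at this
          omega
        · intro X h _
          exact (bal_bound' X h).2.1
  exact main _ X le_rfl

lemma core4_fin : ∀ c d e : Fin 3, ∀ f : Fin 4, ∀ i : Fin 2, 5 ≤ sz ![![2, 0, c.val], ![d, e, f], ![0, 2, i]] →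
    t4 ![![2, 0, c.val], ![d, e, f], ![0, 2, i]] < t4 (w0 (sz ![![2, 0, c.val], ![d, e, f], ![0, 2, i]])) := by
  decide +kernel

lemma core4 (M b c d e f g h i : ℤ) (hM : 2 ≤ M) (hb : 0 ≤ b) (hc : 0 ≤ c)
    (hf : 0 ≤ f) (hi : 0 ≤ i) (hd : b ≤ d) (hg : b ≤ g) (he : e ≤ b + M) (hh : h ≤ b + M) (he0 : 0 ≤ e) (hh0 : 0 ≤ h)
    (hcl : b ≤ c) (hde : e ≤ d + M) (hgh : h ≤ g + M) (hdg : d ≤ g + M) (heh : h ≤ e + M)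
    (hih : h ≤ i + M) (hfi : f ≤ i + M) (hts : e - d ≤ h - g)
    (hpos : 0 < KT4 (b + M) b c d e f g h i)
    (h1 : KT4 (b + M - 1) (b + 1) c d e f g h i ≤ KT4 (b + M) b c d e f g h i)
    (h2 : 1 ≤ e → KT4 (b + M) b c (d + 1) (e - 1) f g h i ≤ KT4 (b + M) b c d e f g h i) :
    b = 0 ∧ M = 2 ∧ g = 0 ∧ h = 2 ∧ d ≤ 2 ∧ e ≤ 2 ∧ f ≤ 3 ∧ i ≤ 1 := by
  have hd0 : 0 ≤ d := hb.trans hd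
  have hg0 : 0 ≤ g := hb.trans hg
  have c1 : (M - 1) * (B2 d e f + B2 g h i + KB d e f g h i) ≤ B2 g h i * (e - d) + B2 d e f * (h - g) := by
    simp only [KT4, KB, B2] at h1 ⊢; linarith
  have c2 : 1 ≤ e → (e - d - 1) * (B2 (b + M) b c + B2 g h i + KB (b + M) b c g h i) ≤
     B2 g h i * (b + M - b) + B2 (b + M) b c * (g - h) := by
    intro he
    have := h2 he
    simp only [KT4, KB, B2] at this ⊢; linarith
  have hT : KT4 (b + M) b c d e f g h i = (B2 d e f + B2 g h i + KB d e f g h i) * B2 (b + M) b c +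
     ((b + M) * (B2 g h i * (e + f) + B2 d e f * (h + i)) + b * (B2 g h i * (d + f) + B2 d e f * (g + i)) +
      c * (B2 g h i * (d + e) + B2 d e f * (g + h))) + B2 d e f * B2 g h i := by
    simp only [KT4, KB, B2]; ring
  clear h1 h2
  obtain ⟨V, hV⟩ : ∃ V, V = B2 d e f := ⟨_, rfl⟩
  obtain ⟨W, hW⟩ : ∃ W, W = B2 g h i := ⟨_, rfl⟩
  obtain ⟨B, hB⟩ : ∃ B, B = KB d e f g h i := ⟨_, rfl⟩
  rw [← hV, ← hW, ← hB] at c1 hT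
  rw [hT] at hpos
  have hV0 : 0 ≤ V := by rw [hV]; unfold B2; positivity
  have hW0 : 0 ≤ W := by rw [hW]; unfold B2; positivity
  have hB0 : 0 ≤ B := by rw [hB]; unfold KB; positivity
  -- B > 0
  have hBpos : 0 < B := by
    rcases hB0.lt_or_eq with hlt | hB0'
    · exact hlt
    exfalso
    have hBe : d * h + d * i + e * g + e * i + f * g + f * h = 0 := by
      rw [← hB0'] at hB; unfold KB at hB; linarith
    have p1 := mul_nonneg hd0 hh0
    have p2 := mul_nonneg hd0 hi
    have p3 := mul_nonneg he0 hg0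
    have p4 := mul_nonneg he0 hi
    have p5 := mul_nonneg hf hg0
    have p6 := mul_nonneg hf hh0
    have z1 : d * h = 0 := by linarith
    have z2 : d * i = 0 := by linarith
    have z3 : e * g = 0 := by linarith
    have z4 : e * i = 0 := by linarith
    have z5 : f * g = 0 := by linarith
    have z6 : f * h = 0 := by linarith
    have w1 : W * e = 0 := by
      have : W * e = (e * g) * h + (e * g) * i + (e * i) * h := by rw [hW, B2]; ring
      rw [this, z3, z4]; ring
    have w2 : W * d = 0 := by
      have : W * d = (d * h) * g + (d * i) * g + (d * i) * h := by rw [hW, B2]; ring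
      rw [this, z1, z2]; ring
    have w3 : V * h = 0 := by
      have : V * h = (d * h) * e + (d * h) * f + (f * h) * e := by rw [hV, B2]; ring
      rw [this, z1, z6]; ring
    have w4 : V * g = 0 := by
      have : V * g = (e * g) * d + (f * g) * d + (f * g) * e := by rw [hV, B2]; ring
      rw [this, z3, z5]; ring
    have hVW : (M - 1) * (V + W) ≤ 0 := by
      rw [← hB0'] at c1
      linarith
    have hVW0 : V + W ≤ 0 := by
      by_contra hcon
      have : 0 < (M - 1) * (V + W) := mul_pos (by linarith) (by linarith)
      linarith
    have hV1 : V = 0 := by linarith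
    have hW1 : W = 0 := by linarith
    rw [hV1, hW1, ← hB0'] at hpos
    simp at hpos
  have ht : h - g = M := by
    by_contra hne
    have ht' : h - g ≤ M - 1 := by omega
    have hs' : e - d ≤ M - 1 := by omega
    have x1 := mul_le_mul_of_nonneg_left ht' hV0
    have x2 := mul_le_mul_of_nonneg_left hs' hW0
    have x3 : 0 < (M - 1) * B := by apply mul_pos <;> linarith
    linarith
  have hgb : b = g := by omega
  subst hgb
  obtain rfl : b + M = h := by omega
  have hi' : b ≤ i := by linarith
  have heb : b ≤ e := by linarith
  have hV2 : V < 2 * B := by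
    rw [hV, hB]
    unfold B2 KB
    have p1 := mul_nonneg hd0 (show 0 ≤ b + M - e by linarith)
    have p2 := mul_nonneg hf (show 0 ≤ b + M - d by linarith)
    have p3 := mul_nonneg hf (show 0 ≤ b + M - e by linarith)
    have p4 := mul_nonneg hd0 hi
    have p5 := mul_nonneg he0 hb
    have p6 := mul_nonneg he0 hi
    have p7 := mul_nonneg hf hb
    rcases hd0.lt_or_eq with hlt | heq
    · have p8 := mul_pos hlt (show 0 < b + M by linarith)
      linarith
    · rw [hB, KB] at hBpos
      rw [← heq] at hBpos ⊢
      have p9 := mul_nonneg hf (show 0 ≤ b + M by linarith)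
      linarith
  by_cases hs : e - d = M
  · exfalso
    obtain rfl : d = b := by linarith
    obtain rfl : e = d + M := by linarith
    have hVWB : V + W = B := by rw [hV, hW, hB]; unfold B2 KB; ring
    have c3 : (M - 2) * B ≤ 0 := by
      rw [ht] at c1
      have : V = B - W := by linarith
      rw [this] at c1
      linarith
    have hM2 : M = 2 := by
      by_contra hne
      have : 0 < (M - 2) * B := mul_pos (by omega) hBpos
      linarith
    subst hM2
    have c4 := c2 (by linarith)
    unfold B2 KB at c4
    have p1 := mul_nonneg hb hb
    have p2 := mul_nonneg hb hc
    have p3 := mul_nonneg hb hi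
    linarith
  · have hs1 : e - d ≤ M - 1 := by omega
    have x2 := mul_le_mul_of_nonneg_left hs1 hW0
    rw [ht] at c1
    have hM2 : M = 2 := by
      by_contra hne
      have : 2 * B ≤ (M - 1) * B := mul_le_mul_of_nonneg_right (by omega) hB0
      linarith
    subst hM2
    clear c2 hT hpos hts x2 ht hgh
    have c3 : (1 - (e - d)) * W + B - V ≤ 0 := by linarith
    rw [hV, hW, hB] at c3
    unfold B2 KB at c3
    obtain ⟨d', rfl⟩ : ∃ d', d = b + d' := ⟨d - b, by ring⟩
    obtain ⟨e', rfl⟩ : ∃ e', e = b + e' := ⟨e - b, by ring⟩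
    obtain ⟨i', rfl⟩ : ∃ i', i = b + i' := ⟨i - b, by ring⟩
    have hi0 : 0 ≤ i' := by linarith
    have p1 := mul_nonneg hb hb
    have p2 := mul_nonneg hb hi0
    have p3 := mul_nonneg hb hf
    have l1 : 0 ≤ d' := by linarith
    have l2 : d' ≤ 2 := by linarith
    have l3 : 0 ≤ e' := by linarith
    have l4 : e' ≤ 2 := by linarith
    clear c1 hV2 hBpos hB0 hW0 hV0 hV hW hB
    have hb0 : b = 0 := by
      by_contra hne
      have hb1 : 1 ≤ b := by omega
      clear hne
      interval_cases d' <;> interval_cases e' <;> first | (exfalso; omega) | nlinarith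
    subst hb0
    refine ⟨rfl, rfl, rfl, rfl, by linarith, by linarith, ?_, ?_⟩
    · interval_cases d' <;> interval_cases e' <;> first | (exfalso; omega) | linarith
    · interval_cases d' <;> interval_cases e' <;> first | (exfalso; omega) | linarith

def Mx (X : Cfg) : Prop := ∀ Y : Cfg, sz Y = sz X → t4 Y ≤ t4 X

lemma sz_w0 (m : ℕ) : sz (w0 m) = m := by
  have h : ∀ r < 9, sz (pat r) = r := by decide
  have := h (m % 9) (Nat.mod_lt _ (by norm_num))
  simp only [sz, w0] at this ⊢
  omega

lemma sz_tab (a b c d e f g h i : ℕ) : sz ![![a, b, c], ![d, e, f], ![g, h, i]] = a + b + c + d + e + f + g + h + i := rfl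
lemma t4_tab (a b c d e f g h i : ℕ) : t4 ![![a, b, c], ![d, e, f], ![g, h, i]] = KT4 a b c d e f g h i := rfl

lemma KT4_cast (a b c d e f g h i : ℕ) : ((KT4 a b c d e f g h i : ℕ) : ℤ) =
    KT4 (a : ℤ) b c d e f g h i := by simp only [KT4, KB, B2]; push_cast; ring

lemma mx_core (X : Cfg) (M : ℕ) (hM : 2 ≤ M) (hb : AdjB X M) (h : X 0 0 = X 0 1 + M) (hm : 5 ≤ sz X)
    (hpos : 0 < t4 X) (hts : X 1 1 + X 2 0 ≤ X 2 1 + X 1 0) (hx : Mx X) : False := by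
  have e := cfg_eq X
  obtain ⟨a, ha⟩ : ∃ a, a = X 0 0 := ⟨_, rfl⟩
  obtain ⟨b, hb'⟩ : ∃ a, a = X 0 1 := ⟨_, rfl⟩
  obtain ⟨c, hc⟩ : ∃ a, a = X 0 2 := ⟨_, rfl⟩
  obtain ⟨d, hd⟩ : ∃ a, a = X 1 0 := ⟨_, rfl⟩
  obtain ⟨e', he⟩ : ∃ a, a = X 1 1 := ⟨_, rfl⟩
  obtain ⟨f, hf⟩ : ∃ a, a = X 1 2 := ⟨_, rfl⟩
  obtain ⟨g, hg⟩ : ∃ a, a = X 2 0 := ⟨_, rfl⟩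
  obtain ⟨h', hh⟩ : ∃ a, a = X 2 1 := ⟨_, rfl⟩
  obtain ⟨i, hi⟩ : ∃ a, a = X 2 2 := ⟨_, rfl⟩
  have a1 := (hb 0 0 1).2
  have a2 := (hb 0 0 2).2
  have a3 := (hb 1 1 0).2
  have a4 := (hb 1 2 0).2
  have a5 := (hb 0 0 2).1
  have a6 := (hb 1 1 0).1
  have a7 := (hb 2 1 0).1
  have a8 := (hb 0 1 2).2
  have a9 := (hb 1 2 1).2
  have a10 := (hb 2 1 2).1
  have a11 := (hb 2 1 2).2
  have a12 := (hb 0 2 1).1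
  clear hb
  rw [← ha, ← hb', ← hc, ← hd, ← he, ← hf, ← hg, ← hh, ← hi] at e
  rw [← ha, ← hb'] at h
  rw [← he, ← hg, ← hh, ← hd] at hts
  rw [← ha] at a1 a2 a5
  rw [← hb'] at a3 a4 a12
  rw [← hc] at a5 a12
  rw [← hd] at a1 a6 a8
  rw [← he] at a3 a6 a9
  rw [← hf] at a11
  rw [← hg] at a2 a7 a8
  rw [← hh] at a4 a7 a9 a10
  rw [← hi] at a10 a11
  subst h
  clear ha hb' hc hd he hf hg hh hi
  rw [e] at hx hm hpos
  have x1 := hx ![![b + M - 1, b + 1, c], ![d, e', f], ![g, h', i]] (by rw [sz_tab, sz_tab]; omega)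
  have x2 : 1 ≤ e' → _ := fun he => hx ![![b + M, b, c], ![d + 1, e' - 1, f], ![g, h', i]] (by rw [sz_tab, sz_tab]; omega)
  have x3 := hx (w0 _) (sz_w0 _)
  rw [t4_tab, t4_tab] at x1 x2
  rw [t4_tab] at hpos
  have y0 : (0 : ℤ) < KT4 ((b : ℤ) + M) b c d e' f g h' i := by
    rw [← Nat.cast_add, ← KT4_cast]; exact_mod_cast hpos
  have y1 : KT4 ((b : ℤ) + M - 1) (b + 1) c d e' f g h' i ≤ KT4 ((b : ℤ) + M) b c d e' f g h' i := by
    have : ((b + M - 1 : ℕ) : ℤ) = (b : ℤ) + M - 1 := by omega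
    rw [← this, ← Nat.cast_add, ← Nat.cast_add_one, ← KT4_cast, ← KT4_cast]; exact_mod_cast x1
  have y2 : 1 ≤ (e' : ℤ) → KT4 ((b : ℤ) + M) b c (d + 1) (e' - 1) f g h' i ≤ KT4 ((b : ℤ) + M) b c d e' f g h' i := by
    intro he
    have he' : 1 ≤ e' := by omega
    have : ((e' - 1 : ℕ) : ℤ) = (e' : ℤ) - 1 := by omega
    rw [← this, ← Nat.cast_add, ← Nat.cast_add_one, ← KT4_cast, ← KT4_cast]; exact_mod_cast x2 he'
  clear x1 x2 hpos hx e
  have := core4 M b c d e' f g h' i (by omega) (by omega) (by omega) (by omega) (by omega) (by omega) (by omega)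
    (by omega) (by omega) (by omega) (by omega) (by omega) (by omega) (by omega) (by omega) (by omega) (by omega)
    (by omega) (by omega) y0 y1 y2
  clear y0 y1 y2
  obtain ⟨b0, m0, g0, h0, d2, e2, f3, i1⟩ := this
  have hc2 : c < 3 := by omega
  obtain rfl : b = 0 := by omega
  obtain rfl : M = 2 := by omega
  obtain rfl : g = 0 := by omega
  obtain rfl : h' = 2 := by omega
  have := core4_fin ⟨c, hc2⟩ ⟨d, by omega⟩ ⟨e', by omega⟩ ⟨f, by omega⟩ ⟨i, by omega⟩ hm
  exact absurd x3 (not_le.2 this)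

lemma Mx.pm {X : Cfg} (h : Mx X) (σ τ : Equiv.Perm (Fin 3)) : Mx (fun i j => X (σ i) (τ j)) := by
  intro Y hY
  rw [(inv_pm X σ τ).2.2.1] at hY
  rw [(inv_pm X σ τ).1]
  exact h Y hY

lemma Mx.tr {X : Cfg} (h : Mx X) : Mx (fun i j => X j i) := by
  intro Y hY
  rw [(inv_tr X).2.2.1] at hY
  rw [(inv_tr X).1]
  exact h Y hY

lemma mx_core' (X : Cfg) (M : ℕ) (hM : 2 ≤ M) (hb : AdjB X M) (h : X 0 0 = X 0 1 + M) (hm : 5 ≤ sz X)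
    (hpos : 0 < t4 X) (hx : Mx X) : False := by
  by_cases hts : X 1 1 + X 2 0 ≤ X 2 1 + X 1 0
  · exact mx_core X M hM hb h hm hpos hts hx
  · refine mx_core _ M hM (hb.pm (Equiv.swap 1 2) 1) ?_ ?_ ?_ ?_ (hx.pm (Equiv.swap 1 2) 1)
    · exact h
    · rw [(inv_pm X _ _).2.2.1]; exact hm
    · rw [(inv_pm X _ _).1]; exact hpos
    · show X 2 1 + X 1 0 ≤ X 1 1 + X 2 0
      omega

lemma mx_bal0 (X : Cfg) : 5 ≤ sz X → 0 < t4 X → Mx X → ∃ q, ∀ i j, X i j = q ∨ X i j = q + 1 := by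
  have hp : ∀ (X : Cfg) (σ τ : Equiv.Perm (Fin 3)),
      (5 ≤ sz (fun i j => X (σ i) (τ j)) → 0 < t4 (fun i j => X (σ i) (τ j)) → Mx (fun i j => X (σ i) (τ j)) →
        ∃ q, ∀ i j, X (σ i) (τ j) = q ∨ X (σ i) (τ j) = q + 1) →
      (5 ≤ sz X → 0 < t4 X → Mx X → ∃ q, ∀ i j, X i j = q ∨ X i j = q + 1) := by
    intro X σ τ h h1 h2 h3
    rw [(inv_pm X σ τ).1, (inv_pm X σ τ).2.2.1] at h
    obtain ⟨q, hq⟩ := h h1 h2 (h3.pm σ τ)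
    refine ⟨q, fun i j => ?_⟩
    have := hq (σ.symm i) (τ.symm j)
    simpa using this
  apply adj_wlog (fun X => 5 ≤ sz X → 0 < t4 X → Mx X → ∃ q, ∀ i j, X i j = q ∨ X i j = q + 1) hp
  · intro X h h1 h2 h3
    rw [(inv_tr X).1, (inv_tr X).2.2.1] at h
    obtain ⟨q, hq⟩ := h h1 h2 h3.tr
    exact ⟨q, fun i j => hq j i⟩
  · intro X M hM hb h h1 h2 h3
    exact (mx_core' X M hM hb h h1 h2 h3).elim
  · apply diag_wlog (fun X => 5 ≤ sz X → 0 < t4 X → Mx X → ∃ q, ∀ i j, X i j = q ∨ X i j = q + 1) hp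
    · intro X hb h h1 h2 h3
      have h4 := ex11_all X hb h
      have h5 := h3 _ h4.2.2.1
      omega
    · intro X h _ _ _
      exact h

lemma mx_bal (X : Cfg) (hm : 5 ≤ sz X) (hpos : 0 < t4 X) (hx : Mx X) : t4 X = f4 (sz X) ∧ PM X (w0 (sz X)) := by
  have key := bal_bound' X (mx_bal0 X hm hpos hx)
  have := hx (w0 _) (sz_w0 _)
  have e : t4 X = f4 (sz X) := le_antisymm key.1 this
  exact ⟨e, key.2.2 hm e⟩

lemma t4_mono {X Y : Cfg} (h : ∀ i j, X i j ≤ Y i j) : t4 X ≤ t4 Y := by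
  unfold t4 KT4 KB B2
  gcongr <;> apply h

lemma t3_mono {X Y : Cfg} (h : ∀ i j, X i j ≤ Y i j) : t3 X ≤ t3 Y := by
  unfold t3 KT3 B2
  gcongr <;> apply h

lemma t2_mono {X Y : Cfg} (h : ∀ i j, X i j ≤ Y i j) : t2 X ≤ t2 Y := by
  unfold t2 T2 B2
  gcongr <;> apply h

lemma f4_pos (m : ℕ) (hm : 5 ≤ m) : 0 < f4 m := by
  by_cases h : 9 ≤ m
  · have h1 : t4 (fun _ _ => 1) ≤ f4 m := t4_mono fun i j => by unfold w0; omega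
    exact lt_of_lt_of_le (by decide) h1
  · have hd : ∀ m < 9, 5 ≤ m → 0 < f4 m := by decide +kernel
    exact hd m (by omega) hm

theorem t4_bound (X : Cfg) (hm : 5 ≤ sz X) : t4 X ≤ f4 (sz X) ∧ (t4 X = f4 (sz X) → PM X (w0 (sz X))) := by
  have hfin : (Set.Finite {Y : Cfg | sz Y = sz X}) := by
    apply (Set.finite_Icc (0 : Cfg) (fun _ _ => sz X)).subset
    intro Y hY
    have hY' : sz Y = sz X := hY
    refine ⟨fun _ _ => Nat.zero_le _, ?_⟩
    intro i j
    show Y i j ≤ sz X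
    rw [← hY']
    unfold sz
    fin_cases i <;> fin_cases j <;> simp <;> omega
  obtain ⟨Z, hZ, hmax⟩ := hfin.exists_maximalFor t4 _ ⟨X, rfl⟩
  have hZ' : sz Z = sz X := hZ
  have hmx : Mx Z := by
    intro Y hY
    by_contra hlt
    have := hmax (j := Y) (hY.trans hZ') (by omega)
    omega
  have h0 : f4 (sz X) ≤ t4 Z := hmx (w0 (sz X)) ((sz_w0 _).trans hZ'.symm)
  have hp := f4_pos _ hm
  obtain ⟨e, _⟩ := mx_bal Z (by omega) (by omega) hmx
  rw [hZ'] at e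
  have h1 : t4 X ≤ t4 Z := hmx X hZ'.symm
  refine ⟨by omega, fun heq => ?_⟩
  have hX : Mx X := by
    intro Y hY
    have := hmx Y (hY.trans hZ'.symm)
    omega
  exact (mx_bal X hm (by omega) hX).2

def pad (X : Cfg) (k : ℕ) : Cfg := fun i j => if i = 0 ∧ j = 0 then X i j + k else X i j

lemma pad_le (X : Cfg) (k : ℕ) (i j : Fin 3) : X i j ≤ pad X k i j := by
  unfold pad; split_ifs <;> omega

lemma sz_pad (X : Cfg) (k : ℕ) : sz (pad X k) = sz X + k := by
  simp [sz, pad]; omega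

lemma t4_weak (X : Cfg) (m : ℕ) (hm : 5 ≤ m) (h : sz X ≤ m) : t4 X ≤ f4 m := by
  have hs : sz (pad X (m - sz X)) = m := by rw [sz_pad]; omega
  have := (t4_bound (pad X (m - sz X)) (by omega)).1
  rw [hs] at this
  exact (t4_mono (pad_le X _)).trans this

lemma t3_weak (X : Cfg) (m : ℕ) (h : sz X ≤ m) : t3 X ≤ f3 m := by
  have hs : sz (pad X (m - sz X)) = m := by rw [sz_pad]; omega
  have := t3_bound (pad X (m - sz X))
  rw [hs] at this
  exact (t3_mono (pad_le X _)).trans this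

lemma t4_strict (X : Cfg) (m : ℕ) (hm : 5 ≤ m) (h : sz X < m) : t4 X < f4 m := by
  by_contra hcon
  push Not at hcon
  have hp := f4_pos m hm
  rw [cfg_eq X] at h hcon
  generalize X 0 0 = x0 at *
  generalize X 0 1 = x1 at *
  generalize X 0 2 = x2 at *
  generalize X 1 0 = x3 at *
  generalize X 1 1 = x4 at *
  generalize X 1 2 = x5 at *
  generalize X 2 0 = x6 at *
  generalize X 2 1 = x7 at *
  generalize X 2 2 = x8 at *
  rw [sz_tab] at h
  rw [t4_tab] at hcon
  have g : ∀ a b c d e f g h i : ℕ, a + b + c + d + e + f + g + h + i ≤ m → KT4 a b c d e f g h i ≤ f4 m :=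
    fun a b c d e f g h i hh => t4_weak ![![a, b, c], ![d, e, f], ![g, h, i]] m hm (by rw [sz_tab]; exact hh)
  have e0 := Nat.mul_le_mul_left x0 ((g (x0 + 1) x1 x2 x3 x4 x5 x6 x7 x8 (by omega)).trans hcon)
  have e1 := Nat.mul_le_mul_left x1 ((g x0 (x1 + 1) x2 x3 x4 x5 x6 x7 x8 (by omega)).trans hcon)
  have e2 := Nat.mul_le_mul_left x2 ((g x0 x1 (x2 + 1) x3 x4 x5 x6 x7 x8 (by omega)).trans hcon)
  have e3 := Nat.mul_le_mul_left x3 ((g x0 x1 x2 (x3 + 1) x4 x5 x6 x7 x8 (by omega)).trans hcon)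
  have e4 := Nat.mul_le_mul_left x4 ((g x0 x1 x2 x3 (x4 + 1) x5 x6 x7 x8 (by omega)).trans hcon)
  have e5 := Nat.mul_le_mul_left x5 ((g x0 x1 x2 x3 x4 (x5 + 1) x6 x7 x8 (by omega)).trans hcon)
  have e6 := Nat.mul_le_mul_left x6 ((g x0 x1 x2 x3 x4 x5 (x6 + 1) x7 x8 (by omega)).trans hcon)
  have e7 := Nat.mul_le_mul_left x7 ((g x0 x1 x2 x3 x4 x5 x6 (x7 + 1) x8 (by omega)).trans hcon)
  have e8 := Nat.mul_le_mul_left x8 ((g x0 x1 x2 x3 x4 x5 x6 x7 (x8 + 1) (by omega)).trans hcon)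
  have hpos : 0 < KT4 x0 x1 x2 x3 x4 x5 x6 x7 x8 := by omega
  clear hcon g
  simp only [KT4, KB, B2] at *
  linarith

def f2 (m : ℕ) : ℕ := t2 (w0 m)

lemma t2_sq (X : Cfg) : 2 * t2 X + sqs X = sz X ^ 2 := by
  unfold t2 sqs sz T2 B2; ring

lemma t2_weak (X : Cfg) (m : ℕ) (h : sz X ≤ m) : t2 X ≤ f2 m := by
  have key : ∀ Y : Cfg, sz Y = m → t2 Y ≤ f2 m := by
    intro Y hY
    have h1 := t2_sq Y
    have h2 := t2_sq (w0 m)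
    rw [sz_w0] at h2
    rw [hY] at h1
    have h3 : sqs (w0 m) ≤ sqs Y := by
      have hw : ∀ i j, ((w0 m i j : ℤ) - (m / 9 : ℕ)) * ((w0 m i j : ℤ) - (m / 9 : ℕ) - 1) = 0 := by
        intro i j
        unfold w0 pat
        split_ifs <;> push_cast <;> ring
      have hy : ∀ i j, 0 ≤ ((Y i j : ℤ) - (m / 9 : ℕ)) * ((Y i j : ℤ) - (m / 9 : ℕ) - 1) := by
        intro i j
        generalize ((Y i j : ℤ) - (m / 9 : ℕ)) = x
        rcases le_or_gt x 0 with h | h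
        · exact mul_nonneg_of_nonpos_of_nonpos h (by linarith)
        · exact mul_nonneg h.le (by linarith [Int.add_one_le_iff.2 h])
      have s1 : (sz Y : ℤ) = sz (w0 m) := by rw [hY, sz_w0]
      generalize m / 9 = q at *
      have a0 := hw 0 0; have a1 := hw 0 1; have a2 := hw 0 2
      have a3 := hw 1 0; have a4 := hw 1 1; have a5 := hw 1 2
      have a6 := hw 2 0; have a7 := hw 2 1; have a8 := hw 2 2
      have b0 := hy 0 0; have b1 := hy 0 1; have b2 := hy 0 2
      have b3 := hy 1 0; have b4 := hy 1 1; have b5 := hy 1 2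
      have b6 := hy 2 0; have b7 := hy 2 1; have b8 := hy 2 2
      clear hw hy h1 h2
      zify
      have s2 : (2 * q + 1 : ℤ) * sz Y = (2 * q + 1 : ℤ) * sz (w0 m) := by rw [s1]
      simp only [sz, sqs] at *
      push_cast at *
      linarith
    unfold f2
    omega
  have hs : sz (pad X (m - sz X)) = m := by rw [sz_pad]; omega
  exact (t2_mono (pad_le X _)).trans (key _ hs)

def tw0 (a b c d e f x y z : ℕ) : Cfg := ![![a, z, b], ![y, d, f], ![c, e, x]]
def tw1 (a b c d e f x y z : ℕ) : Cfg := tw0 b c a e f d y z x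
def tw2 (a b c d e f x y z : ℕ) : Cfg := tw0 c a b f d e z x y

lemma tw0_t3 (a b c d e f x y z : ℤ) : KT3 a z b y d f c e x =
    PT3 a b c d e f x y z + x * ((b - e) * (c - f) + y * z) := by
  simp only [KT3, PT3, B2]; ring

lemma tw0_t4 (a b c d e f y z : ℕ) : KT4 a z b y d f c e 0 = PT4 a b c d e f 0 y z := by
  simp only [KT4, PT4, B2, KB]; ring

lemma PT3_cyc (a b c d e f x y z : ℕ) : PT3 b c a e f d y z x = PT3 a b c d e f x y z := by
  simp only [PT3, B2]; ring

lemma PT4_cyc (a b c d e f x y z : ℕ) : PT4 b c a e f d y z x = PT4 a b c d e f x y z := by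
  simp only [PT4, B2]; ring

lemma PT3_le0 (a b c d e f x y z : ℕ) (h : 0 ≤ ((b : ℤ) - e) * ((c : ℤ) - f)) :
    PT3 a b c d e f x y z ≤ t3 (tw0 a b c d e f x y z) := by
  have h1 := tw0_t3 a b c d e f x y z
  have : (0 : ℤ) ≤ x * (((b : ℤ) - e) * ((c : ℤ) - f) + y * z) := by positivity
  have e1 : ((PT3 a b c d e f x y z : ℕ) : ℤ) = PT3 (a : ℤ) b c d e f x y z := by
    simp only [PT3, B2]; push_cast; ring
  have e2 : ((t3 (tw0 a b c d e f x y z) : ℕ) : ℤ) = KT3 (a : ℤ) z b y d f c e x := by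
    simp only [t3, tw0, KT3, B2, Matrix.cons_val_zero, Matrix.cons_val_one, Matrix.cons_val]; push_cast; ring
  zify
  rw [e1, e2]
  linarith

lemma sz_tw0 (a b c d e f x y z : ℕ) : sz (tw0 a b c d e f x y z) = a + b + c + d + e + f + x + y + z := by
  unfold tw0; rw [sz_tab]; ring

lemma PT3_bound (a b c d e f x y z m : ℕ) (h : a + b + c + d + e + f + x + y + z ≤ m) :
    PT3 a b c d e f x y z ≤ f3 m := by
  have key : ∀ a b c d e f x y z : ℕ, a + b + c + d + e + f + x + y + z ≤ m →
      0 ≤ ((b : ℤ) - e) * ((c : ℤ) - f) → PT3 a b c d e f x y z ≤ f3 m := by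
    intro a b c d e f x y z h h1
    exact (PT3_le0 a b c d e f x y z h1).trans (t3_weak _ m (by rw [sz_tw0]; exact h))
  by_cases h1 : 0 ≤ ((b : ℤ) - e) * ((c : ℤ) - f)
  · exact key _ _ _ _ _ _ _ _ _ h h1
  by_cases h2 : 0 ≤ ((c : ℤ) - f) * ((a : ℤ) - d)
  · rw [← PT3_cyc]
    exact key _ _ _ _ _ _ _ _ _ (by omega) h2
  by_cases h3 : 0 ≤ ((a : ℤ) - d) * ((b : ℤ) - e)
  · rw [← PT3_cyc, ← PT3_cyc]
    exact key _ _ _ _ _ _ _ _ _ (by omega) h3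
  exfalso
  push Not at h1 h2 h3
  have := mul_pos_of_neg_of_neg h1 h2
  have h4 := mul_neg_of_pos_of_neg this h3
  have : ((b : ℤ) - e) * (c - f) * ((c - f) * (a - d)) * ((a - d) * (b - e)) =
    (((a : ℤ) - d) * (b - e) * (c - f)) ^ 2 := by ring
  rw [this] at h4
  exact absurd (sq_nonneg _) (not_le.2 h4)

/-! quadruple bound for the prism -/

lemma PT4_main (a b c d e f x y z : ℤ) :
    3 * ((a + b + c) * (d + e + f) * PT4 a b c d e f x y z) ≤
    ((x + y + z) * ((a + b + c) * (d + e + f)) + (d + e + f) * B2 a b c + (a + b + c) * B2 d e f) ^ 2 := by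
  have key : ∀ A B C : ℤ, 3 * B2 A B C ≤ (A + B + C) ^ 2 := by
    intro A B C
    unfold B2
    nlinarith [sq_nonneg (A - B), sq_nonneg (B - C), sq_nonneg (A - C)]
  have h := key ((a + b + c) * (d + e + f) * x + (d + e + f) * (b * c) + (a + b + c) * (e * f))
    ((a + b + c) * (d + e + f) * y + (d + e + f) * (a * c) + (a + b + c) * (d * f))
    ((a + b + c) * (d + e + f) * z + (d + e + f) * (a * b) + (a + b + c) * (d * e))
  have e1 : B2 ((a + b + c) * (d + e + f) * x + (d + e + f) * (b * c) + (a + b + c) * (e * f))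
    ((a + b + c) * (d + e + f) * y + (d + e + f) * (a * c) + (a + b + c) * (d * f))
    ((a + b + c) * (d + e + f) * z + (d + e + f) * (a * b) + (a + b + c) * (d * e)) =
     (a + b + c) * (d + e + f) * PT4 a b c d e f x y z := by
    simp only [B2, PT4]; ring
  rw [e1] at h
  refine h.trans (le_of_eq ?_)
  simp only [B2]; ring

lemma f4_formula (q r : ℕ) (hr : r ≤ 8) : f4 (9 * q + r) =
    (match r with
    | 0 => 81 * q ^ 4 | 1 => 36 * q ^ 3 + 81 * q ^ 4 | 2 => 15 * q ^ 2 + 72 * q ^ 3 + 81 * q ^ 4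
    | 3 => 6 * q + 45 * q ^ 2 + 108 * q ^ 3 + 81 * q ^ 4
    | 4 => 1 + 18 * q + 84 * q ^ 2 + 144 * q ^ 3 + 81 * q ^ 4
    | 5 => 5 + 44 * q + 138 * q ^ 2 + 180 * q ^ 3 + 81 * q ^ 4
    | 6 => 12 + 84 * q + 207 * q ^ 2 + 216 * q ^ 3 + 81 * q ^ 4
    | 7 => 24 + 138 * q + 285 * q ^ 2 + 252 * q ^ 3 + 81 * q ^ 4
    | _ => 45 + 216 * q + 378 * q ^ 2 + 288 * q ^ 3 + 81 * q ^ 4) := by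
  unfold f4
  rw [w0_eq q r hr]
  interval_cases r <;> simp [t4, pat, patL, KT4, KB, B2] <;> ring

lemma f4_big (s : ℕ) (hs : 15 ≤ s) : 3 * s ^ 4 < 256 * f4 s := by
  obtain ⟨q, r, hr, rfl⟩ : ∃ q r, r ≤ 8 ∧ s = 9 * q + r := ⟨s / 9, s % 9, by omega, by omega⟩
  rw [f4_formula q r hr]
  by_cases h6 : 6 ≤ r
  · obtain ⟨k, rfl⟩ : ∃ k, q = k + 1 := ⟨q - 1, by omega⟩
    have k2 := Nat.zero_le (k ^ 2)
    have k3 := Nat.zero_le (k ^ 3)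
    have k4 := Nat.zero_le (k ^ 4)
    interval_cases r <;> simp only <;> linarith
  · obtain ⟨k, rfl⟩ : ∃ k, q = k + 2 := ⟨q - 2, by omega⟩
    have k2 := Nat.zero_le (k ^ 2)
    have k3 := Nat.zero_le (k ^ 3)
    have k4 := Nat.zero_le (k ^ 4)
    have h5 : r ≤ 5 := by omega
    interval_cases r <;> simp only <;> linarith

def smallB (U V Z : ℕ) : Bool := decide (15 ≤ U + V + Z) || U == 0 || V == 0 || decide (Z < 3) ||
  decide ((Z * (U * V) + V * (U ^ 2 / 3) + U * (V ^ 2 / 3)) ^ 2 < 3 * (U * V * f4 (U + V + Z)))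

lemma small_dec0 : ∀ U V Z : Fin 15, smallB U V Z = true := by decide +kernel

lemma small_dec (U V Z : ℕ) (hs : U + V + Z < 15) (hU : 0 < U) (hV : 0 < V) (hZ : 3 ≤ Z) :
    (Z * (U * V) + V * (U ^ 2 / 3) + U * (V ^ 2 / 3)) ^ 2 < 3 * (U * V * f4 (U + V + Z)) := by
  have := small_dec0 ⟨U, by omega⟩ ⟨V, by omega⟩ ⟨Z, by omega⟩
  simp only [smallB, Bool.or_eq_true, decide_eq_true_eq, beq_iff_eq] at this
  rcases this with (((h | h) | h) | h) | h
  · omega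
  · omega
  · omega
  · omega
  · exact h

lemma e2_le (a b c : ℕ) : 3 * B2 a b c ≤ (a + b + c) ^ 2 := by
  unfold B2
  have h : (3 : ℤ) * (a * b + a * c + b * c) ≤ (a + b + c) ^ 2 := by
    nlinarith [sq_nonneg ((a : ℤ) - b), sq_nonneg ((b : ℤ) - c), sq_nonneg ((a : ℤ) - c)]
  exact_mod_cast h

lemma PT4_strict (a b c d e f x y z : ℕ) (hU : 0 < a + b + c) (hV : 0 < d + e + f) (hx : 1 ≤ x) (hy : 1 ≤ y) (hz : 1 ≤ z) :
    PT4 a b c d e f x y z < f4 (a + b + c + (d + e + f) + (x + y + z)) := by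
  have h1 : 3 * ((a + b + c) * (d + e + f) * PT4 a b c d e f x y z) ≤
    ((x + y + z) * ((a + b + c) * (d + e + f)) + (d + e + f) * B2 a b c + (a + b + c) * B2 d e f) ^ 2 := by
    have := PT4_main a b c d e f x y z
    simp only [PT4, B2] at this ⊢
    exact_mod_cast this
  have ha := e2_le a b c
  have hd := e2_le d e f
  obtain ⟨U, hU'⟩ : ∃ U, U = a + b + c := ⟨_, rfl⟩
  obtain ⟨V, hV'⟩ : ∃ V, V = d + e + f := ⟨_, rfl⟩
  obtain ⟨Z, hZ'⟩ : ∃ Z, Z = x + y + z := ⟨_, rfl⟩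
  rw [← hU', ← hV', ← hZ'] at h1
  rw [← hU'] at ha hU
  rw [← hV'] at hd hV
  rw [← hU', ← hV', ← hZ']
  have hZ3 : 3 ≤ Z := by omega
  clear hU' hV' hZ' hx hy hz
  generalize PT4 a b c d e f x y z = P at *
  generalize B2 a b c = A at *
  generalize B2 d e f = D at *
  by_contra hcon
  push Not at hcon
  by_cases hs : U + V + Z < 15
  · have h3 := small_dec U V Z hs hU hV hZ3
    have hA : A ≤ U ^ 2 / 3 := by omega
    have hD : D ≤ V ^ 2 / 3 := by omega
    have h4 : (Z * (U * V) + V * A + U * D) ^ 2 ≤ (Z * (U * V) + V * (U ^ 2 / 3) + U * (V ^ 2 / 3)) ^ 2 := by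
      gcongr
    have h5 : 3 * (U * V * f4 (U + V + Z)) ≤ 3 * (U * V * P) := by gcongr
    omega
  · have h3 := f4_big (U + V + Z) (by omega)
    generalize f4 (U + V + Z) = F at *
    have hUV : 0 < U * V := Nat.mul_pos hU hV
    have h4 : 3 * (Z * (U * V) + V * A + U * D) ≤ U * V * (3 * Z + U + V) := by
      have x1 := Nat.mul_le_mul_left V ha
      have x2 := Nat.mul_le_mul_left U hd
      linarith
    have h5 : 9 * (3 * (U * V * P)) ≤ (U * V * (3 * Z + U + V)) ^ 2 := by
      have := Nat.pow_le_pow_left h4 2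
      rw [mul_pow] at this
      omega
    have h6 : 27 * P ≤ U * V * (3 * Z + U + V) ^ 2 := by
      apply Nat.le_of_mul_le_mul_left _ hUV
      linarith
    have h7 : 4 * (U * V) ≤ (U + V) ^ 2 := by
      zify; nlinarith [sq_nonneg ((U : ℤ) - V)]
    have h8 : 8 * ((U + V) * (3 * Z + U + V)) ≤ 9 * (U + V + Z) ^ 2 := by
      zify; nlinarith [sq_nonneg ((U : ℤ) + V - 3 * Z)]
    have h9 := Nat.mul_le_mul_right ((3 * Z + U + V) ^ 2) h7
    have h10 := Nat.pow_le_pow_left h8 2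
    have h11 : (9 * (U + V + Z) ^ 2) ^ 2 = 81 * (U + V + Z) ^ 4 := by ring
    have h12 : (8 * ((U + V) * (3 * Z + U + V))) ^ 2 = 64 * ((U + V) ^ 2 * (3 * Z + U + V) ^ 2) := by ring
    rw [h11, h12] at h10
    have h13 : 4 * (U * V) * (3 * Z + U + V) ^ 2 = 4 * (U * V * (3 * Z + U + V) ^ 2) := by ring
    rw [h13] at h9
    omega

lemma f4_mono {s m : ℕ} (hm : 5 ≤ m) (h : s ≤ m) : f4 s ≤ f4 m :=
  t4_weak (w0 s) m hm (by rw [sz_w0]; exact h)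

lemma PT4_bound (a b c d e f x y z m : ℕ) (hm : 5 ≤ m) (h : a + b + c + d + e + f + x + y + z ≤ m) :
    PT4 a b c d e f x y z ≤ f4 m ∧ (PT4 a b c d e f x y z = f4 m →
      a + b + c + d + e + f + x + y + z = m ∧ (x = 0 ∨ y = 0 ∨ z = 0)) := by
  have key0 : ∀ a b c d e f y z : ℕ, a + b + c + d + e + f + 0 + y + z ≤ m →
      PT4 a b c d e f 0 y z ≤ f4 m ∧ (PT4 a b c d e f 0 y z = f4 m →
      a + b + c + d + e + f + 0 + y + z = m) := by
    intro a b c d e f y z h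
    have e1 : PT4 a b c d e f 0 y z = t4 (tw0 a b c d e f 0 y z) := (tw0_t4 a b c d e f y z).symm
    rw [e1]
    refine ⟨t4_weak _ m hm (by rw [sz_tw0]; exact h), fun heq => ?_⟩
    by_contra hne
    have := t4_strict (tw0 a b c d e f 0 y z) m hm (by rw [sz_tw0]; omega)
    omega
  by_cases hx : x = 0
  · subst hx
    have := key0 a b c d e f y z h
    exact ⟨this.1, fun h => ⟨this.2 h, Or.inl rfl⟩⟩
  by_cases hy : y = 0
  · subst hy
    rw [← PT4_cyc]
    have := key0 b c a e f d z x (by omega)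
    exact ⟨this.1, fun h => ⟨by have := this.2 h; omega, Or.inr (Or.inl rfl)⟩⟩
  by_cases hz : z = 0
  · subst hz
    rw [← PT4_cyc, ← PT4_cyc]
    have := key0 c a b f d e x y (by omega)
    exact ⟨this.1, fun h => ⟨by have := this.2 h; omega, Or.inr (Or.inr rfl)⟩⟩
  have hlt : PT4 a b c d e f x y z < f4 m := by
    by_cases hU : 0 < a + b + c
    · by_cases hV : 0 < d + e + f
      · have := PT4_strict a b c d e f x y z hU hV (by omega) (by omega) (by omega)
        exact this.trans_le (f4_mono hm (by omega))
      · obtain ⟨rfl, rfl, rfl⟩ : d = 0 ∧ e = 0 ∧ f = 0 := by omega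
        have : PT4 a b c 0 0 0 x y z = 0 := by simp [PT4, B2]
        rw [this]; exact f4_pos m hm
    · obtain ⟨rfl, rfl, rfl⟩ : a = 0 ∧ b = 0 ∧ c = 0 := by omega
      have : PT4 0 0 0 d e f x y z = 0 := by simp [PT4, B2]
      rw [this]; exact f4_pos m hm
  exact ⟨hlt.le, fun h => absurd h hlt.ne⟩

lemma IsIso.symm' {G H : Multigraph} (h : IsIso G H) : IsIso H G := by
  obtain ⟨v, e, h⟩ := h
  refine ⟨v.symm, e.symm, fun x => ?_⟩
  rcases h (e.symm x) with ⟨a, b⟩ | ⟨a, b⟩ <;> rw [e.apply_symm_apply] at a b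
  · exact Or.inl ⟨by rw [a]; simp, by rw [b]; simp⟩
  · exact Or.inr ⟨by rw [b]; simp, by rw [a]; simp⟩

lemma IsIso.trans' {G H K : Multigraph} (h : IsIso G H) (h' : IsIso H K) : IsIso G K := by
  obtain ⟨v, e, h⟩ := h
  obtain ⟨v', e', h'⟩ := h'
  refine ⟨v.trans v', e.trans e', fun x => ?_⟩
  simp only [Equiv.trans_apply]
  rcases h x with ⟨a, b⟩ | ⟨a, b⟩ <;> rcases h' (e x) with ⟨a', b'⟩ | ⟨a', b'⟩ <;>
  rw [a', b', a, b] <;> simp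

lemma chainNode_zero (D : Multigraph) (w : D.E → ℕ) (e : D.E) :
    chainNode D w e 0 = Sum.inl (Quot.mk _ (D.src e)) := by
  simp [chainNode]

lemma chainNode_last (D : Multigraph) (w : D.E → ℕ) (e : D.E) :
    chainNode D w e (w e) = Sum.inl (Quot.mk _ (D.tgt e)) := by
  unfold chainNode
  rw [dif_neg (by omega)]
  split_ifs with h
  · rw [Quot.sound ⟨e, h, rfl, rfl⟩]
  · rfl

lemma chainNode_mid (D : Multigraph) (w : D.E → ℕ) (e : D.E) (j : Fin (w e - 1)) :
    chainNode D w e (j.val + 1) = Sum.inr ⟨e, j⟩ := by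
  unfold chainNode
  rw [dif_pos (by have := j.2; omega)]
  rfl

lemma subdivide_perm (D : Multigraph) (w : D.E → ℕ) (v : D.V ≃ D.V) (s : D.E ≃ D.E)
    (h1 : ∀ d, D.src (s d) = v (D.src d)) (h2 : ∀ d, D.tgt (s d) = v (D.tgt d)) :
    IsIso (subdivide D (fun d => w (s d))) (subdivide D w) := by
  let qe : Quot (zeroRel D (fun d => w (s d))) ≃ Quot (zeroRel D w) := Quot.congr v (by
    intro a b
    unfold zeroRel
    constructor
    · rintro ⟨e, h, rfl, rfl⟩
      exact ⟨s e, h, h1 e, h2 e⟩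
    · rintro ⟨e, h, ha, hb⟩
      refine ⟨s.symm e, by simpa using h, v.injective ?_, v.injective ?_⟩
      · rw [← h1]; simpa using ha
      · rw [← h2]; simpa using hb)
  let V : (subdivide D (fun d => w (s d))).V ≃ (subdivide D w).V :=
    Equiv.sumCongr qe (Equiv.sigmaCongrLeft (β := fun f => Fin (w f - 1)) s)
  have key : ∀ d j, V (chainNode D (fun d => w (s d)) d j) = chainNode D w (s d) j := by
    intro d j
    unfold chainNode
    split_ifs with h h' 
    · rfl
    · show Sum.inl (Quot.mk _ (v (D.src d))) = _
      rw [h1]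
    · show Sum.inl (Quot.mk _ (v (D.tgt d))) = _
      rw [h2]
  refine ⟨V, Equiv.sigmaCongrLeft (β := fun f => Fin (w f)) s, fun e => Or.inl ⟨?_, ?_⟩⟩
  · exact (key e.1 e.2.val).symm
  · exact (key e.1 (e.2.val + 1)).symm

lemma sub_card_E (D : Multigraph) (w : D.E → ℕ) : Fintype.card (subdivide D w).E = ∑ d, w d := by
  have : Fintype.card (subdivide D w).E = Fintype.card (Σ f : D.E, Fin (w f)) := by
    apply Fintype.card_congr; rfl
  rw [this]; simp

lemma sub_card_V (D : Multigraph) (w : D.E → ℕ) (hz : ZeroAcyclic D w) :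
    Fintype.card (subdivide D w).V + Fintype.card D.E = Fintype.card D.V + ∑ d, w d := by
  have : Fintype.card (subdivide D w).V = Fintype.card (Quot (zeroRel D w) ⊕ (Σ f : D.E, Fin (w f - 1))) := by
    apply Fintype.card_congr; rfl
  rw [this, ← hz, Fintype.card_sum, Fintype.card_sigma]
  have h2 : ∑ d, (w d - 1) + Fintype.card D.E = ∑ d, w d + (Finset.univ.filter fun e : D.E => w e = 0).card := by
    rw [Finset.card_filter, ← Finset.sum_add_distrib, ← Finset.card_univ, Finset.card_eq_sum_ones,
      ← Finset.sum_add_distrib]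
    apply Finset.sum_congr rfl
    intro d _
    split_ifs with h <;> omega
  simp only [Fintype.card_fin]
  omega

lemma sub_conn (D : Multigraph) (w : D.E → ℕ) 
    (hc : ∀ f : D.V → ZMod 2, (∀ e, f (D.src e) = f (D.tgt e)) → ∀ x y, f x = f y)
    (f : (subdivide D w).V → ZMod 2)
    (hf : ∀ e, f ((subdivide D w).src e) = f ((subdivide D w).tgt e)) : ∀ x y, f x = f y := by
  have step : ∀ d j, j ≤ w d → f (chainNode D w d j) = f (Sum.inl (Quot.mk _ (D.src d))) := by
    intro d j
    induction j with
    | zero => intro _; rw [chainNode_zero]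
    | succ j ih =>
      intro h
      rw [← ih (by omega)]
      exact (hf ⟨d, ⟨j, h⟩⟩).symm
  have h1 := hc (fun v => f (Sum.inl (Quot.mk _ v))) (fun d => by
    have := step d (w d) le_rfl
    rw [chainNode_last] at this
    exact this.symm)
  have h2 : ∀ x : (subdivide D w).V, ∃ v, f x = f (Sum.inl (Quot.mk _ v)) := by
    rintro (q | ⟨d, j⟩)
    · obtain ⟨v, rfl⟩ := Quot.exists_rep q
      exact ⟨v, rfl⟩
    · refine ⟨D.src d, ?_⟩
      rw [← step d (j.val + 1) (by have := j.2; omega), chainNode_mid]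
  intro x y
  obtain ⟨a, ha⟩ := h2 x
  obtain ⟨b, hb⟩ := h2 y
  rw [ha, hb]; exact h1 a b

lemma tele (g : ℕ → ZMod 2) (n : ℕ) : ∑ j : Fin n, (g j.val + g (j.val + 1)) = g 0 + g n := by
  rw [Fin.sum_univ_eq_sum_range (fun j => g j + g (j + 1))]
  induction n with
  | zero => simp [CharTwo.add_self_eq_zero]
  | succ n ih => 
    rw [Finset.sum_range_succ, ih]
    have : g n + g n = 0 := CharTwo.add_self_eq_zero _
    linear_combination this

lemma sub_good (D : Multigraph) (w : D.E → ℕ) {ψ : D.E → Q4} (h : Good D ψ) (hz : ZeroAcyclic D w)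
    (hsp : ∀ g : Q4 →ₗ[ZMod 2] ZMod 2, (∀ d, 0 < w d → g (ψ d) = 0) → ∀ d, g (ψ d) = 0) :
    Good (subdivide D w) (fun e => ψ e.1) where
  ne := by
    obtain ⟨v⟩ := h.ne
    exact ⟨Sum.inl (Quot.mk _ v)⟩
  conn := sub_conn D w h.conn
  card := by
    have h1 := sub_card_E D w
    have h2 := sub_card_V D w hz
    have h3 := h.card
    omega
  cob := by
    intro f
    have : ∑ e : (subdivide D w).E, (f ((subdivide D w).src e) + f ((subdivide D w).tgt e)) • ψ e.1 =
      ∑ e : (Σ d : D.E, Fin (w d)), (f (chainNode D w e.1 e.2.val) + f (chainNode D w e.1 (e.2.val+1))) • ψ e.1 :=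
      Fintype.sum_equiv (Equiv.refl _) _ _ (fun _ => rfl)
    rw [this, Fintype.sum_sigma, ← h.cob (fun v => f (Sum.inl (Quot.mk _ v)))]
    apply Finset.sum_congr rfl
    intro d _
    simp only
    rw [← Finset.sum_smul, tele (fun j => f (chainNode D w d j)), chainNode_zero, chainNode_last]
  span := by
    by_contra hne
    obtain ⟨g, hg, hle⟩ := Submodule.exists_le_ker_of_lt_top _ (lt_top_iff_ne_top.2 hne)
    apply hg
    have h1 := hsp g (fun d hd => by
      have : ψ d ∈ Submodule.span (ZMod 2) (Set.range (fun e : (subdivide D w).E => ψ e.1)) :=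
        Submodule.subset_span ⟨⟨d, ⟨0, hd⟩⟩, rfl⟩
      exact hle this)
    have h2 : (⊤ : Submodule (ZMod 2) Q4) ≤ LinearMap.ker g := by
      rw [← h.span, Submodule.span_le]
      rintro _ ⟨d, rfl⟩
      exact h1 d
    ext1 
    rw [LinearMap.ker_eq_top.1 (top_le_iff.1 h2)]

lemma sub_lab (D : Multigraph) (w : D.E → ℕ) {ψ : D.E → Q4} (h : Good D ψ) :
    Lab D (subdivide D w) (fun e => ψ e.1) w := by
  refine ⟨ψ, fun e => some e.1, h, fun e => rfl, fun d => ?_⟩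
  unfold cls
  have : Fintype.card (Fin (w d)) = Fintype.card {e : (subdivide D w).E // some e.1 = some d} := by
    apply Fintype.card_congr
    refine ⟨fun j => ⟨⟨d, j⟩, rfl⟩, fun e => ⟨e.1.2.val, ?_⟩, ?_, ?_⟩
    · have h1 := e.1.2.2
      have h2 := Option.some.inj e.2
      exact lt_of_lt_of_eq h1 (congrArg w h2)
    · intro j; rfl
    · rintro ⟨⟨d', j⟩, h⟩
      obtain rfl := Option.some.inj h
      rfl
  rw [Fintype.card_fin, Fintype.card_subtype] at this
  rw [this]

def W0 (m : ℕ) : K33.E → ℕ := fun p => w0 m p.1 p.2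

lemma w0_pos {m : ℕ} (hm : 9 ≤ m) (i j : Fin 3) : 0 < w0 m i j := by
  unfold w0
  have := Nat.div_pos hm (by norm_num)
  omega

lemma sum9 (w : Fin 3 × Fin 3 → ℕ) : ∑ p, w p = sz (fun i j => w (i, j)) := by
  rw [Fintype.sum_prod_type]
  simp only [Fin.sum_univ_three, sz]
  ring

lemma sum_K33 (w : K33.E → ℕ) : ∑ e : K33.E, w e = sz (fun i j => w (i, j)) :=
  (Fintype.sum_equiv (Equiv.refl _) _ _ (fun _ => rfl)).trans (sum9 w)

lemma sum_W0 (m : ℕ) : ∑ e : K33.E, W0 m e = m := by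
  rw [sum_K33]; exact sz_w0 m

lemma card_K33E : Fintype.card K33.E = 9 := by
  have : Fintype.card K33.E = Fintype.card (Fin 3 × Fin 3) := by apply Fintype.card_congr; rfl
  rw [this]; rfl
lemma card_K33V : Fintype.card K33.V = 6 := by
  have : Fintype.card K33.V = Fintype.card (Fin 3 ⊕ Fin 3) := by apply Fintype.card_congr; rfl
  rw [this]; rfl

def parT (a b c d e f : Fin 3 ⊕ Fin 3) : Fin 3 ⊕ Fin 3 → Fin 3 ⊕ Fin 3 :=
  Sum.elim ![a, b, c] ![d, e, f]

def par : ℕ → Fin 3 ⊕ Fin 3 → Fin 3 ⊕ Fin 3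
  | 8 => parT (.inl 0) (.inl 1) (.inl 2) (.inl 0) (.inr 1) (.inr 2)
  | 7 => parT (.inl 0) (.inl 1) (.inl 2) (.inl 0) (.inl 1) (.inr 2)
  | 6 => parT (.inl 0) (.inl 1) (.inl 2) (.inl 0) (.inl 1) (.inl 2)
  | 5 => parT (.inl 0) (.inr 2) (.inr 2) (.inl 0) (.inl 0) (.inr 2)
  | 4 => parT (.inl 0) (.inr 2) (.inr 1) (.inl 2) (.inl 0) (.inl 0)
  | _ => id

def root (m : ℕ) (v : Fin 3 ⊕ Fin 3) : Fin 3 ⊕ Fin 3 := par m (par m (par m v))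

def adjZ (m : ℕ) (u v : Fin 3 ⊕ Fin 3) : Bool :=
  match u, v with
  | .inl i, .inr j => w0 m i j == 0
  | .inr j, .inl i => w0 m i j == 0
  | _, _ => false

lemma par_ok (m : Fin 5) (v : Fin 3 ⊕ Fin 3) : par (m + 4) v = v ∨ adjZ (m + 4) v (par (m + 4) v) = true := by
  revert m v; decide +kernel
lemma root_idem (m : Fin 5) (v : Fin 3 ⊕ Fin 3) : root (m + 4) (root (m + 4) v) = root (m + 4) v := by
  revert m v; decide +kernel
lemma root_z (m : Fin 5) (i j : Fin 3) (h : w0 (m + 4) i j = 0) : root (m + 4) (.inl i) = root (m + 4) (.inr j) := by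
  revert m i j; decide +kernel
lemma root_card (m : Fin 5) : Fintype.card {v : Fin 3 ⊕ Fin 3 // root (m + 4) v = v} +
    (univ.filter fun p : Fin 3 × Fin 3 => w0 (m + 4) p.1 p.2 = 0).card = 6 := by
  have : ∀ m : Fin 5, (univ.filter fun v : Fin 3 ⊕ Fin 3 => root (m + 4) v = v).card +
    (univ.filter fun p : Fin 3 × Fin 3 => w0 (m + 4) p.1 p.2 = 0).card = 6 := by decide +kernel
  rw [Fintype.card_subtype]
  convert this m

def evenB (m : ℕ) (a b c d e f g h i : Bool) : Bool :=
  !((List.finRange 9).all (fun k => w0 m (kEn k).1 (kEn k).2 == 0 || !(![a,b,c,d,e,f,g,h,i] k)) &&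
    !(xor a (xor b c)) && !(xor d (xor e f)) && !(xor g (xor h i)) &&
    !(xor a (xor d g)) && !(xor b (xor e h)) && !(xor c (xor f i))) ||
    !(a || b || c || d || e || f || g || h || i)

lemma evenB_true : ∀ m : Fin 5, ∀ a b c d e f g h i : Bool, evenB (m + 4) a b c d e f g h i = true := by
  decide +kernel

lemma even0 (m : Fin 5) (c : Fin 9 → Bool) 
    (h0 : ∀ k : Fin 9, 0 < w0 (m + 4) (kEn k).1 (kEn k).2 → c k = false)
    (r0 : xor (c 0) (xor (c 1) (c 2)) = false) (r1 : xor (c 3) (xor (c 4) (c 5)) = false)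
    (r2 : xor (c 6) (xor (c 7) (c 8)) = false) (s0 : xor (c 0) (xor (c 3) (c 6)) = false)
    (s1 : xor (c 1) (xor (c 4) (c 7)) = false) (s2 : xor (c 2) (xor (c 5) (c 8)) = false) : ∀ k, c k = false := by
  have hc : c = ![c 0, c 1, c 2, c 3, c 4, c 5, c 6, c 7, c 8] := by
    ext k; fin_cases k <;> rfl
  have := evenB_true m (c 0) (c 1) (c 2) (c 3) (c 4) (c 5) (c 6) (c 7) (c 8)
  unfold evenB at this
  rw [← hc, r0, r1, r2, s0, s1, s2] at this
  have h1 : ((List.finRange 9).all (fun k => w0 (m + 4) (kEn k).1 (kEn k).2 == 0 || !(c k))) = true := by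
    rw [List.all_eq_true]
    intro k _
    by_cases hk : w0 (m + 4) (kEn k).1 (kEn k).2 = 0
    · simp [hk]
    · simp [h0 k (by omega)]
  rw [h1] at this
  simp only [Bool.not_false, Bool.and_true, Bool.not_true, Bool.false_or, Bool.not_eq_true', Bool.or_eq_false_iff] at this
  obtain ⟨⟨⟨⟨⟨⟨⟨⟨a, b⟩, d⟩, e⟩, f⟩, g⟩, h⟩, i⟩, j⟩ := this
  intro k; fin_cases k <;> assumption

lemma zeroAcyclic_W0 (m : ℕ) (hm : 4 ≤ m) : ZeroAcyclic K33 (W0 m) := by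
  unfold ZeroAcyclic
  rw [card_K33V]
  by_cases h9 : 9 ≤ m
  · have e : Quot (zeroRel K33 (W0 m)) ≃ (Fin 3 ⊕ Fin 3) :=
      ⟨Quot.lift id (by rintro a b ⟨e, h, _⟩; exact absurd h (w0_pos h9 _ _).ne'), Quot.mk _,
        by rintro ⟨x⟩; rfl, fun x => rfl⟩
    rw [Fintype.card_congr e, Finset.filter_false_of_mem]
    · rfl
    · intro x _; exact (w0_pos h9 _ _).ne'
  · obtain ⟨k, rfl⟩ : ∃ k : Fin 5, m = k + 4 := ⟨⟨m - 4, by omega⟩, by simp; omega⟩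
    have hp : ∀ v : K33.V, Quot.mk (zeroRel K33 (W0 (k + 4))) (par (k + 4) v) = Quot.mk _ v := by
      intro v
      rcases par_ok k v with h | h
      · exact congrArg _ h
      · rcases v with i | j
        · generalize hq : par (k + 4) (Sum.inl i) = q at h ⊢
          rcases q with i' | j
          · exact absurd h (by simp [adjZ])
          · exact (Quot.sound ⟨(i, j), by simpa [adjZ, W0] using h, rfl, rfl⟩).symm
        · generalize hq : par (k + 4) (Sum.inr j) = q at h ⊢
          rcases q with i | j'
          · exact (Quot.sound ⟨(i, j), by simpa [adjZ, W0] using h, rfl, rfl⟩)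
          · exact absurd h (by simp [adjZ])
    have e : Quot (zeroRel K33 (W0 (k + 4))) ≃ {v : Fin 3 ⊕ Fin 3 // root (k + 4) v = v} :=
      ⟨Quot.lift (fun v => ⟨root (k + 4) v, root_idem k v⟩) (by
          rintro _ _ ⟨e, h, rfl, rfl⟩
          exact Subtype.ext (root_z k e.1 e.2 h)),
        fun v => Quot.mk _ v.1,
        by
          rintro ⟨v⟩
          exact (hp _).trans ((hp _).trans (hp v)),
        fun v => Subtype.ext v.2⟩
    rw [Fintype.card_congr e, ← root_card k]
    rfl

lemma span_W0 (m : ℕ) (hm : 4 ≤ m) {ψ : K33.E → Q4} (h : Good K33 ψ) 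
    (g : Q4 →ₗ[ZMod 2] ZMod 2) (hg : ∀ d, 0 < W0 m d → g (ψ d) = 0) : ∀ d, g (ψ d) = 0 := by
  by_cases h9 : 9 ≤ m
  · exact fun d => hg d (w0_pos h9 _ _)
  · obtain ⟨k, rfl⟩ : ∃ k : Fin 5, m = k + 4 := ⟨⟨m - 4, by omega⟩, by simp; omega⟩
    have hz : ∀ a : ZMod 2, (a.val == 1) = false ↔ a = 0 := by
      have h1 : ∀ a : ZMod 2, (a.val == 1) = false → a = 0 := by decide
      intro a
      exact ⟨h1 a, fun h => by rw [h]; rfl⟩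
    have hx : ∀ a b c : ZMod 2, a + b + c = 0 → xor (a.val == 1) (xor (b.val == 1) (c.val == 1)) = false := by
      decide
    have hcob : ∀ f : K33.V → ZMod 2, ∑ e : Fin 3 × Fin 3, (f (.inl e.1) + f (.inr e.2)) * g (ψ e) = 0 := by
      intro f
      have := congrArg g (h.cob f)
      rw [map_sum, map_zero] at this
      rw [← this]
      refine Fintype.sum_equiv (Equiv.refl _) _ _ (fun e => ?_)
      rw [map_smul]; rfl
    have hr : ∀ i : Fin 3, g (ψ (i, 0)) + g (ψ (i, 1)) + g (ψ (i, 2)) = 0 := by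
      intro i
      have := hcob (Sum.elim (fun j => if j = i then 1 else 0) 0)
      rw [Fintype.sum_prod_type] at this
      simpa [Fin.sum_univ_three, ite_mul, Finset.sum_ite_eq] using this
    have hs : ∀ i : Fin 3, g (ψ (0, i)) + g (ψ (1, i)) + g (ψ (2, i)) = 0 := by
      intro i
      have := hcob (Sum.elim 0 (fun j => if j = i then 1 else 0))
      rw [Fintype.sum_prod_type] at this
      simpa [Fin.sum_univ_three, ite_mul, Finset.sum_ite_eq] using this
    have := even0 k (fun i => (g (ψ (kEn i))).val == 1) (fun i hi => (hz _).2 (hg _ hi))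
      (hx _ _ _ (hr 0)) (hx _ _ _ (hr 1)) (hx _ _ _ (hr 2))
      (hx _ _ _ (hs 0)) (hx _ _ _ (hs 1)) (hx _ _ _ (hs 2))
    intro d
    obtain ⟨i, rfl⟩ := kEn_bij.2 d
    exact (hz _).1 (this i)

lemma K33_good : ∃ ψ, Good K33 ψ := by
  apply exists_good
  · exact ⟨Sum.inl 0⟩
  · refine (connOn_iff K33 _).2 fun f hf => ?_
    have h1 : ∀ i j : Fin 3, f (Sum.inl i) = f (Sum.inr j) := fun i j => hf (i, j) (mem_univ _)
    rintro (i | i) (j | j)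
    · rw [h1 i 0, h1 j 0]
    · exact h1 i j
    · exact (h1 j i).symm
    · rw [← h1 0 i, ← h1 0 j]
  · rw [card_K33E, card_K33V]

def GG (m : ℕ) : Multigraph := subdivide K33 (W0 m)

lemma GG_good (m : ℕ) (hm : 4 ≤ m) : ∃ φ, Good (GG m) φ ∧ Lab K33 (GG m) φ (W0 m) := by
  obtain ⟨ψ, h⟩ := K33_good
  exact ⟨_, sub_good K33 (W0 m) h (zeroAcyclic_W0 m hm) (span_W0 m hm h), sub_lab K33 _ h⟩

lemma GG_card (m : ℕ) : Fintype.card (GG m).E = m := by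
  rw [GG, sub_card_E, sum_W0]

lemma GG_mem (n m : ℕ) (hn : 1 ≤ n) (hm : m = n + 3) : memG (GG m) n m := by
  obtain ⟨φ, hg, _⟩ := GG_good m (by omega)
  have h := hg.card
  have h1 := GG_card m
  refine ⟨?_, GG_card m, ?_⟩
  · unfold Multigraph.nV; omega
  · exact (connOn_iff _ _).2 fun f hf => hg.conn f (fun e => hf e (mem_univ _))

lemma GG_N (m : ℕ) (hm : 4 ≤ m) : Nk (GG m) 4 = f4 m ∧ Nk (GG m) 3 = f3 m ∧ Nk (GG m) 2 = f2 m ∧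
    Nk (GG m) 1 = m ∧ Nk (GG m) 0 = 1 := by
  obtain ⟨φ, hg, hl⟩ := GG_good m hm
  simp only [Nk_K hg hl, kSum4, kSum3, kSum2, kSum1, kSum0]
  refine ⟨rfl, rfl, rfl, ?_, trivial⟩
  exact sz_w0 m

abbrev Bfg := Fin 3 → Fin 3 → Bool

def bK (b : Bfg) (p : K33.E) : Bool := b p.1 p.2

def SB (b : Bfg) : Finset K33.E := univ.filter fun p => bK b p = true

def dg (b : Bfg) : Fin 3 ⊕ Fin 3 → ℕ :=
  Sum.elim (fun i => (b i 0).toNat + (b i 1).toNat + (b i 2).toNat)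
    (fun i => (b 0 i).toNat + (b 1 i).toNat + (b 2 i).toNat)

def nb (b : Bfg) : Cfg := fun i j => (b i j).toNat

lemma ite_toNat (b : Bool) [Decidable (b = true)] : (if b = true then 1 else 0) = b.toNat := by cases b <;> simp

lemma ite_bq (b : Bool) (q : Prop) [Decidable (b = true ∧ q)] :
    (if b = true ∧ q then 1 else 0 : ℕ) = if q then b.toNat else 0 := by
  by_cases hq : q <;> cases b <;> simp [hq]

lemma card_SB' (P : K33.E → Prop) [DecidablePred P] : (univ.filter P).card =
    sz (fun i j => if P (i, j) then 1 else 0) := by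
  rw [Finset.card_filter, sum_K33]
  refine congrArg sz ?_
  ext i j
  congr

lemma card_SB (b : Bfg) : (SB b).card = sz (nb b) := by
  unfold SB
  rw [card_SB']
  unfold nb
  congr 1
  ext i j
  rw [show b i j = bK b (i, j) from rfl]
  cases bK b (i, j) <;> simp

lemma degIn_SB (b : Bfg) (v : K33.V) : degIn K33 (SB b) v = dg b v := by
  unfold degIn SB
  rw [Finset.filter_filter, Finset.filter_filter, card_SB', card_SB']
  rcases v with i | i
  · have h1 : ∀ i' j : Fin 3, (K33.src (i', j) = Sum.inl i) ↔ i' = i := fun i' j =>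
      ⟨fun h => Sum.inl.inj h, fun h => congrArg _ h⟩
    have h2 : ∀ i' j : Fin 3, ¬ (K33.tgt (i', j) = Sum.inl i) := fun i' j h => by cases h
    simp only [h1, h2, and_false, if_false]
    simp only [ite_bq, sz, dg, Sum.elim_inl]
    fin_cases i <;> simp [bK]
  · have h1 : ∀ i' j : Fin 3, (K33.tgt (i', j) = Sum.inr i) ↔ j = i := fun i' j =>
      ⟨fun h => Sum.inr.inj h, fun h => congrArg _ h⟩
    have h2 : ∀ i' j : Fin 3, ¬ (K33.src (i', j) = Sum.inr i) := fun i' j h => by cases h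
    simp only [h1, h2, and_false, if_false]
    simp only [ite_bq, sz, dg, Sum.elim_inr]
    fin_cases i <;> simp [bK]

def V6 : List (Fin 3 ⊕ Fin 3) := [.inl 0, .inl 1, .inl 2, .inr 0, .inr 1, .inr 2]
lemma mem_V6 : ∀ v, v ∈ V6 := by rintro (i | i) <;> fin_cases i <;> simp [V6]
def I3 : List (Fin 3) := [0, 1, 2]
lemma mem_I3 : ∀ v, v ∈ I3 := by intro i; fin_cases i <;> simp [I3]

def mB (b : Bfg) : Bool := V6.all fun v => dg b v ≤ 1
def c1 (b : Bfg) : ℕ := (V6.map fun v => if dg b v == 1 then 1 else 0).sum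
def pB (b : Bfg) : Bool := sz (nb b) == 4 && V6.all (fun v => dg b v ≤ 2) && c1 b == 4 &&
  I3.any fun i => I3.any fun j => b i j && dg b (.inl i) == 2 && dg b (.inr j) == 2
def tB (b : Bfg) : Bool := sz (nb b) == 4 && V6.all (fun v => dg b v ≤ 2) && c1 b == 4 &&
  I3.all fun i => I3.all fun j => !(b i j) || dg b (.inl i) == 1 || dg b (.inr j) == 1

lemma m_iff (b : Bfg) : IsMatchingIn K33 (SB b) ↔ mB b = true := by
  unfold IsMatchingIn mB
  simp only [degIn_SB, List.all_eq_true, decide_eq_true_eq]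
  exact ⟨fun h v _ => h v, fun h v => h v (mem_V6 v)⟩

lemma c1_eq (b : Bfg) : (Finset.univ.filter fun v : K33.V => degIn K33 (SB b) v = 1).card = c1 b := by
  simp only [degIn_SB]
  rw [Finset.card_filter]
  have : ∀ f : Fin 3 ⊕ Fin 3 → ℕ, ∑ v : K33.V, f v = f (.inl 0) + f (.inl 1) + f (.inl 2) + f (.inr 0) + f (.inr 1) + f (.inr 2) := by
    intro f
    have h : ∑ v : K33.V, f v = ∑ v : Fin 3 ⊕ Fin 3, f v := Fintype.sum_equiv (Equiv.refl _) _ _ (fun _ => rfl)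
    refine h.trans ?_
    rw [Fintype.sum_sum_type]
    simp only [Fin.sum_univ_three]
    ring
  refine Eq.trans ?_ ((this (fun v => if dg b v = 1 then 1 else 0)).trans ?_)
  · exact Finset.sum_congr rfl (fun v _ => by congr)
  simp [c1, V6]
  ring

lemma p_iff (b : Bfg) : IsPath3PlusEdgeIn K33 (SB b) ↔ pB b = true := by
  unfold IsPath3PlusEdgeIn pB
  rw [c1_eq, card_SB]
  simp only [degIn_SB, List.all_eq_true, decide_eq_true_eq, Bool.and_eq_true, beq_iff_eq, List.any_eq_true, and_assoc]
  refine and_congr Iff.rfl (and_congr ⟨fun h v _ => h v, fun h v => h v (mem_V6 v)⟩ (and_congr Iff.rfl ?_))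
  constructor
  · rintro ⟨e, h, h1, h2⟩
    exact ⟨e.1, mem_I3 _, e.2, mem_I3 _, (mem_filter.1 h).2, h1, h2⟩
  · rintro ⟨i, _, j, _, h, h1, h2⟩
    exact ⟨(i, j), mem_filter.2 ⟨mem_univ _, h⟩, h1, h2⟩

lemma t_iff (b : Bfg) : IsTwoPlusTwoIn K33 (SB b) ↔ tB b = true := by
  unfold IsTwoPlusTwoIn tB
  rw [c1_eq, card_SB]
  simp only [degIn_SB, List.all_eq_true, decide_eq_true_eq, Bool.and_eq_true, Bool.or_eq_true, Bool.not_eq_true', beq_iff_eq, and_assoc]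
  refine and_congr Iff.rfl (and_congr ⟨fun h v _ => h v, fun h v => h v (mem_V6 v)⟩ (and_congr Iff.rfl ?_))
  constructor
  · intro h i _ j _
    cases hb : b i j
    · exact Or.inl (Or.inl rfl)
    · rcases h (i, j) (mem_filter.2 ⟨mem_univ _, hb⟩) with h | h
      · exact Or.inl (Or.inr h)
      · exact Or.inr h
  · intro h e he
    have hb : b e.1 e.2 = true := (mem_filter.1 he).2
    rcases h e.1 (mem_I3 _) e.2 (mem_I3 _) with (h | h) | h
    · rw [hb] at h; cases h
    · exact Or.inl h
    · exact Or.inr h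

def ngB (b : Bfg) : Bfg := fun i j => !(b i j)

def cB (r : ℕ) (b : Bfg) : Bool :=
  match r with
  | 2 => mB b | 3 => mB b | 4 => pB b | 5 => tB (ngB b) | 6 => mB (ngB b) | 7 => mB (ngB b) | _ => true

lemma max_eq (w : K33.E → ℕ) (q : ℕ) (b : Bfg) (hw : ∀ e, w e = q + (bK b e).toNat)
    (h : 0 < sz (nb b)) : maxChains K33 w = SB b := by
  have hex : ∃ i j, b i j = true := by
    by_contra hne
    push Not at hne
    simp [sz, nb, hne] at h
  obtain ⟨i, j, hij⟩ := hex
  ext e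
  unfold maxChains SB
  rw [mem_filter, mem_filter]
  simp only [mem_univ, true_and, hw]
  constructor
  · intro h
    have := h (i, j)
    rw [show bK b (i, j) = _ from hij] at this
    cases hb : bK b e
    · rw [hb] at this; simp at this
    · rfl
  · intro h f
    rw [h]
    have := Bool.toNat_le (bK b f)
    simp; omega

lemma min_eq (w : K33.E → ℕ) (q : ℕ) (b : Bfg) (hw : ∀ e, w e = q + (bK b e).toNat)
    (h : sz (nb b) < 9) : minChains K33 w = SB (ngB b) := by
  have hex : ∃ i j, b i j = false := by
    by_contra hne
    push Not at hne
    simp [sz, nb, hne] at h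
  obtain ⟨i, j, hij⟩ := hex
  ext e
  unfold minChains SB
  rw [mem_filter, mem_filter]
  have hn : bK (ngB b) e = !(bK b e) := rfl
  simp only [mem_univ, true_and, hw, hn, Bool.not_eq_true']
  constructor
  · intro h
    have := h (i, j)
    rw [show bK b (i, j) = _ from hij] at this
    cases hb : bK b e
    · rfl
    · rw [hb] at this; simp at this
  · intro h f
    rw [h]
    simp

lemma cond_iff (w : K33.E → ℕ) (q m : ℕ) (b : Bfg) (hw : ∀ e, w e = q + (bK b e).toNat)
    (h : sz (nb b) = m % 9) : k33Cond m w ↔ cB (m % 9) b = true := by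
  have h9 : m % 9 < 9 := Nat.mod_lt _ (by norm_num)
  have e1 := min_eq w q b hw (by omega)
  by_cases h0 : 0 < m % 9
  · have e2 := max_eq w q b hw (by omega)
    unfold k33Cond
    rw [e1, e2, m_iff, m_iff, p_iff, t_iff]
    clear e1 e2 hw
    generalize m % 9 = r at *
    interval_cases r <;> simp [cB]
  · have : m % 9 = 0 := by omega
    unfold k33Cond
    rw [this]
    simp [cB]

def cntB (r : ℕ) (b : Bfg) : Bool := sz (nb b) == r && cB r b

lemma cB_all : ∀ r : Fin 9, ∀ a b c d e f g h i : Bool,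
    (!(cntB r ![![a, b, c], ![d, e, f], ![g, h, i]]) || pmB (nb ![![a, b, c], ![d, e, f], ![g, h, i]]) (pat r)) = true := by
  decide +kernel

def pb (r : ℕ) : Bfg := fun i j => (patL r).contains (3 * i.val + j.val)

lemma cB_pat : ∀ r : Fin 9, cntB r (pb r) = true := by decide +kernel

lemma bfg_eq (b : Bfg) : b = ![![b 0 0, b 0 1, b 0 2], ![b 1 0, b 1 1, b 1 2], ![b 2 0, b 2 1, b 2 2]] := by
  ext i j; fin_cases i <;> fin_cases j <;> rfl

lemma pat_pb (r : ℕ) (i j : Fin 3) : pat r i j = (pb r i j).toNat := by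
  unfold pat pb
  exact ite_toNat _

lemma cond_W0 (m : ℕ) : k33Cond m (W0 m) := by
  have h := cB_pat ⟨m % 9, Nat.mod_lt _ (by norm_num)⟩
  simp only [cntB, Bool.and_eq_true, beq_iff_eq] at h
  refine (cond_iff (W0 m) (m / 9) m (pb (m % 9)) (fun e => ?_) h.1).2 h.2
  exact congrArg (m / 9 + ·) (pat_pb _ _ _)

lemma bal_W0 (m : ℕ) : BalancedWeights (W0 m) := by
  intro e f
  have h1 : W0 m e = m / 9 + (pb (m % 9) e.1 e.2).toNat := by rw [← pat_pb]; rfl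
  have h2 : W0 m f = m / 9 + (pb (m % 9) f.1 f.2).toNat := by rw [← pat_pb]; rfl
  have := Bool.toNat_le (pb (m % 9) e.1 e.2)
  omega

lemma sz_add (q : ℕ) (E : Cfg) : sz (fun i j => q + E i j) = 9 * q + sz E := by
  unfold sz; ring

lemma pm_of_cond (m : ℕ) (w : K33.E → ℕ) (hb : BalancedWeights w) (hs : ∑ e, w e = m)
    (hc : k33Cond m w) : PM (fun i j => w (i, j)) (w0 m) := by
  obtain ⟨e0, _, he0⟩ := Finset.exists_min_image (univ : Finset K33.E) w ⟨(0, 0), mem_univ _⟩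
  have hw : ∀ e : K33.E, w e = w e0 + (decide (w e ≠ w e0)).toNat := by
    intro e
    have h1 := he0 e (mem_univ _)
    have h2 := hb e e0
    by_cases h : w e = w e0
    · simp [h]
    · simp [h]; omega
  generalize hq : w e0 = q at hw
  set b : Bfg := fun i j => decide (w (i, j) ≠ q) with hbdef
  have hw' : ∀ e : K33.E, w e = q + (bK b e).toNat := hw
  have hX : (fun i j => w (i, j)) = fun i j => q + nb b i j := by
    ext i j; exact hw' (i, j)
  have hlt : sz (nb b) < 9 := by
    have hz : nb b e0.1 e0.2 = 0 := by
      have := hw' e0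
      show (bK b e0).toNat = 0
      omega
    have hl : ∀ i j, nb b i j ≤ 1 := fun i j => Bool.toNat_le _
    have a0 := hl 0 0; have a1 := hl 0 1; have a2 := hl 0 2
    have a3 := hl 1 0; have a4 := hl 1 1; have a5 := hl 1 2
    have a6 := hl 2 0; have a7 := hl 2 1; have a8 := hl 2 2
    obtain ⟨i, j⟩ := e0
    unfold sz
    clear * - hz a0 a1 a2 a3 a4 a5 a6 a7 a8
    have hz' : nb b i j = 0 := hz
    clear hz
    have hi : (i = 0 ∨ i = 1 ∨ i = 2) ∧ (j = 0 ∨ j = 1 ∨ j = 2) := by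
      constructor
      · clear hz'; revert i; decide
      · clear hz'; revert j; decide
    obtain ⟨h1 | h1 | h1, h2 | h2 | h2⟩ := hi <;> rw [h1, h2] at hz' <;> clear h1 h2 <;> omega
  rw [sum_K33, hX, sz_add] at hs
  have hr : sz (nb b) = m % 9 := by omega
  have hq9 : m / 9 = q := by omega
  have hcb := (cond_iff w q m b hw' hr).1 hc
  have h9 : m % 9 < 9 := Nat.mod_lt _ (by norm_num)
  have := cB_all ⟨m % 9, h9⟩ (b 0 0) (b 0 1) (b 0 2) (b 1 0) (b 1 1) (b 1 2) (b 2 0) (b 2 1) (b 2 2)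
  rw [← bfg_eq b] at this
  have hcn : cntB (m % 9) b = true := by simp [cntB, hr, hcb]
  simp only [hcn, Bool.not_true, Bool.false_or] at this
  obtain ⟨σ, τ, h⟩ := pm_of_pmB this
  rw [hX]
  refine ⟨σ, τ, fun i j => ?_⟩
  simp only [h i j, w0, hq9]

def k33v (σ τ : Equiv.Perm (Fin 3)) : K33.V ≃ K33.V := Equiv.sumCongr σ τ
def k33e (σ τ : Equiv.Perm (Fin 3)) : K33.E ≃ K33.E := Equiv.prodCongr σ τ

lemma iso_of_PM (w : K33.E → ℕ) (m : ℕ) (h : PM (fun i j => w (i, j)) (w0 m)) :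
    IsIso (GG m) (subdivide K33 w) := by
  obtain ⟨σ, τ, h⟩ := h
  have := subdivide_perm K33 w (k33v σ τ) (k33e σ τ) (fun d => rfl) (fun d => rfl)
  have he : (fun d => w (k33e σ τ d)) = W0 m := by
    ext d; exact h d.1 d.2
  rw [he] at this
  exact this

lemma chn_nodes {H : Multigraph} (l : List H.E) (x y : H.V) (h : chn H x l y) :
    ∃ g : ℕ → H.V, g 0 = x ∧ g l.length = y ∧ ∀ j (hj : j < l.length), joins H l[j] (g j) (g (j + 1)) := by
  induction l generalizing x with
  | nil => exact ⟨fun _ => x, rfl, h, fun j hj => absurd hj (by simp)⟩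
  | cons e l ih =>
    obtain ⟨z, hz, h⟩ := h
    obtain ⟨g, h0, h1, h2⟩ := ih z h
    refine ⟨fun j => match j with | 0 => x | j + 1 => g j, rfl, h1, ?_⟩
    intro j hj
    cases j with
    | zero => simpa [h0] using hz
    | succ j => exact h2 j (by simpa using hj)

lemma iso_of_pres {D H : Multigraph} {κ : D.V → H.V} {L : D.E → List H.E} (hp : Pres D H κ L)
    (hne : Nonempty D.V)
    (hc : ∀ f : H.V → ZMod 2, (∀ e, f (H.src e) = f (H.tgt e)) → ∀ x y, f x = f y)
    (w : D.E → ℕ) (hw : ∀ d, (L d).length = w d)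
    (hcard : Fintype.card (subdivide D w).V = Fintype.card H.V) : IsIso (subdivide D w) H := by
  have hn := fun d => chn_nodes (L d) _ _ (hp.chain d)
  choose nd h0 h1 h2 using hn
  let F : (subdivide D w).V → H.V := fun v => match v with
    | Sum.inl q => Quot.lift κ (by
        rintro _ _ ⟨e, he, rfl, rfl⟩
        rw [← h0 e, ← h1 e, hw e, he]) q
    | Sum.inr ⟨d, j⟩ => nd d (j.val + 1)
  have hF : ∀ d j, j ≤ w d → F (chainNode D w d j) = nd d j := by
    intro d j hj
    unfold chainNode
    split_ifs with h h'
    · show nd d (j - 1 + 1) = _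
      congr 1; omega
    · subst h'
      exact (h0 d).symm
    · have : j = w d := by omega
      rw [this, ← hw d]
      exact (h1 d).symm
  let E : (subdivide D w).E → H.E := fun e => (L e.1)[e.2.val]'(by rw [hw]; exact e.2.2)
  have hE : Function.Surjective E := by
    intro e
    obtain ⟨d, hd⟩ := hp.cover e
    obtain ⟨j, hj, rfl⟩ := List.getElem_of_mem hd
    exact ⟨⟨d, ⟨j, by rw [← hw]; exact hj⟩⟩, rfl⟩
  have hEb : Function.Bijective E := by
    rw [Fintype.bijective_iff_surjective_and_card]
    refine ⟨hE, ?_⟩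
    rw [sub_card_E, ← hp.sum_len]
    exact Finset.sum_congr rfl fun d _ => (hw d).symm
  have hj : ∀ e : (subdivide D w).E, joins H (E e) (F ((subdivide D w).src e)) (F ((subdivide D w).tgt e)) := by
    rintro ⟨d, j⟩
    have e1 : F ((subdivide D w).src ⟨d, j⟩) = nd d j.val := hF d j.val j.2.le
    have e2 : F ((subdivide D w).tgt ⟨d, j⟩) = nd d (j.val + 1) := hF d (j.val + 1) j.2
    rw [e1, e2]
    exact h2 d j.val _
  have hFs : Function.Surjective F := by
    obtain ⟨v0⟩ := hne
    let x0 : (subdivide D w).V := Sum.inl (Quot.mk _ v0)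
    intro y
    have := hc (fun x => if x ∈ Set.range F then 1 else 0) (fun e => by
      obtain ⟨e', rfl⟩ := hE e
      have a1 : F ((subdivide D w).src e') ∈ Set.range F := ⟨_, rfl⟩
      have a2 : F ((subdivide D w).tgt e') ∈ Set.range F := ⟨_, rfl⟩
      rcases hj e' with ⟨b1, b2⟩ | ⟨b1, b2⟩
      · rw [b1, b2, if_pos a1, if_pos a2]
      · rw [b1, b2, if_pos a1, if_pos a2]) y (F x0)
    by_contra hy
    have hy' : y ∉ Set.range F := hy
    rw [if_neg hy', if_pos (Set.mem_range_self x0)] at this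
    exact absurd this (by decide)
  have hFb : Function.Bijective F := by
    rw [Fintype.bijective_iff_surjective_and_card]
    exact ⟨hFs, hcard⟩
  exact ⟨Equiv.ofBijective F hFb, Equiv.ofBijective E hEb, hj⟩

lemma iso_GG {H : Multigraph} {n m : ℕ} (hm : m = n + 3) (hn : 1 ≤ n) (hH : memG H n m)
    {κ : K33.V → H.V} {L : K33.E → List H.E} (hp : Pres K33 H κ L)
    (hpm : PM (fun i j => (L (i, j)).length) (w0 m)) : IsIso (GG m) H := by
  have h1 := iso_of_PM (fun d => (L d).length) m hpm
  refine h1.trans' (iso_of_pres hp ⟨Sum.inl 0⟩ ?_ _ (fun _ => rfl) ?_)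
  · intro f hf
    exact (connOn_iff H _).1 hH.2.2 f (fun e _ => hf e)
  · obtain ⟨⟨v, _, _⟩⟩ := h1
    rw [← Fintype.card_congr v]
    have := (GG_mem n m hn hm).1
    have h2 := hH.1
    unfold Multigraph.nV at this h2
    omega

lemma sum_prism (f : prism.E → ℕ) (i : Fin 3) : ∑ d, f d =
    f (.inl (i + 1, false)) + f (.inl (i + 2, false)) + f (.inl (i, false)) +
    f (.inl (i + 1, true)) + f (.inl (i + 2, true)) + f (.inl (i, true)) +
    f (.inr i) + f (.inr (i + 1)) + f (.inr (i + 2)) := by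
  have h : ∀ f : (Fin 3 × Bool) ⊕ Fin 3 → ℕ, ∑ d, f d =
    f (.inl (i + 1, false)) + f (.inl (i + 2, false)) + f (.inl (i, false)) +
    f (.inl (i + 1, true)) + f (.inl (i + 2, true)) + f (.inl (i, true)) +
    f (.inr i) + f (.inr (i + 1)) + f (.inr (i + 2)) := by
    intro f
    rw [Fintype.sum_sum_type, Fintype.sum_prod_type]
    simp only [Fin.sum_univ_three, Fintype.sum_bool]
    fin_cases i
    · show _ = f (.inl (1, false)) + f (.inl (2, false)) + f (.inl (0, false)) +
        f (.inl (1, true)) + f (.inl (2, true)) + f (.inl (0, true)) +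
        f (.inr 0) + f (.inr 1) + f (.inr 2)
      ring
    · show _ = f (.inl (2, false)) + f (.inl (0, false)) + f (.inl (1, false)) +
        f (.inl (2, true)) + f (.inl (0, true)) + f (.inl (1, true)) +
        f (.inr 1) + f (.inr 2) + f (.inr 0)
      ring
    · show _ = f (.inl (0, false)) + f (.inl (1, false)) + f (.inl (2, false)) +
        f (.inl (0, true)) + f (.inl (1, true)) + f (.inl (2, true)) +
        f (.inr 2) + f (.inr 0) + f (.inr 1)
      ring
  exact (Fintype.sum_equiv (Equiv.refl _) _ _ (fun _ => rfl)).trans (h f)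

lemma pres_untwist {H : Multigraph} {κ : prism.V → H.V} {L : prism.E → List H.E} (hp : Pres prism H κ L)
    (i : Fin 3) (hz : L (.inr i) = []) : ∃ (κ' : K33.V → H.V) (L' : K33.E → List H.E), Pres K33 H κ' L' ∧
    (fun a b => (L' (a, b)).length) = tw0 (L (.inl (i + 1, false))).length (L (.inl (i + 2, false))).length
      (L (.inl (i, false))).length (L (.inl (i + 1, true))).length (L (.inl (i + 2, true))).length
      (L (.inl (i, true))).length 0 (L (.inr (i + 1))).length (L (.inr (i + 2))).length := by
  have hk : κ (i, false) = κ (i, true) := by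
    have := hp.chain (.inr i)
    rw [hz] at this
    exact this
  have i1 : i + 1 + 1 = i + 2 := by clear hz hk; revert i; decide
  have i2 : i + 2 + 1 = i := by clear hz hk i1; revert i; decide
  have i3 : ∀ j, j = i ∨ j = i + 1 ∨ j = i + 2 := by clear hz hk i1 i2; revert i; decide
  have cp0 : chn H (κ (i + 1, false)) (L (.inl (i + 1, false))) (κ (i + 2, false)) := by
    rw [← i1]; exact hp.chain (.inl (i + 1, false))
  have cq0 : chn H (κ (i + 1, true)) (L (.inl (i + 1, true))) (κ (i + 2, true)) := by
    rw [← i1]; exact hp.chain (.inl (i + 1, true))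
  have cp1 : chn H (κ (i + 2, false)) (L (.inl (i + 2, false))) (κ (i, false)) := by
    have := hp.chain (.inl (i + 2, false))
    have h : chn H (κ (i + 2, false)) (L (.inl (i + 2, false))) (κ (i + 2 + 1, false)) := this
    rwa [i2] at h
  have cq1 : chn H (κ (i + 2, true)) (L (.inl (i + 2, true))) (κ (i, true)) := by
    have := hp.chain (.inl (i + 2, true))
    have h : chn H (κ (i + 2, true)) (L (.inl (i + 2, true))) (κ (i + 2 + 1, true)) := this
    rwa [i2] at h
  have cp2 : chn H (κ (i, false)) (L (.inl (i, false))) (κ (i + 1, false)) := hp.chain (.inl (i, false))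
  have cq2 : chn H (κ (i, true)) (L (.inl (i, true))) (κ (i + 1, true)) := hp.chain (.inl (i, true))
  have cz1 : chn H (κ (i + 1, false)) (L (.inr (i + 1))) (κ (i + 1, true)) := hp.chain (.inr (i + 1))
  have cz2 : chn H (κ (i + 2, false)) (L (.inr (i + 2))) (κ (i + 2, true)) := hp.chain (.inr (i + 2))
  rw [← hk] at cq1 cq2
  let κ' : Fin 3 ⊕ Fin 3 → H.V := Sum.elim ![κ (i + 2, false), κ (i + 1, true), κ (i, false)]
    ![κ (i + 1, false), κ (i + 2, true), κ (i, false)]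
  let M : Fin 3 → Fin 3 → List H.E :=
    ![![(L (.inl (i + 1, false))).reverse, L (.inr (i + 2)), L (.inl (i + 2, false))],
      ![(L (.inr (i + 1))).reverse, L (.inl (i + 1, true)), (L (.inl (i, true))).reverse],
      ![L (.inl (i, false)), (L (.inl (i + 2, true))).reverse, []]]
  have hM : (fun a b => (M a b).length) = tw0 (L (.inl (i + 1, false))).length (L (.inl (i + 2, false))).length
      (L (.inl (i, false))).length (L (.inl (i + 1, true))).length (L (.inl (i + 2, true))).length
      (L (.inl (i, true))).length 0 (L (.inr (i + 1))).length (L (.inr (i + 2))).length := by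
    ext a b
    fin_cases a <;> fin_cases b <;> simp [M, tw0]
  have hch : ∀ a b, chn H (κ' (.inl a)) (M a b) (κ' (.inr b)) := by
    intro a b
    fin_cases a <;> fin_cases b
    · exact chn_reverse cp0
    · exact cz2
    · exact cp1
    · exact chn_reverse cz1
    · exact cq0
    · exact chn_reverse cq2
    · exact cp2
    · exact chn_reverse cq1
    · exact (rfl : κ (i, false) = κ (i, false))
  refine ⟨κ', fun d => M d.1 d.2, ⟨fun d => hch d.1 d.2, ?_, ?_⟩, hM⟩
  · intro e
    obtain ⟨d, hd⟩ := hp.cover e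
    have key : ∃ a b, e ∈ M a b := by
      rcases d with ⟨j, b⟩ | j
      · rcases i3 j with rfl | rfl | rfl <;> cases b
        · exact ⟨2, 0, hd⟩
        · exact ⟨1, 2, List.mem_reverse.2 hd⟩
        · exact ⟨0, 0, List.mem_reverse.2 hd⟩
        · exact ⟨1, 1, hd⟩
        · exact ⟨0, 2, hd⟩
        · exact ⟨2, 1, List.mem_reverse.2 hd⟩
      · rcases i3 j with rfl | rfl | rfl
        · rw [hz] at hd; exact absurd hd (by simp)
        · exact ⟨1, 0, List.mem_reverse.2 hd⟩
        · exact ⟨0, 1, hd⟩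
    obtain ⟨a, b, h⟩ := key
    exact ⟨(a, b), h⟩
  · rw [sum_K33, ← hp.sum_len, sum_prism _ i]
    have : (fun a b => (M (a, b).1 (a, b).2).length) = _ := hM
    rw [this]
    simp only [sz, tw0, hz]
    simp
    omega

lemma ind_ne {E : Type} [Fintype E] {ψ : E → Q4} {F : Finset E} (h : Ind ψ F) {d : E} (hd : d ∈ F) : ψ d ≠ 0 := by
  intro h0
  have := h (fun e => if e = d then 1 else 0) (fun e he => if_neg (fun (hh : e = d) => he (by rw [hh]; exact hd))) (by
    simp [Finset.sum_ite_eq', ite_smul, h0])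
  have := congrFun this d
  simp at this

lemma ind_ne2 {E : Type} [Fintype E] {ψ : E → Q4} {F : Finset E} (h : Ind ψ F) {d d' : E} (hd : d ∈ F) (hd' : d' ∈ F)
    (hne : d ≠ d') : ψ d ≠ ψ d' := by
  intro h0
  have := h (fun e => (if e = d then 1 else 0) + (if e = d' then 1 else 0)) (fun e he => by
    have n1 : e ≠ d := fun hh => he (by rw [hh]; exact hd)
    have n2 : e ≠ d' := fun hh => he (by rw [hh]; exact hd')
    simp [n1, n2]) (by
    simp only [add_smul, ite_smul, one_smul, zero_smul, Finset.sum_add_distrib, Finset.sum_ite_eq', mem_univ, if_true]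
    exact (q4_add_eq_zero _ _).2 h0)
  have := congrFun this d
  simp [hne] at this

def SepD (D : Multigraph) : Prop := ∀ ψ, Good D ψ → (∀ d, ψ d ≠ 0) ∧ Function.Injective ψ

lemma sep_of {D : Multigraph} (ε : Fin 9 ≃ D.E) (bs : List (List (Fin 9)))
    (hb : ∀ i j : Fin 9, chkL bs [i, j] = true)
    (h : ∀ ψ, Good D ψ → ∀ l : List (Fin 9), Ind ψ (l.toFinset.image ε) ↔ chkL bs l = true) : SepD D := by
  intro ψ hg
  have hI := fun i j => (h ψ hg [i, j]).2 (hb i j)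
  have m1 : ∀ i j, ε i ∈ ([i, j] : List (Fin 9)).toFinset.image ε := fun i j => mem_image_of_mem _ (by simp)
  have m2 : ∀ i j, ε j ∈ ([i, j] : List (Fin 9)).toFinset.image ε := fun i j => mem_image_of_mem _ (by simp)
  refine ⟨fun d => ?_, fun d d' he => ?_⟩
  · obtain ⟨i, rfl⟩ := ε.surjective d
    exact ind_ne (hI i i) (m1 i i)
  · by_contra hne
    obtain ⟨i, rfl⟩ := ε.surjective d
    obtain ⟨j, rfl⟩ := ε.surjective d'
    exact ind_ne2 (hI i j) (m1 i j) (m2 i j) hne he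

lemma sepK : SepD K33 := sep_of kE kBonds (by decide +kernel) (fun ψ hg l => by convert k_ind hg l)
lemma sepP : SepD prism := sep_of pE pBonds (by decide +kernel) (fun ψ hg l => by convert p_ind hg l)

lemma labStep {D H : Multigraph} (hD : SepD D) {φ : H.E → Q4} {X : D.E → ℕ} (hl : Lab D H φ X)
    (hs : ∑ d, X d = Fintype.card H.E) : (∀ e, φ e ≠ 0) ∧ ((∀ d, X d ≤ 1) → Function.Injective φ) ∧
    ((∀ d, 0 < X d) → Fintype.card D.E ≤ (univ.image φ).card) := by
  obtain ⟨ψ, ℓ, hg, h1, h2⟩ := hl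
  obtain ⟨hz, hi⟩ := hD ψ hg
  have hc := cls_sum ℓ
  simp only [h2] at hc
  have hn : (univ.filter fun e => ℓ e = none) = ∅ := by
    rw [← Finset.card_eq_zero]; omega
  have hex : ∀ e, ∃ d, ℓ e = some d := by
    intro e
    cases he : ℓ e with
    | none =>
      have : e ∈ (univ.filter fun e => ℓ e = none) := mem_filter.2 ⟨mem_univ _, he⟩
      rw [hn] at this; exact absurd this (by simp)
    | some d => exact ⟨d, rfl⟩
  choose g hgg using hex
  have hφ : ∀ e, φ e = ψ (g e) := fun e => by rw [h1, hgg]; rfl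
  refine ⟨fun e => by rw [hφ]; exact hz _, fun hX e e' he => ?_, fun hX => ?_⟩
  · rw [hφ, hφ] at he
    have hh := hi he
    have a1 : e ∈ cls ℓ (g e) := mem_filter.2 ⟨mem_univ _, hgg e⟩
    have a2 : e' ∈ cls ℓ (g e) := mem_filter.2 ⟨mem_univ _, by rw [hgg e', hh]⟩
    exact Finset.card_le_one.1 ((h2 (g e)).le.trans (hX _)) _ a1 _ a2
  · rw [← Finset.card_univ, ← Finset.card_image_of_injective univ hi]
    apply Finset.card_le_card
    intro x hx
    obtain ⟨d, _, rfl⟩ := mem_image.1 hx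
    have : 0 < (cls ℓ d).card := by rw [h2]; exact hX d
    obtain ⟨e, he⟩ := Finset.card_pos.1 this
    have := (mem_filter.1 he).2
    exact mem_image.2 ⟨e, mem_univ _, by rw [h1, this]; rfl⟩

abbrev cK (X : K33.E → ℕ) : Cfg := fun i j => X (i, j)

lemma NK_all {H : Multigraph} {φ : H.E → Q4} (h : Good H φ) {X : K33.E → ℕ} (hl : Lab K33 H φ X) :
    Nk H 4 = t4 (cK X) ∧ Nk H 3 = t3 (cK X) ∧ Nk H 2 = t2 (cK X) ∧ Nk H 1 = sz (cK X) ∧ Nk H 0 = 1 := by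
  simp only [Nk_K h hl, kSum4, kSum3, kSum2, kSum1, kSum0]
  exact ⟨rfl, rfl, rfl, rfl, trivial⟩

def pv (i : Fin 3) (g : ℕ → ℕ → ℕ → ℕ → ℕ → ℕ → ℕ → ℕ → ℕ → ℕ) (X : prism.E → ℕ) : ℕ :=
  g (X (.inl (i + 1, false))) (X (.inl (i + 2, false))) (X (.inl (i, false)))
    (X (.inl (i + 1, true))) (X (.inl (i + 2, true))) (X (.inl (i, true)))
    (X (.inr i)) (X (.inr (i + 1))) (X (.inr (i + 2)))

lemma NP_all {H : Multigraph} {φ : H.E → Q4} (h : Good H φ) {X : prism.E → ℕ} (hl : Lab prism H φ X) :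
    Nk H 4 = pv 0 PT4 X ∧ Nk H 3 = pv 0 PT3 X ∧ Nk H 2 = pv 0 T2 X ∧ Nk H 1 = ∑ d, X d ∧ Nk H 0 = 1 := by
  simp only [Nk_P h hl, pSum4, pSum3, pSum2, pSum1, pSum0]
  refine ⟨rfl, rfl, rfl, ?_, trivial⟩
  rw [sum_prism X 0]
  rfl

lemma N_bounds {H : Multigraph} {φ : H.E → Q4} (h : Good H φ) {m : ℕ} (hE : Fintype.card H.E = m) (hm : 5 ≤ m) :
    Nk H 4 ≤ f4 m ∧ Nk H 3 ≤ f3 m ∧ Nk H 2 ≤ f2 m ∧ Nk H 1 ≤ m ∧ Nk H 0 ≤ 1 := by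
  rcases exists_lab h with ⟨X, hl⟩ | ⟨X, hl⟩
  · obtain ⟨a, b, c, d, e⟩ := NK_all h hl
    have hs := hl.sum_le
    rw [sum_K33, hE] at hs
    rw [a, b, c, d, e]
    exact ⟨t4_weak _ _ hm hs, t3_weak _ _ hs, t2_weak _ _ hs, hs, le_rfl⟩
  · obtain ⟨a, b, c, d, e⟩ := NP_all h hl
    have hs := hl.sum_le
    rw [hE] at hs
    rw [a, b, c, d, e]
    rw [sum_prism X 0] at hs
    refine ⟨(PT4_bound _ _ _ _ _ _ _ _ _ m hm hs).1, PT3_bound _ _ _ _ _ _ _ _ _ m hs, ?_, ?_, le_rfl⟩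
    · exact t2_weak ![![_, _, _], ![_, _, _], ![_, _, _]] m (by rw [sz_tab]; exact hs)
    · rw [sum_prism X 0]; exact hs

def twP (i : Fin 3) (X : prism.E → ℕ) : Cfg :=
  tw0 (X (.inl (i + 1, false))) (X (.inl (i + 2, false))) (X (.inl (i, false)))
    (X (.inl (i + 1, true))) (X (.inl (i + 2, true))) (X (.inl (i, true)))
    0 (X (.inr (i + 1))) (X (.inr (i + 2)))

lemma pv_cyc (X : prism.E → ℕ) : ∀ i, pv i PT4 X = pv 0 PT4 X := by
  intro i
  have h1 : pv 1 PT4 X = pv 0 PT4 X := PT4_cyc _ _ _ _ _ _ _ _ _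
  have h2 : pv 2 PT4 X = pv 1 PT4 X := PT4_cyc _ _ _ _ _ _ _ _ _
  fin_cases i
  · rfl
  · exact h1
  · exact h2.trans h1

lemma prismKey (X : prism.E → ℕ) (m : ℕ) (hm : 5 ≤ m) (hs : ∑ d, X d ≤ m) (h4 : pv 0 PT4 X = f4 m) :
    ∑ d, X d = m ∧ ∃ i, X (.inr i) = 0 ∧ PM (twP i X) (w0 m) := by
  have hs' := hs
  rw [sum_prism X 0] at hs
  have hb := (PT4_bound _ _ _ _ _ _ _ _ _ m hm hs).2 h4
  have hsum : ∑ d, X d = m := by rw [sum_prism X 0]; exact hb.1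
  refine ⟨hsum, ?_⟩
  have hex : ∃ i, X (.inr i) = 0 := by
    rcases hb.2 with h | h | h
    · exact ⟨_, h⟩
    · exact ⟨_, h⟩
    · exact ⟨_, h⟩
  obtain ⟨i, hi⟩ := hex
  refine ⟨i, hi, ?_⟩
  have hsz : sz (twP i X) = m := by
    rw [twP, sz_tw0, ← hsum, sum_prism X i, hi]
  have ht : t4 (twP i X) = f4 m := by
    rw [← h4, ← pv_cyc X i, pv, hi]
    exact tw0_t4 _ _ _ _ _ _ _ _
  have := (t4_bound (twP i X) (by omega)).2
  rw [hsz] at this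
  exact this ht

lemma PM.le {Y : Cfg} {m : ℕ} (h : PM Y (w0 m)) (hm : m < 9) (i j : Fin 3) : Y i j ≤ 1 := by
  obtain ⟨σ, τ, h⟩ := h
  have := h (σ.symm i) (τ.symm j)
  simp only [Equiv.apply_symm_apply] at this
  rw [this, w0, Nat.div_eq_of_lt hm, pat]
  split_ifs <;> omega

lemma PM.pos {Y : Cfg} {m : ℕ} (h : PM Y (w0 m)) (hm : 9 ≤ m) (i j : Fin 3) : 0 < Y i j := by
  obtain ⟨σ, τ, h⟩ := h
  have := h (σ.symm i) (τ.symm j)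
  simp only [Equiv.apply_symm_apply] at this
  rw [this]
  exact w0_pos hm _ _

lemma fin3_cases (i j : Fin 3) : j = i ∨ j = i + 1 ∨ j = i + 2 := by revert i j; decide

lemma kKey (X : K33.E → ℕ) (m : ℕ) (hm : 5 ≤ m) (hs : ∑ d, X d ≤ m) (h4 : t4 (cK X) = f4 m) :
    ∑ d, X d = m ∧ PM (cK X) (w0 m) := by
  rw [sum_K33] at hs ⊢
  have : sz (cK X) = m := by
    by_contra hne
    have := t4_strict (cK X) m hm (lt_of_le_of_ne hs hne)
    omega
  refine ⟨this, ?_⟩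
  have h := (t4_bound (cK X) (by omega)).2
  rw [this] at h
  exact h h4

lemma eq_iso {H : Multigraph} {n m : ℕ} (hm : m = n + 3) (hn : 2 ≤ n) (hH : memG H n m) {φ : H.E → Q4} (h : Good H φ)
    (h4 : Nk H 4 = f4 m) : IsIso (GG m) H := by
  have hE : Fintype.card H.E = m := hH.2.1
  have hm5 : 5 ≤ m := by omega
  have hLP : LP2 K33 H φ ∨ LP2 prism H φ := by
    rcases exists_lab h with ⟨X, hl⟩ | ⟨X, hl⟩
    · have hs := hl.sum_le
      rw [hE] at hs
      obtain ⟨hsum, hpm⟩ := kKey X m hm5 hs ((NK_all h hl).1.symm.trans h4)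
      obtain ⟨a, b, c⟩ := labStep sepK hl (hsum.trans hE.symm)
      refine Uthm _ h a ?_ le_rfl
      rcases lt_or_ge m 9 with h9 | h9
      · exact Or.inl (b (fun d => hpm.le h9 d.1 d.2))
      · right
        rw [← card_K33E]
        exact c (fun d => hpm.pos h9 d.1 d.2)
    · have hs := hl.sum_le
      rw [hE] at hs
      obtain ⟨hsum, i, hi, hpm⟩ := prismKey X m hm5 hs ((NP_all h hl).1.symm.trans h4)
      obtain ⟨a, b, c⟩ := labStep sepP hl (hsum.trans hE.symm)
      refine Uthm _ h a ?_ le_rfl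
      rcases lt_or_ge m 9 with h9 | h9
      · left
        apply b
        rintro (⟨j, s⟩ | j)
        · rcases fin3_cases i j with rfl | rfl | rfl <;> cases s
          · exact hpm.le h9 2 0
          · exact hpm.le h9 1 2
          · exact hpm.le h9 0 0
          · exact hpm.le h9 1 1
          · exact hpm.le h9 0 2
          · exact hpm.le h9 2 1
        · rcases fin3_cases i j with rfl | rfl | rfl
          · rw [hi]; omega
          · exact hpm.le h9 1 0
          · exact hpm.le h9 0 1
      · exact absurd (hpm.pos h9 2 2) (lt_irrefl 0)
  rcases hLP with hLP | hLP
  · obtain ⟨κ, L, hp, hl⟩ := hLP.lab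
    have hs := hl.sum_le
    rw [hE] at hs
    exact iso_GG hm (by omega) hH hp (kKey _ m hm5 hs ((NK_all h hl).1.symm.trans h4)).2
  · obtain ⟨κ, L, hp, hl⟩ := hLP.lab
    have hs := hl.sum_le
    rw [hE] at hs
    obtain ⟨_, i, hi, hpm⟩ := prismKey _ m hm5 hs ((NP_all h hl).1.symm.trans h4)
    obtain ⟨κ', L', hp', hL⟩ := pres_untwist hp i (List.length_eq_zero_iff.1 hi)
    refine iso_GG hm (by omega) hH hp' ?_
    rw [hL]
    exact hpm

lemma memG.good {H : Multigraph} {n m : ℕ} (hm : m = n + 3) (hn : 1 ≤ n) (hH : memG H n m) : ∃ φ, Good H φ := by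
  obtain ⟨a, b, c⟩ := hH
  unfold Multigraph.nV at a
  unfold Multigraph.nE at b
  exact exists_good H (Fintype.card_pos_iff.1 (by omega)) c (by omega)

lemma iso_one {G H : Multigraph} {m : ℕ} (hG : memG G 1 m) (hH : memG H 1 m) : IsIso G H := by
  have a := hG.1; have b := hH.1; have c := hG.2.1; have d := hH.2.1
  unfold Multigraph.nV at a b
  unfold Multigraph.nE at c d
  have e1 := Fintype.equivOfCardEq (a.trans b.symm)
  have e2 := Fintype.equivOfCardEq (c.trans d.symm)
  have hs := Fintype.card_le_one_iff_subsingleton.1 b.le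
  exact ⟨e1, e2, fun e => Or.inl ⟨hs.elim _ _, hs.elim _ _⟩⟩

lemma strict {H : Multigraph} {n m : ℕ} (hm : m = n + 3) (hn : 1 ≤ n) (hH : memG H n m) (hi : ¬ IsIso (GG m) H) :
    (∀ p : ℝ, 0 < p → p < 1 → H.rel p < (GG m).rel p) ∧ H.treeCount < (GG m).treeCount := by
  have hG := GG_mem n m hn hm
  by_cases h1 : n = 1
  · subst h1
    exact absurd (iso_one hG hH) hi
  obtain ⟨φ, h⟩ := hH.good hm hn
  obtain ⟨φ', h', _⟩ := GG_good m (by omega)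
  obtain ⟨g4, g3, g2, g1, g0⟩ := GG_N m (by omega)
  obtain ⟨b4, b3, b2, b1, b0⟩ := N_bounds h hH.2.1 (by omega : 5 ≤ m)
  have hlt : Nk H 4 < f4 m := lt_of_le_of_ne b4 fun he => hi (eq_iso hm (by omega) hH h he)
  refine ⟨fun p hp0 hp1 => ?_, ?_⟩
  · rw [h.rel_eq, h'.rel_eq, hH.2.1, hG.2.1]
    have hq : 0 < 1 - p := by linarith
    refine Finset.sum_lt_sum (fun k hk => ?_) ⟨4, by simp, ?_⟩
    · refine mul_le_mul_of_nonneg_right ?_ (by positivity)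
      have hk5 := Finset.mem_range.1 hk
      interval_cases k
      · rw [g0]; exact_mod_cast b0
      · rw [g1]; exact_mod_cast b1
      · rw [g2]; exact_mod_cast b2
      · rw [g3]; exact_mod_cast b3
      · rw [g4]; exact_mod_cast b4
    · refine mul_lt_mul_of_pos_right ?_ (by positivity)
      rw [g4]; exact_mod_cast hlt
  · rw [h.treeCount_eq, h'.treeCount_eq, g4]; exact hlt

theorem uniquely_optimal_k3 (n m : ℕ) (hn : 1 ≤ n) (hm : m = n + 3) :
    ∃ (G : Multigraph) (w : K33.E → ℕ),
      UniquelyOptimal G n m ∧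
      (∀ H : Multigraph, memG H n m → ¬ IsIso G H → H.treeCount < G.treeCount) ∧
      IsWeakSubdivision G K33 w ∧ BalancedWeights w ∧ (∑ e : K33.E, w e) = m ∧
      k33Cond m w ∧
      (∀ (H : Multigraph) (w' : K33.E → ℕ), memG H n m →
        IsWeakSubdivision H K33 w' → BalancedWeights w' → (∑ e : K33.E, w' e) = m →
        k33Cond m w' → IsIso G H) := by
  refine ⟨GG m, W0 m, ⟨GG_mem n m hn hm, fun H hH hi => (strict hm hn hH hi).1⟩,
    fun H hH hi => (strict hm hn hH hi).2,
    ⟨zeroAcyclic_W0 m (by omega), ⟨Equiv.refl _, Equiv.refl _, fun e => Or.inl ⟨rfl, rfl⟩⟩⟩,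
    bal_W0 m, sum_W0 m, cond_W0 m, ?_⟩
  intro H w' hH hw hb hs hc
  exact (iso_of_PM w' m (pm_of_cond m w' hb hs hc)).trans' hw.2.symm'
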